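/- arXiv:2401.07987 — 3 statements merged into one kernel-verified Lean document; each statement's English description precedes it below -/
import Mathlib

section
/- Let R be a commutative noetherian ring with a dualizing module, let G be a Gorenstein injective R-module, and let k ≥ 0 be an integer. Then the submodule Σ_p Γ_p(G) of G, the sum of the p-torsion submodules over all prime ideals p of R of height k, is a Gorenstein injective R-module. -/
open CategoryTheory

universe u

/-- The `a`-torsion submodule `Γ_a(M) = {x ∈ M | a^n x = 0 for some n}`. -/
def torsionGamma {R : Type u} [CommRing R] (a : Ideal R) (M : Type u)
    [AddCommGroup M] [Module R M] : Submodule R M :=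
  ⨆ n : ℕ, Submodule.torsionBySet R M ((a ^ n : Ideal R) : Set R)

/-- Data witnessing that `G` is Gorenstein injective: a ℤ-indexed exact complex of
injective modules, remaining exact after `Hom_R(E', -)` for every injective `E'`,
with `G ≅ ker(E_0 → E_{-1})`. -/
structure GorensteinInjData (R : Type u) [CommRing R] (G : Type u)
    [AddCommGroup G] [Module R G] where
  E : ℤ → Type u
  [acg : ∀ i, AddCommGroup (E i)]
  [mod : ∀ i, Module R (E i)]
  d : ∀ i : ℤ, E (i + 1) →ₗ[R] E i
  inj : ∀ i, Module.Injective R (E i)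
  exact : ∀ i : ℤ, LinearMap.range (d (i + 1)) = LinearMap.ker (d i)
  homExact : ∀ (E' : Type u) [AddCommGroup E'] [Module R E'], Module.Injective R E' →
      ∀ (i : ℤ) (g : E' →ₗ[R] E (i + 1)),
        (d i).comp g = 0 ↔ ∃ f : E' →ₗ[R] E (i + 1 + 1), (d (i + 1)).comp f = g
  equiv : G ≃ₗ[R] LinearMap.ker (d (-1))

/-- An `R`-module `G` is Gorenstein injective. -/
def IsGorensteinInjective (R : Type u) [CommRing R] (G : Type u)
    [AddCommGroup G] [Module R G] : Prop :=
  Nonempty (GorensteinInjData R G)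

/-- Data witnessing that `M` is Gorenstein flat. -/
structure GorensteinFlatData (R : Type u) [CommRing R] (M : Type u)
    [AddCommGroup M] [Module R M] where
  F : ℤ → Type u
  [acg : ∀ i, AddCommGroup (F i)]
  [mod : ∀ i, Module R (F i)]
  d : ∀ i : ℤ, F (i + 1) →ₗ[R] F i
  flat : ∀ i, Module.Flat R (F i)
  exact : ∀ i : ℤ, LinearMap.range (d (i + 1)) = LinearMap.ker (d i)
  tensorExact : ∀ (E' : Type u) [AddCommGroup E'] [Module R E'], Module.Injective R E' →
      ∀ i : ℤ, LinearMap.range (LinearMap.lTensor E' (d (i + 1)))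
        = LinearMap.ker (LinearMap.lTensor E' (d i))
  equiv : M ≃ₗ[R] LinearMap.ker (d (-1))

/-- An `R`-module `M` is Gorenstein flat. -/
def IsGorensteinFlat (R : Type u) [CommRing R] (M : Type u)
    [AddCommGroup M] [Module R M] : Prop :=
  Nonempty (GorensteinFlatData R M)

/-- `E` is an injective hull of `M`: `E` is injective and admits an injective
linear map from `M` with essential image. -/
def IsInjectiveHull (R : Type u) [CommRing R] (M : Type u) [AddCommGroup M] [Module R M]
    (E : Type u) [AddCommGroup E] [Module R E] : Prop :=
  Module.Injective R E ∧ ∃ f : M →ₗ[R] E, Function.Injective f ∧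
    ∀ N : Submodule R E, N ≠ ⊥ → N ⊓ LinearMap.range f ≠ ⊥

/-- `D` is a dualizing module for `R`: finitely generated, of finite injective dimension,
the homothety map `R → Hom_R(D,D)` is bijective, and `Ext^i_R(D,D) = 0` for `i ≥ 1`. -/
def IsDualizingModule (R : Type u) [CommRing R] (D : Type u)
    [AddCommGroup D] [Module R D] : Prop :=
  Module.Finite R D ∧
  (∃ n : ℕ, ∀ (M : Type u) (_ : AddCommGroup M) (_ : Module R M), ∀ i : ℕ, n < i →
      Limits.IsZero (((Ext R (ModuleCat.{u} R) i).obj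
        (Opposite.op (ModuleCat.of R M))).obj (ModuleCat.of R D))) ∧
  Function.Bijective (fun r : R => (r • (LinearMap.id : D →ₗ[R] D))) ∧
  (∀ i : ℕ, 0 < i →
    Limits.IsZero (((Ext R (ModuleCat.{u} R) i).obj
      (Opposite.op (ModuleCat.of R D))).obj (ModuleCat.of R D)))

/-- The height of a prime ideal, as the `Order.height` of the corresponding
point of the prime spectrum. -/
noncomputable def idealHeight {R : Type u} [CommRing R] (p : Ideal R) (hp : p.IsPrime) : ℕ∞ :=
  Order.height (⟨p, hp⟩ : PrimeSpectrum R)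


section Aux
open scoped TensorProduct

variable {R : Type u} [CommRing R]

theorem aux_factor_surj {B C X : Type*} [AddCommGroup B] [AddCommGroup C] [AddCommGroup X]
    [Module R B] [Module R C] [Module R X] (p : B →ₗ[R] C) (hp : Function.Surjective p)
    (f : B →ₗ[R] X) (h : ∀ x, p x = 0 → f x = 0) : ∃ f' : C →ₗ[R] X, f'.comp p = f := by
  have hle : LinearMap.ker p ≤ LinearMap.ker f := fun x hx => h x hx
  refine ⟨((LinearMap.ker p).liftQ f hle).comp (p.quotKerEquivOfSurjective hp).symm.toLinearMap, ?_⟩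
  ext x
  have : (p.quotKerEquivOfSurjective hp).symm (p x) = (LinearMap.ker p).mkQ x := by
    rw [LinearEquiv.symm_apply_eq]; rfl
  simp only [LinearMap.comp_apply, LinearEquiv.coe_coe, this]
  rfl

theorem aux_ext_range {P Q J : Type u} [AddCommGroup P] [AddCommGroup Q] [AddCommGroup J]
    [Module R P] [Module R Q] [Module R J] (hJ : Module.Injective R J) (d : P →ₗ[R] Q)
    (f : P →ₗ[R] J) (h : ∀ x, d x = 0 → f x = 0) : ∃ f' : Q →ₗ[R] J, f'.comp d = f := by
  obtain ⟨f₁, hf₁⟩ := aux_factor_surj d.rangeRestrict d.surjective_rangeRestrict f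
    (fun x hx => h x (by simpa using congrArg Subtype.val hx))
  obtain ⟨f₂, hf₂⟩ := hJ.out (LinearMap.range d).subtype Subtype.val_injective f₁
  refine ⟨f₂, ?_⟩
  ext x
  have := hf₂ (d.rangeRestrict x)
  rw [← hf₁]
  exact this

theorem aux_codlift {N J C X : Type*} [AddCommGroup N] [AddCommGroup J] [AddCommGroup C]
    [AddCommGroup X] [Module R N] [Module R J] [Module R C] [Module R X]
    (ι : N →ₗ[R] J) (π : J →ₗ[R] C) (hι : Function.Injective ι) (he : Function.Exact ι π)
    (f : X →ₗ[R] J) (h : π.comp f = 0) : ∃ f' : X →ₗ[R] N, ι.comp f' = f := by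
  have hr : ∀ x, f x ∈ LinearMap.range ι := fun x => (he (f x)).1 (LinearMap.congr_fun h x)
  refine ⟨(LinearEquiv.ofInjective ι hι).symm.toLinearMap.comp (f.codRestrict _ hr), ?_⟩
  ext x
  have := LinearEquiv.apply_symm_apply (LinearEquiv.ofInjective ι hι) (f.codRestrict _ hr x)
  exact congrArg Subtype.val this

theorem aux_exists_res (M : Type u) [AddCommGroup M] [Module R M] :
    ∃ (P : ℕ → Type u) (_ : ∀ i, AddCommGroup (P i)) (_ : ∀ i, Module R (P i))
      (d : ∀ i, P (i + 1) →ₗ[R] P i) (ε : P 0 →ₗ[R] M),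
      (∀ i, Module.Projective R (P i)) ∧ Function.Surjective ε ∧ Function.Exact (d 0) ε ∧
      (∀ i, Function.Exact (d (i + 1)) (d i)) ∧
      ∀ (N : Type u) (_ : AddCommGroup N) (_ : Module R N) (j : ℕ),
        Limits.IsZero (((Ext R (ModuleCat.{u} R) (j + 1)).obj
          (Opposite.op (ModuleCat.of R M))).obj (ModuleCat.of R N)) →
        ∀ g : P (j + 1) →ₗ[R] N, g.comp (d (j + 1)) = 0 → ∃ h : P j →ₗ[R] N, h.comp (d j) = g := by
  let P : ProjectiveResolution (ModuleCat.of R M) := ProjectiveResolution.of _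
  refine ⟨fun i => P.complex.X i, fun i => inferInstance, fun i => inferInstance,
    fun i => (P.complex.d (i + 1) i).hom, (P.π.f 0).hom, ?_, ?_, ?_, ?_, ?_⟩
  · intro i
    exact (IsProjective.iff_projective (R := R) (P.complex.X i)).2 (P.projective i)
  · exact (ModuleCat.epi_iff_surjective (P.π.f 0)).1 inferInstance
  · have : (ShortComplex.mk _ _ P.complex_d_comp_π_f_zero).Exact :=
      ShortComplex.exact_of_g_is_cokernel _ P.isColimitCokernelCofork
    exact (ShortComplex.ShortExact.moduleCat_exact_iff_function_exact _).1 this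
  · intro i
    exact (ShortComplex.ShortExact.moduleCat_exact_iff_function_exact _).1 (P.exact_succ i)
  · intro N _ _ j hz g hg
    have h1 := hz.of_iso (P.isoExt (R := R) (j + 1) (ModuleCat.of R N)).symm
    rw [← HomologicalComplex.exactAt_iff_isZero_homology,
      HomologicalComplex.exactAt_iff' _ j (j + 1) (j + 2) (by simp) (by simp),
      ShortComplex.moduleCat_exact_iff] at h1
    obtain ⟨h, hh⟩ := h1 (ModuleCat.ofHom g) (by
      apply ModuleCat.hom_ext
      exact hg)
    refine ⟨ModuleCat.Hom.hom h, ?_⟩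
    exact congrArg ModuleCat.Hom.hom hh

theorem aux_exists_inj (M : Type u) [AddCommGroup M] [Module R M] :
    ∃ (J : Type u) (_ : AddCommGroup J) (_ : Module R J) (ι : M →ₗ[R] J),
      Module.Injective R J ∧ Function.Injective ι := by
  obtain ⟨⟨J, hJ, f, hf⟩⟩ := EnoughInjectives.presentation (ModuleCat.of R M)
  exact ⟨J, inferInstance, inferInstance, f.hom, Module.injective_module_of_injective_object R J,
    (ModuleCat.mono_iff_injective f).1 hf⟩

/-- `C` has a finite injective coresolution of length `n` on which `Hom(D,-)` is exact. -/
inductive AuxGood (D : Type u) [AddCommGroup D] [Module R D] :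
    ℕ → ∀ (C : Type u) [AddCommGroup C] [Module R C], Prop
  | inj (C : Type u) [AddCommGroup C] [Module R C] (h : Module.Injective R C) : AuxGood D 0 C
  | step (n : ℕ) (C J C' : Type u) [AddCommGroup C] [Module R C] [AddCommGroup J] [Module R J]
      [AddCommGroup C'] [Module R C'] (ι : C →ₗ[R] J) (π : J →ₗ[R] C')
      (hJ : Module.Injective R J) (hι : Function.Injective ι) (hπ : Function.Surjective π)
      (he : Function.Exact ι π) (hl : ∀ f : D →ₗ[R] C', ∃ f' : D →ₗ[R] J, π.comp f' = f)
      (h : AuxGood D n C') : AuxGood D (n + 1) C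

/-- elementary form of vanishing of `Ext^(j+1)(M,N)`. -/
def AuxV (M : Type u) [AddCommGroup M] [Module R M] (P : ℕ → Type u) [∀ i, AddCommGroup (P i)]
    [∀ i, Module R (P i)] (d : ∀ i, P (i + 1) →ₗ[R] P i) (j : ℕ) (N : Type u)
    [AddCommGroup N] [Module R N] : Prop :=
  ∀ g : P (j + 1) →ₗ[R] N, g.comp (d (j + 1)) = 0 → ∃ h : P j →ₗ[R] N, h.comp (d j) = g

theorem AuxV.shift {M : Type u} [AddCommGroup M] [Module R M] {P : ℕ → Type u}
    [∀ i, AddCommGroup (P i)] [∀ i, Module R (P i)] {d : ∀ i, P (i + 1) →ₗ[R] P i}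
    (hP : ∀ i, Module.Projective R (P i)) (hd : ∀ i, Function.Exact (d (i + 1)) (d i))
    {N J C : Type u} [AddCommGroup N] [Module R N] [AddCommGroup J] [Module R J]
    [AddCommGroup C] [Module R C] (ι : N →ₗ[R] J) (π : J →ₗ[R] C) (hJ : Module.Injective R J)
    (hι : Function.Injective ι) (hπ : Function.Surjective π) (he : Function.Exact ι π) (j : ℕ)
    (h : AuxV M P d (j + 1) N) : AuxV M P d j C := by
  intro g hg
  have := hP (j + 1)
  obtain ⟨g', hg'⟩ := Module.projective_lifting_property π g hπ
  obtain ⟨k, hk⟩ := aux_codlift ι π hι he (g'.comp (d (j + 1))) (by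
    rw [← LinearMap.comp_assoc, hg', hg])
  obtain ⟨m, hm⟩ := h k (by
    ext x
    apply hι
    have h1 := LinearMap.congr_fun hk (d (j + 1 + 1) x)
    simp only [LinearMap.comp_apply] at h1
    rw [(hd (j + 1)).apply_apply_eq_zero, map_zero] at h1
    simpa using h1)
  obtain ⟨q, hq⟩ := aux_ext_range hJ (d j) (g' - ι.comp m) (by
    intro x hx
    obtain ⟨y, rfl⟩ := (hd j x).1 hx
    have h1 := LinearMap.congr_fun hk y
    rw [← hm] at h1
    simp only [LinearMap.comp_apply] at h1
    simp [h1])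
  refine ⟨π.comp q, ?_⟩
  rw [LinearMap.comp_assoc, hq, LinearMap.comp_sub, hg', ← LinearMap.comp_assoc,
    he.linearMap_comp_eq_zero, LinearMap.zero_comp, sub_zero]

theorem AuxV.lift {M : Type u} [AddCommGroup M] [Module R M] {P : ℕ → Type u}
    [∀ i, AddCommGroup (P i)] [∀ i, Module R (P i)] {d : ∀ i, P (i + 1) →ₗ[R] P i}
    (hP : ∀ i, Module.Projective R (P i)) (hd : ∀ i, Function.Exact (d (i + 1)) (d i))
    {ε : P 0 →ₗ[R] M} (hε : Function.Surjective ε) (hε' : Function.Exact (d 0) ε)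
    {N J C : Type u} [AddCommGroup N] [Module R N] [AddCommGroup J] [Module R J]
    [AddCommGroup C] [Module R C] (ι : N →ₗ[R] J) (π : J →ₗ[R] C)
    (hι : Function.Injective ι) (hπ : Function.Surjective π) (he : Function.Exact ι π)
    (h : AuxV M P d 0 N) (g : M →ₗ[R] C) : ∃ f : M →ₗ[R] J, π.comp f = g := by
  have := hP 0
  obtain ⟨g', hg'⟩ := Module.projective_lifting_property π (g.comp ε) hπ
  obtain ⟨k, hk⟩ := aux_codlift ι π hι he (g'.comp (d 0)) (by
    rw [← LinearMap.comp_assoc, hg', LinearMap.comp_assoc, hε'.linearMap_comp_eq_zero,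
      LinearMap.comp_zero])
  obtain ⟨m, hm⟩ := h k (by
    ext x
    apply hι
    have h1 := LinearMap.congr_fun hk (d (0 + 1) x)
    simp only [LinearMap.comp_apply] at h1
    rw [(hd 0).apply_apply_eq_zero, map_zero] at h1
    simpa using h1)
  obtain ⟨q, hq⟩ := aux_factor_surj ε hε (g' - ι.comp m) (by
    intro x hx
    obtain ⟨y, rfl⟩ := (hε' x).1 hx
    have h1 := LinearMap.congr_fun hk y
    rw [← hm] at h1
    simp only [LinearMap.comp_apply] at h1
    simp [h1])
  refine ⟨q, ?_⟩
  ext x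
  obtain ⟨y, rfl⟩ := hε x
  have h2 : (π.comp (q.comp ε)) y = (g.comp ε) y := by
    rw [hq, LinearMap.comp_sub, hg', ← LinearMap.comp_assoc,
      he.linearMap_comp_eq_zero, LinearMap.zero_comp, sub_zero]
  exact h2

theorem aux_good_of {D : Type u} [AddCommGroup D] [Module R D] {P : ℕ → Type u}
    [∀ i, AddCommGroup (P i)] [∀ i, Module R (P i)] {d : ∀ i, P (i + 1) →ₗ[R] P i}
    (hP : ∀ i, Module.Projective R (P i)) (hd : ∀ i, Function.Exact (d (i + 1)) (d i))
    {ε : P 0 →ₗ[R] D} (hε : Function.Surjective ε) (hε' : Function.Exact (d 0) ε) (n : ℕ) :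
    ∀ (C : Type u) [AddCommGroup C] [Module R C], (∀ j, AuxV D P d j C) →
      (∀ (M : Type u) (_ : AddCommGroup M) (_ : Module R M),
        ∃ (Q : ℕ → Type u) (_ : ∀ i, AddCommGroup (Q i)) (_ : ∀ i, Module R (Q i))
          (e : ∀ i, Q (i + 1) →ₗ[R] Q i) (ε : Q 0 →ₗ[R] M),
          (∀ i, Module.Projective R (Q i)) ∧ Function.Surjective ε ∧ Function.Exact (e 0) ε ∧
          (∀ i, Function.Exact (e (i + 1)) (e i)) ∧ AuxV M Q e n C) →
      AuxGood (R := R) D n C := by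
  induction n with
  | zero =>
    intro C _ _ _ h
    refine AuxGood.inj C ?_
    obtain ⟨J, _, _, ι, hJ, hι⟩ := aux_exists_inj (R := R) C
    obtain ⟨Q, _, _, e, ε', hQ, h1, h2, h3, h4⟩ := h (J ⧸ LinearMap.range ι) _ _
    obtain ⟨s, hs⟩ := AuxV.lift hQ h3 h1 h2 ι (LinearMap.range ι).mkQ hι
      (Submodule.mkQ_surjective _) (LinearMap.exact_map_mkQ_range ι) h4 LinearMap.id
    obtain ⟨r, hr⟩ := aux_codlift ι (LinearMap.range ι).mkQ hι (LinearMap.exact_map_mkQ_range ι)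
      (LinearMap.id - s.comp (LinearMap.range ι).mkQ) (by
        rw [LinearMap.comp_sub, ← LinearMap.comp_assoc, hs]; simp)
    have hri : ∀ x, r (ι x) = x := by
      intro x
      apply hι
      have := LinearMap.congr_fun hr (ι x)
      have h0 : (LinearMap.range ι).mkQ (ι x) = 0 := by simp
      simp only [LinearMap.comp_apply, LinearMap.sub_apply, LinearMap.id_apply, h0, map_zero,
        sub_zero] at this
      exact this
    constructor
    intro X Y _ _ _ _ f hf g
    obtain ⟨k, hk⟩ := hJ.out f hf (ι.comp g)
    exact ⟨r.comp k, fun x => by simp [hk, hri]⟩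
  | succ n ih =>
    intro C _ _ hC h
    obtain ⟨J, _, _, ι, hJ, hι⟩ := aux_exists_inj (R := R) C
    refine AuxGood.step n C J (J ⧸ LinearMap.range ι) ι (LinearMap.range ι).mkQ hJ hι
      (Submodule.mkQ_surjective _) (LinearMap.exact_map_mkQ_range ι) ?_ ?_
    · exact AuxV.lift hP hd hε hε' ι (LinearMap.range ι).mkQ hι
        (Submodule.mkQ_surjective _) (LinearMap.exact_map_mkQ_range ι) (hC 0)
    · refine ih _ (fun j => ?_) ?_
      · exact AuxV.shift hP hd ι (LinearMap.range ι).mkQ hJ hι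
          (Submodule.mkQ_surjective _) (LinearMap.exact_map_mkQ_range ι) j (hC _)
      · intro M _ _
        obtain ⟨Q, i1, i2, e, ε', hQ, h1, h2, h3, h4⟩ := h M _ _
        exact ⟨Q, i1, i2, e, ε', hQ, h1, h2, h3, AuxV.shift hQ h3 ι (LinearMap.range ι).mkQ hJ hι
          (Submodule.mkQ_surjective _) (LinearMap.exact_map_mkQ_range ι) n h4⟩

theorem aux_good_of_dualizing (D : Type u) [AddCommGroup D] [Module R D]
    (hD : IsDualizingModule R D) : ∃ n, AuxGood (R := R) D n D := by
  obtain ⟨_, ⟨n, hn⟩, _, h⟩ := hD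
  refine ⟨n, ?_⟩
  obtain ⟨P, _, _, d, ε, hP, h1, h2, h3, h4⟩ := aux_exists_res (R := R) D
  refine aux_good_of hP h3 h1 h2 n D (fun j => h4 D _ _ j (h (j + 1) (Nat.succ_pos _))) ?_
  intro M _ _
  obtain ⟨Q, i1, i2, e, ε', hQ, k1, k2, k3, k4⟩ := aux_exists_res (R := R) M
  exact ⟨Q, i1, i2, e, ε', hQ, k1, k2, k3, k4 D _ _ n (hn M _ _ (n + 1) (Nat.lt_succ_self _))⟩


section Cplx
variable {X : ℤ → Type u} [∀ i, AddCommGroup (X i)] [∀ i, Module R (X i)]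
  (d : ∀ i : ℤ, X (i + 1) →ₗ[R] X i)

/-- `Hom(M, X)` is exact. -/
def AuxInC (M : Type u) [AddCommGroup M] [Module R M] : Prop :=
  ∀ (i : ℤ) (g : M →ₗ[R] X (i + 1)), (d i).comp g = 0 →
    ∃ f : M →ₗ[R] X (i + 1 + 1), (d (i + 1)).comp f = g

variable {d}

theorem AuxInC.retract {M M' : Type u} [AddCommGroup M] [Module R M] [AddCommGroup M'] [Module R M']
    (s : M →ₗ[R] M') (r : M' →ₗ[R] M) (h : r.comp s = LinearMap.id) (hM : AuxInC d M') :
    AuxInC d M := by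
  intro i g hg
  obtain ⟨f, hf⟩ := hM i (g.comp r) (by rw [← LinearMap.comp_assoc, hg, LinearMap.zero_comp])
  exact ⟨f.comp s, by rw [← LinearMap.comp_assoc, hf, LinearMap.comp_assoc, h, LinearMap.comp_id]⟩

theorem AuxInC.equiv {M M' : Type u} [AddCommGroup M] [Module R M] [AddCommGroup M'] [Module R M']
    (e : M ≃ₗ[R] M') (hM : AuxInC d M') : AuxInC d M :=
  AuxInC.retract e.toLinearMap e.symm.toLinearMap (by ext; simp) hM

theorem AuxInC.finsupp {M : Type u} [AddCommGroup M] [Module R M] (S : Type u)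
    (hM : AuxInC d M) : AuxInC d (S →₀ M) := by
  intro i g hg
  have : ∀ s : S, ∃ f : M →ₗ[R] X (i + 1 + 1),
      (d (i + 1)).comp f = g.comp (Finsupp.lsingle s) := fun s =>
    hM i _ (by rw [← LinearMap.comp_assoc, hg, LinearMap.zero_comp])
  choose f hf using this
  refine ⟨Finsupp.lsum R f, ?_⟩
  ext s m
  simpa using LinearMap.congr_fun (hf s) m

variable (hX : ∀ i, Module.Injective R (X i)) (hd : ∀ i, (d i).comp (d (i + 1)) = 0)

include hX hd in
theorem AuxInC.right {A B C : Type u} [AddCommGroup A] [Module R A] [AddCommGroup B] [Module R B]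
    [AddCommGroup C] [Module R C] (ι : A →ₗ[R] B) (p : B →ₗ[R] C) (hι : Function.Injective ι)
    (hp : Function.Surjective p) (he : Function.Exact ι p) (hA : AuxInC d A) (hB : AuxInC d B) :
    AuxInC d C := by
  intro i g hg
  obtain ⟨f, hf⟩ := hB i (g.comp p) (by rw [← LinearMap.comp_assoc, hg, LinearMap.zero_comp])
  obtain ⟨k, hk⟩ := hA (i + 1) (f.comp ι) (by
    rw [← LinearMap.comp_assoc, hf, LinearMap.comp_assoc, he.linearMap_comp_eq_zero,
      LinearMap.comp_zero])
  obtain ⟨k', hk'⟩ := (hX _).out ι hι k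
  obtain ⟨q, hq⟩ := aux_factor_surj p hp (f - (d (i + 1 + 1)).comp k') (by
    intro x hx
    obtain ⟨y, rfl⟩ := (he x).1 hx
    have := LinearMap.congr_fun hk y
    simp only [LinearMap.comp_apply] at this
    simp [hk', this])
  refine ⟨q, ?_⟩
  ext x
  obtain ⟨y, rfl⟩ := hp x
  have : ((d (i + 1)).comp (q.comp p)) y = (g.comp p) y := by
    rw [hq, LinearMap.comp_sub, hf, ← LinearMap.comp_assoc, hd, LinearMap.zero_comp, sub_zero]
  exact this

include hX hd in
theorem AuxInC.left {A B C : Type u} [AddCommGroup A] [Module R A] [AddCommGroup B] [Module R B]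
    [AddCommGroup C] [Module R C] (ι : A →ₗ[R] B) (p : B →ₗ[R] C) (hι : Function.Injective ι)
    (hp : Function.Surjective p) (he : Function.Exact ι p) (hB : AuxInC d B) (hC : AuxInC d C) :
    AuxInC d A := by
  intro i g hg
  obtain ⟨j, rfl⟩ : ∃ j, i = j + 1 := ⟨i - 1, by ring⟩
  obtain ⟨g', hg'⟩ := (hX _).out ι hι g
  obtain ⟨k, hk⟩ := aux_factor_surj p hp ((d (j + 1)).comp g') (by
    intro x hx
    obtain ⟨y, rfl⟩ := (he x).1 hx
    simpa [hg'] using LinearMap.congr_fun hg y)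
  obtain ⟨f, hf⟩ := hC j k (by
    ext x
    obtain ⟨y, rfl⟩ := hp x
    have h1 := LinearMap.congr_fun hk y
    simp only [LinearMap.comp_apply] at h1
    simpa [h1] using LinearMap.congr_fun (hd j) (g' y))
  obtain ⟨m, hm⟩ := hB (j + 1) (g' - f.comp p) (by
    rw [LinearMap.comp_sub, ← LinearMap.comp_assoc, hf, hk, sub_self])
  refine ⟨m.comp ι, ?_⟩
  rw [← LinearMap.comp_assoc, hm, LinearMap.sub_comp, LinearMap.comp_assoc,
    he.linearMap_comp_eq_zero, LinearMap.comp_zero, sub_zero]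
  ext x
  simp [hg']

include hX hd in
theorem AuxInC.of_good {D : Type u} [AddCommGroup D] [Module R D]
    (hI : ∀ (I : Type u) [AddCommGroup I] [Module R I], Module.Injective R I → AuxInC d I)
    {n : ℕ} {C : Type u} [AddCommGroup C] [Module R C] (h : AuxGood (R := R) D n C) :
    AuxInC d C := by
  induction h with
  | inj C h => exact hI C h
  | step n C J C' ι π hJ hι hπ he hl h ih => exact AuxInC.left hX hd ι π hι hπ he (hI J hJ) ih

end Cplx

section Tens
variable [IsNoetherianRing R]

omit [IsNoetherianRing R] in
theorem aux_flat_ker {K P F : Type u} [AddCommGroup K] [Module R K] [AddCommGroup P] [Module R P]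
    [AddCommGroup F] [Module R F] (ι : K →ₗ[R] P) (p : P →ₗ[R] F) (hι : Function.Injective ι)
    (hp : Function.Surjective p) (he : Function.Exact ι p) [Module.Flat R P] [Module.Flat R F] :
    Module.Flat R K := by
  rw [Module.Flat.iff_rTensor_preserves_injective_linearMap]
  intro N N' _ _ _ _ L hL
  have h1 := LinearMap.lTensor_injective_of_exact_of_flat p hp ι hι he N
  have h2 := Module.Flat.rTensor_preserves_injective_linearMap (M := P) L hL
  have h3 : (ι.lTensor N').comp (L.rTensor K) = (L.rTensor P).comp (ι.lTensor N) := by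
    ext; simp
  have h4 : Function.Injective ((ι.lTensor N').comp (L.rTensor K)) := by
    rw [h3]; exact h2.comp h1
  exact Function.Injective.of_comp (f := ι.lTensor N') h4

/-- evaluation map `Hom(M,N) ⊗ F → Hom(M, N ⊗ F)`. -/
theorem aux_hom_tensor_surj (M N F : Type u) [AddCommGroup M] [Module R M] [AddCommGroup N]
    [Module R N] [AddCommGroup F] [Module R F] [Module.Finite R M] [Module.Flat R F] :
    Function.Surjective (TensorProduct.rTensorHomToHomRTensor (.id R) M N F) := by
  intro φ
  obtain ⟨n, p, hp⟩ := Module.Finite.exists_fin' R M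
  obtain ⟨m, q, hq⟩ := Module.Finite.exists_fin' R (LinearMap.ker p)
  let q' : (Fin m → R) →ₗ[R] (Fin n → R) := (LinearMap.ker p).subtype.comp q
  have hq' : ∀ x, p x = 0 → ∃ y, q' y = x := fun x hx => by
    obtain ⟨y, hy⟩ := hq ⟨x, hx⟩
    exact ⟨y, by simp [q', hy]⟩
  have hpq : p.comp q' = 0 := by
    ext i; simp [q']
  have hex : Function.Exact (LinearMap.lcomp R N p) (LinearMap.lcomp R N q') := by
    intro f
    constructor
    · intro hf
      obtain ⟨f', hf'⟩ := aux_factor_surj p hp f (fun x hx => by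
        obtain ⟨y, rfl⟩ := hq' x hx
        exact LinearMap.congr_fun hf y)
      exact ⟨f', hf'⟩
    · rintro ⟨f', rfl⟩
      show (f'.comp p).comp q' = 0
      rw [LinearMap.comp_assoc, hpq, LinearMap.comp_zero]
  have hex' := Module.Flat.rTensor_exact (R := R) F hex
  obtain ⟨t, ht⟩ := (rTensorHomEquivHomRTensor R (Fin n → R) N F).surjective (φ.comp p)
  rw [rTensorHomEquivHomRTensor_apply] at ht
  have nat : ∀ {A B : Type u} [AddCommGroup A] [Module R A] [AddCommGroup B] [Module R B]
      (u : A →ₗ[R] B) (t : (B →ₗ[R] N) ⊗[R] F),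
      TensorProduct.rTensorHomToHomRTensor (.id R) A N F ((LinearMap.lcomp R N u).rTensor F t) =
      (TensorProduct.rTensorHomToHomRTensor (.id R) B N F t).comp u := by
    intro A B _ _ _ _ u t
    induction t with
    | zero => simp
    | add x y hx hy => simp only [map_add, hx, hy, LinearMap.add_comp]
    | tmul f x => ext a; simp
  have h0 : (LinearMap.lcomp R N q').rTensor F t = 0 := by
    apply (rTensorHomEquivHomRTensor R (Fin m → R) N F).injective
    rw [rTensorHomEquivHomRTensor_apply, nat, ht, LinearMap.comp_assoc, hpq, map_zero,
      LinearMap.comp_zero]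
  obtain ⟨s, rfl⟩ := (hex' t).1 h0
  refine ⟨s, ?_⟩
  rw [nat] at ht
  ext x
  obtain ⟨y, rfl⟩ := hp x
  exact LinearMap.congr_fun ht y

theorem aux_lift_tensor {M N N' F : Type u} [AddCommGroup M] [Module R M] [AddCommGroup N]
    [Module R N] [AddCommGroup N'] [Module R N'] [AddCommGroup F] [Module R F] [Module.Finite R M]
    [Module.Flat R F] (π : N →ₗ[R] N')
    (h : ∀ f : M →ₗ[R] N', ∃ f' : M →ₗ[R] N, π.comp f' = f) (f : M →ₗ[R] N' ⊗[R] F) :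
    ∃ f' : M →ₗ[R] N ⊗[R] F, (π.rTensor F).comp f' = f := by
  obtain ⟨t, rfl⟩ := aux_hom_tensor_surj M N' F f
  induction t with
  | zero => exact ⟨0, by simp⟩
  | add x y hx hy =>
    obtain ⟨a, ha⟩ := hx
    obtain ⟨b, hb⟩ := hy
    exact ⟨a + b, by rw [LinearMap.comp_add, ha, hb, map_add]⟩
  | tmul g x =>
    obtain ⟨g', rfl⟩ := h g
    exact ⟨TensorProduct.rTensorHomToHomRTensor (.id R) M N F (g' ⊗ₜ x), by ext; simp⟩

theorem aux_inj_tensor {J F : Type u} [AddCommGroup J] [Module R J] [AddCommGroup F] [Module R F]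
    [Module.Flat R F] (hJ : Module.Injective R J) : Module.Injective R (J ⊗[R] F) := by
  apply Module.Baer.injective
  intro I g
  obtain ⟨t, rfl⟩ := aux_hom_tensor_surj I J F g
  induction t with
  | zero => exact ⟨0, by simp⟩
  | add x y hx hy =>
    obtain ⟨a, ha⟩ := hx
    obtain ⟨b, hb⟩ := hy
    exact ⟨a + b, fun x hx => by rw [LinearMap.add_apply, ha x hx, hb x hx, map_add]; rfl⟩
  | tmul g x =>
    obtain ⟨g', hg'⟩ := hJ.out I.subtype Subtype.val_injective g
    refine ⟨TensorProduct.rTensorHomToHomRTensor (.id R) R J F (g' ⊗ₜ x), fun y hy => ?_⟩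
    have := hg' ⟨y, hy⟩
    simp only [Submodule.subtype_apply] at this
    simp [this]

theorem AuxGood.tensor {D : Type u} [AddCommGroup D] [Module R D] [Module.Finite R D]
    {n : ℕ} {C : Type u} [AddCommGroup C] [Module R C] (h : AuxGood (R := R) D n C)
    (F : Type u) [AddCommGroup F] [Module R F] [Module.Flat R F] :
    AuxGood (R := R) D n (C ⊗[R] F) := by
  induction h with
  | inj C h => exact .inj _ (aux_inj_tensor h)
  | step n C J C' ι π hJ hι hπ he hl h ih =>
    exact .step n _ (J ⊗[R] F) (C' ⊗[R] F) (ι.rTensor F) (π.rTensor F) (aux_inj_tensor hJ)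
      (Module.Flat.rTensor_preserves_injective_linearMap ι hι)
      (LinearMap.rTensor_surjective F hπ) (Module.Flat.rTensor_exact F he)
      (aux_lift_tensor π hl) ih

/-- the natural map `M ⊗ Hom(J,I) → Hom(Hom(M,J),I)`. -/
noncomputable def auxTheta (R : Type u) [CommRing R] (J I : Type u) [AddCommGroup J] [Module R J]
    [AddCommGroup I] [Module R I] (M : Type u) [AddCommGroup M] [Module R M] :
    M ⊗[R] (J →ₗ[R] I) →ₗ[R] ((M →ₗ[R] J) →ₗ[R] I) :=
  TensorProduct.lift ((LinearMap.llcomp R (M →ₗ[R] J) J I).flip ∘ₗ LinearMap.applyₗ)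

omit [IsNoetherianRing R] in
theorem auxTheta_tmul {J I M : Type u} [AddCommGroup J] [Module R J]
    [AddCommGroup I] [Module R I] [AddCommGroup M] [Module R M] (m : M) (f : J →ₗ[R] I)
    (φ : M →ₗ[R] J) : auxTheta R J I M (m ⊗ₜ f) φ = f (φ m) := by
  simp [auxTheta]

omit [IsNoetherianRing R] in
theorem auxTheta_nat {J I M M' : Type u} [AddCommGroup J] [Module R J]
    [AddCommGroup I] [Module R I] [AddCommGroup M] [Module R M] [AddCommGroup M'] [Module R M']
    (u : M →ₗ[R] M') (t : M ⊗[R] (J →ₗ[R] I)) :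
    auxTheta R J I M' (u.rTensor _ t) = (auxTheta R J I M t).comp (LinearMap.lcomp R J u) := by
  induction t with
  | zero => simp
  | add x y hx hy => simp only [map_add, hx, hy, LinearMap.add_comp]
  | tmul f x => ext a; simp [auxTheta_tmul]

omit [IsNoetherianRing R] in
theorem auxTheta_free (J I : Type u) [AddCommGroup J] [Module R J]
    [AddCommGroup I] [Module R I] (n : ℕ) :
    Function.Bijective (auxTheta R J I (Fin n → R)) := by
  let inv : (((Fin n → R) →ₗ[R] J) →ₗ[R] I) →ₗ[R] (Fin n → R) ⊗[R] (J →ₗ[R] I) :=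
    ∑ i : Fin n, (TensorProduct.mk R _ _ (Pi.single i 1)).comp
      (LinearMap.lcomp R I ((LinearMap.llcomp R (Fin n → R) R J).flip (LinearMap.proj i) |>.comp
          (LinearMap.ringLmapEquivSelf R R J).symm.toLinearMap))
  refine Function.bijective_iff_has_inverse.2 ⟨inv, ?_, ?_⟩
  · intro t
    induction t with
    | zero => simp
    | add x y hx hy => simp only [map_add, hx, hy]
    | tmul v f =>
      have : ∀ i, (auxTheta R J I (Fin n → R) (v ⊗ₜ f)).comp
        ((LinearMap.llcomp R (Fin n → R) R J).flip (LinearMap.proj i) |>.comp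
          (LinearMap.ringLmapEquivSelf R R J).symm.toLinearMap) = v i • f := by
        intro i
        ext j
        simp [auxTheta_tmul]
      simp only [inv, LinearMap.sum_apply, LinearMap.comp_apply, LinearMap.lcomp_apply',
        TensorProduct.mk_apply, this, TensorProduct.tmul_smul, TensorProduct.smul_tmul',
        ← TensorProduct.sum_tmul]
      congr 1
      ext i
      simp [Finset.sum_apply, Pi.single_apply]
  · intro ψ
    ext φ
    have key : ∀ i, (LinearMap.llcomp R (Fin n → R) R J).flip (LinearMap.proj i)
      ((LinearMap.ringLmapEquivSelf R R J).symm (φ (Pi.single i 1))) =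
        (LinearMap.toSpanSingleton R J (φ (Pi.single i 1))).comp (LinearMap.proj i) := by
      intro i
      ext j
      simp
    simp only [inv, LinearMap.sum_apply, map_sum, LinearMap.comp_apply, LinearMap.lcomp_apply',
      TensorProduct.mk_apply, auxTheta_tmul, LinearEquiv.coe_coe, key]
    rw [← map_sum]
    congr 1
    ext i
    simp [Finset.sum_apply, Pi.single_apply]

omit [IsNoetherianRing R] in
theorem auxTheta_surj {J I M : Type u} [AddCommGroup J] [Module R J]
    [AddCommGroup I] [Module R I] [AddCommGroup M] [Module R M] [Module.Finite R M]
    (hI : Module.Injective R I) : Function.Surjective (auxTheta R J I M) := by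
  intro ψ
  obtain ⟨n, p, hp⟩ := Module.Finite.exists_fin' R M
  obtain ⟨ψ', hψ'⟩ := hI.out (LinearMap.lcomp R J p) (fun f g h => by
    ext x
    obtain ⟨y, rfl⟩ := hp x
    exact LinearMap.congr_fun h y) ψ
  obtain ⟨t, rfl⟩ := (auxTheta_free J I n).2 ψ'
  refine ⟨p.rTensor _ t, ?_⟩
  rw [auxTheta_nat]
  ext φ
  exact hψ' φ

theorem auxTheta_bij {J I M : Type u} [AddCommGroup J] [Module R J]
    [AddCommGroup I] [Module R I] [AddCommGroup M] [Module R M] [Module.Finite R M]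
    (hI : Module.Injective R I) : Function.Bijective (auxTheta R J I M) := by
  refine ⟨?_, auxTheta_surj hI⟩
  rw [injective_iff_map_eq_zero]
  intro t ht
  obtain ⟨n, p, hp⟩ := Module.Finite.exists_fin' R M
  obtain ⟨t', rfl⟩ := LinearMap.rTensor_surjective (J →ₗ[R] I) hp t
  rw [auxTheta_nat] at ht
  let k := (LinearMap.ker p).subtype
  have hk : Function.Exact k p := LinearMap.exact_subtype_ker_map p
  obtain ⟨ψ, hψ⟩ := aux_ext_range hI (LinearMap.lcomp R J k) (auxTheta R J I _ t') (by
    intro f hf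
    obtain ⟨f', rfl⟩ := aux_factor_surj p hp f (fun x hx => by
      exact LinearMap.congr_fun hf ⟨x, hx⟩)
    exact LinearMap.congr_fun ht f')
  obtain ⟨s, rfl⟩ := auxTheta_surj (M := LinearMap.ker p) hI ψ
  rw [← auxTheta_nat] at hψ
  have := (auxTheta_free J I n).1 hψ
  rw [← this, ← LinearMap.comp_apply, ← LinearMap.rTensor_comp, hk.linearMap_comp_eq_zero]
  simp

theorem aux_flat_hom {J I : Type u} [AddCommGroup J] [Module R J]
    [AddCommGroup I] [Module R I] (hJ : Module.Injective R J) (hI : Module.Injective R I) :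
    Module.Flat R (J →ₗ[R] I) := by
  rw [Module.Flat.iff_rTensor_injective]
  intro a _
  have h2 : Function.Injective
      ((auxTheta R J I R).comp (a.subtype.rTensor (J →ₗ[R] I))) := by
    intro x y h
    simp only [LinearMap.comp_apply] at h
    rw [auxTheta_nat, auxTheta_nat] at h
    apply (auxTheta_bij (M := a) hI).1
    ext φ
    obtain ⟨φ', hφ'⟩ := hJ.out a.subtype Subtype.val_injective φ
    have h3 : LinearMap.lcomp R J a.subtype φ' = φ := by ext x; exact hφ' x
    rw [← h3]
    exact LinearMap.congr_fun h φ'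
  exact Function.Injective.of_comp (f := auxTheta R J I R) h2

end Tens


section Main
variable [IsNoetherianRing R]

/-- `K` is flat and an `n`-th syzygy of a flat module. -/
inductive AuxSyz : ℕ → ∀ (K : Type u) [AddCommGroup K] [Module R K], Prop
  | flat (K : Type u) [AddCommGroup K] [Module R K] (h : Module.Flat R K) : AuxSyz 0 K
  | step (n : ℕ) (K K' S : Type u) [AddCommGroup K] [Module R K] [AddCommGroup K'] [Module R K']
      (ι : K →ₗ[R] (S →₀ R)) (p : (S →₀ R) →ₗ[R] K') (hι : Function.Injective ι)
      (hp : Function.Surjective p) (he : Function.Exact ι p) (hK : Module.Flat R K)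
      (hK' : Module.Flat R K') (h : AuxSyz n K') : AuxSyz (n + 1) K

omit [IsNoetherianRing R] in
theorem AuxSyz.isFlat {n : ℕ} {K : Type u} [AddCommGroup K] [Module R K]
    (h : AuxSyz (R := R) n K) : Module.Flat R K := by
  cases h <;> assumption

omit [IsNoetherianRing R] in
theorem aux_lift_free {D J C S : Type u} [AddCommGroup D] [Module R D] [AddCommGroup J] [Module R J]
    [AddCommGroup C] [Module R C] (π : J →ₗ[R] C)
    (hl : ∀ f : D →ₗ[R] C, ∃ f' : D →ₗ[R] J, π.comp f' = f) (f : D ⊗[R] (S →₀ R) →ₗ[R] C) :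
    ∃ f' : D ⊗[R] (S →₀ R) →ₗ[R] J, π.comp f' = f := by
  classical
  let e := TensorProduct.finsuppScalarRight R R D S
  have : ∀ s : S, ∃ f' : D →ₗ[R] J,
      π.comp f' = (f.comp e.symm.toLinearMap).comp (Finsupp.lsingle s) := fun s => hl _
  choose k hk using this
  have h1 : π.comp (Finsupp.lsum R k) = f.comp e.symm.toLinearMap := by
    ext s m
    simpa using LinearMap.congr_fun (hk s) m
  refine ⟨(Finsupp.lsum R k).comp e.toLinearMap, ?_⟩
  rw [← LinearMap.comp_assoc, h1, LinearMap.comp_assoc]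
  simp

omit [IsNoetherianRing R] in
theorem aux_ext_of_good {D : Type u} [AddCommGroup D] [Module R D] (n : ℕ) :
    ∀ (N : Type u) [AddCommGroup N] [Module R N] (K : Type u) [AddCommGroup K] [Module R K],
    AuxGood (R := R) D n N → AuxSyz (R := R) n K →
    ∀ (A B : Type u) [AddCommGroup A] [Module R A] [AddCommGroup B] [Module R B]
      (i : A →ₗ[R] B) (q : B →ₗ[R] D ⊗[R] K), Function.Injective i → Function.Surjective q →
      Function.Exact i q → ∀ g : A →ₗ[R] N, ∃ g' : B →ₗ[R] N, g'.comp i = g := by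
  induction n with
  | zero =>
    intro N _ _ K _ _ hN _ A B _ _ _ _ i q hi hq he g
    cases hN with
    | inj _ h =>
      obtain ⟨g', hg'⟩ := h.out i hi g
      exact ⟨g', LinearMap.ext hg'⟩
  | succ n ih =>
    intro N _ _ K _ _ hN hK A B _ _ _ _ i q hi hq he g
    cases hN with
    | step _ _ J N' ι π hJ hι hπ he' hl hN' =>
    cases hK with
    | step _ _ K' S κ p hκ hp hκp fK fK' hK' =>
    have lift : ∀ f : D ⊗[R] K →ₗ[R] N', ∃ f' : D ⊗[R] K →ₗ[R] J, π.comp f' = f := by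
      intro f
      obtain ⟨f₁, hf₁⟩ := ih N' K' hN' hK' (D ⊗[R] K) (D ⊗[R] (S →₀ R)) (κ.lTensor D)
        (p.lTensor D) (LinearMap.lTensor_injective_of_exact_of_flat p hp κ hκ hκp D)
        (LinearMap.lTensor_surjective D hp) (lTensor_exact D hκp hp) f
      obtain ⟨f₂, hf₂⟩ := aux_lift_free π hl f₁
      exact ⟨f₂.comp (κ.lTensor D), by rw [← LinearMap.comp_assoc, hf₂, hf₁]⟩
    obtain ⟨g₁, hg₁⟩ := hJ.out i hi (ι.comp g)
    obtain ⟨c, hc⟩ := aux_factor_surj q hq (π.comp g₁) (by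
      intro x hx
      obtain ⟨y, rfl⟩ := (he x).1 hx
      simp [hg₁, he'.apply_apply_eq_zero])
    obtain ⟨c', hc'⟩ := lift c
    obtain ⟨g₂, hg₂⟩ := aux_codlift ι π hι he' (g₁ - c'.comp q) (by
      rw [LinearMap.comp_sub, ← LinearMap.comp_assoc, hc', hc, sub_self])
    refine ⟨g₂, ?_⟩
    ext x
    apply hι
    have := LinearMap.congr_fun hg₂ (i x)
    simp only [LinearMap.comp_apply, LinearMap.sub_apply, he.apply_apply_eq_zero, map_zero,
      sub_zero, hg₁] at this
    exact this

variable {X : ℤ → Type u} [∀ i, AddCommGroup (X i)] [∀ i, Module R (X i)]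
  {d : ∀ i : ℤ, X (i + 1) →ₗ[R] X i}

omit [IsNoetherianRing R] in
theorem AuxInC.tensor_free {D : Type u} [AddCommGroup D] [Module R D] (S : Type u)
    (hD : AuxInC d D) : AuxInC d (D ⊗[R] (S →₀ R)) := by
  classical
  exact AuxInC.equiv (TensorProduct.finsuppScalarRight R R D S) (hD.finsupp S)

theorem AuxInC.tensor_flat (hX : ∀ i, Module.Injective R (X i))
    (hd : ∀ i, (d i).comp (d (i + 1)) = 0)
    {D : Type u} [AddCommGroup D] [Module R D] [Module.Finite R D] {n : ℕ}
    (hG : AuxGood (R := R) D n D) (hD : AuxInC d D) (m j : ℕ) (hmj : m + j = n) :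
    ∀ (K : Type u) [AddCommGroup K] [Module R K], AuxSyz (R := R) m K → AuxInC d (D ⊗[R] K) := by
  have cover : ∀ (m : ℕ) (K : Type u) [AddCommGroup K] [Module R K], AuxSyz (R := R) m K →
      ∃ (S L : Type u) (_ : AddCommGroup L) (_ : Module R L) (κ : L →ₗ[R] (S →₀ R))
        (p : (S →₀ R) →ₗ[R] K), Function.Injective κ ∧ Function.Surjective p ∧
        Function.Exact κ p ∧ Module.Flat R L ∧ AuxSyz (R := R) (m + 1) L := by
    intro m K _ _ hK
    let p : (K →₀ R) →ₗ[R] K := Finsupp.linearCombination R id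
    have hp : Function.Surjective p := Finsupp.linearCombination_id_surjective R K
    have := hK.isFlat
    have hf : Module.Flat R (LinearMap.ker p) := aux_flat_ker (K := LinearMap.ker p) (LinearMap.ker p).subtype p
      Subtype.val_injective hp (LinearMap.exact_subtype_ker_map p)
    exact ⟨K, LinearMap.ker p, inferInstance, inferInstance, (LinearMap.ker p).subtype, p,
      Subtype.val_injective, hp, LinearMap.exact_subtype_ker_map p, hf,
      .step m _ K K (LinearMap.ker p).subtype p Subtype.val_injective hp
        (LinearMap.exact_subtype_ker_map p) hf this hK⟩
  induction j generalizing m with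
  | zero =>
    intro K _ _ hK
    obtain rfl : m = n := hmj
    obtain ⟨S, L, _, _, κ, p, hκ, hp, he, hL, hLs⟩ := cover m K hK
    have := hK.isFlat
    have i1 := LinearMap.lTensor_injective_of_exact_of_flat p hp κ hκ he D
    have i2 := LinearMap.lTensor_surjective D hp
    have i3 := lTensor_exact D he hp
    obtain ⟨r, hr⟩ := aux_ext_of_good m (D ⊗[R] L) K (hG.tensor L) hK (D ⊗[R] L)
      (D ⊗[R] (S →₀ R)) (κ.lTensor D) (p.lTensor D) i1 i2 i3 LinearMap.id
    have hP := hD.tensor_free S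
    exact AuxInC.right hX hd (κ.lTensor D) (p.lTensor D) i1 i2 i3
      (AuxInC.retract (κ.lTensor D) r hr hP) hP
  | succ j ih =>
    intro K _ _ hK
    obtain ⟨S, L, _, _, κ, p, hκ, hp, he, hL, hLs⟩ := cover m K hK
    have := hK.isFlat
    exact AuxInC.right hX hd (κ.lTensor D) (p.lTensor D)
      (LinearMap.lTensor_injective_of_exact_of_flat p hp κ hκ he D)
      (LinearMap.lTensor_surjective D hp) (lTensor_exact D he hp)
      (ih (m + 1) (by omega) L hLs) (hD.tensor_free S)

theorem AuxInC.hom_hom (hX : ∀ i, Module.Injective R (X i))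
    (hd : ∀ i, (d i).comp (d (i + 1)) = 0)
    {D : Type u} [AddCommGroup D] [Module R D] [Module.Finite R D] {n : ℕ}
    (hG : AuxGood (R := R) D n D) (hD : AuxInC d D)
    {I : Type u} [AddCommGroup I] [Module R I] (hI : Module.Injective R I)
    {m : ℕ} {C : Type u} [AddCommGroup C] [Module R C] (h : AuxGood (R := R) D m C) :
    AuxInC d ((D →ₗ[R] C) →ₗ[R] I) := by
  have base : ∀ (J : Type u) [AddCommGroup J] [Module R J], Module.Injective R J →
      AuxInC d ((D →ₗ[R] J) →ₗ[R] I) := by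
    intro J _ _ hJ
    have := AuxInC.tensor_flat hX hd hG hD 0 n (by omega) (J →ₗ[R] I) (.flat _ (aux_flat_hom hJ hI))
    exact AuxInC.equiv (LinearEquiv.ofBijective _ (auxTheta_bij (J := J) (M := D) hI)).symm this
  induction h with
  | inj C h => exact base C h
  | step n C J C' ι π hJ hι hπ he hl h ih =>
    refine AuxInC.right hX hd (LinearMap.lcomp R I (LinearMap.compRight R π (M := D)))
      (LinearMap.lcomp R I (LinearMap.compRight R ι (M := D))) ?_ ?_ ?_ ih (base J hJ)
    · intro a b hab
      ext f
      obtain ⟨f', rfl⟩ := hl f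
      exact LinearMap.congr_fun hab f'
    · intro g
      obtain ⟨g', hg'⟩ := hI.out (LinearMap.compRight R ι (M := D)) (fun a b hab => by
        ext x
        exact hι (LinearMap.congr_fun hab x)) g
      exact ⟨g', LinearMap.ext hg'⟩
    · intro g
      constructor
      · intro hg
        obtain ⟨g', hg'⟩ := aux_factor_surj (LinearMap.compRight R π (M := D)) hl g (by
          intro f hf
          obtain ⟨f', rfl⟩ := aux_codlift ι π hι he f hf
          exact LinearMap.congr_fun hg f')
        exact ⟨g', hg'⟩
      · rintro ⟨g', rfl⟩
        ext f
        have : π.comp (ι.comp f) = 0 := by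
          rw [← LinearMap.comp_assoc, he.linearMap_comp_eq_zero, LinearMap.zero_comp]
        show g' (π.comp (ι.comp f)) = 0
        rw [this, map_zero]

theorem AuxInC.of_injective (hX : ∀ i, Module.Injective R (X i))
    (hd : ∀ i, (d i).comp (d (i + 1)) = 0)
    {D : Type u} [AddCommGroup D] [Module R D] (hdual : IsDualizingModule R D) (hD : AuxInC d D)
    (I : Type u) [AddCommGroup I] [Module R I] (hI : Module.Injective R I) : AuxInC d I := by
  obtain ⟨n, hG⟩ := aux_good_of_dualizing D hdual
  have := hdual.1
  have h := AuxInC.hom_hom hX hd hG hD hI hG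
  let e : R ≃ₗ[R] (D →ₗ[R] D) := LinearEquiv.ofBijective
    (LinearMap.toSpanSingleton R (D →ₗ[R] D) LinearMap.id) hdual.2.2.1
  refine AuxInC.equiv ?_ h
  exact (LinearMap.ringLmapEquivSelf R R I).symm.trans (LinearEquiv.congrLeft I R e)


omit [IsNoetherianRing R] in
theorem aux_mem_l (a b : Ideal R) (r : R) (hr : r ∈ a * b) : r ∈ a :=
  (Ideal.mul_le_left : a * b ≤ a) hr

omit [IsNoetherianRing R] in
theorem aux_mem_r (a b : Ideal R) (r : R) (hr : r ∈ a * b) : r ∈ b :=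
  (Ideal.mul_le_right : a * b ≤ b) hr

/-- elements killed by some ideal of `W`. -/
def auxGamma (W : Submonoid (Ideal R)) (M : Type u) [AddCommGroup M] [Module R M] :
    Submodule R M where
  carrier := {x | ∃ a ∈ W, ∀ r ∈ a, r • x = 0}
  zero_mem' := ⟨1, W.one_mem, fun r _ => smul_zero r⟩
  add_mem' := by
    rintro x y ⟨a, ha, hx⟩ ⟨b, hb, hy⟩
    exact ⟨a * b, W.mul_mem ha hb, fun r hr => by
      rw [smul_add, hx r (aux_mem_l a b r hr), hy r (aux_mem_r a b r hr), add_zero]⟩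
  smul_mem' := by
    rintro c x ⟨a, ha, hx⟩
    exact ⟨a, ha, fun r hr => by rw [smul_comm, hx r hr, smul_zero]⟩

omit [IsNoetherianRing R] in
theorem auxGamma_map (W : Submonoid (Ideal R)) {M N : Type u} [AddCommGroup M] [Module R M]
    [AddCommGroup N] [Module R N] (f : M →ₗ[R] N) (x : M) (hx : x ∈ auxGamma W M) :
    f x ∈ auxGamma W N := by
  obtain ⟨a, ha, h⟩ := hx
  exact ⟨a, ha, fun r hr => by rw [← map_smul, h r hr, map_zero]⟩

omit [IsNoetherianRing R] in
theorem auxGamma_fg (W : Submonoid (Ideal R)) {M N : Type u} [AddCommGroup M] [Module R M]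
    [Module.Finite R M] [AddCommGroup N] [Module R N] (f : M →ₗ[R] N)
    (h : ∀ x, f x ∈ auxGamma W N) : ∃ a ∈ W, ∀ r ∈ a, r • f = 0 := by
  classical
  obtain ⟨S, hS⟩ := (Module.Finite.fg_top : (⊤ : Submodule R M).FG)
  have key : ∀ T : Finset M, ∃ a ∈ W, ∀ r ∈ a, ∀ x ∈ T, r • f x = 0 := by
    intro T
    induction T using Finset.induction_on with
    | empty => exact ⟨1, W.one_mem, by simp⟩
    | insert x T _ ih =>
      obtain ⟨a, ha, h1⟩ := ih
      obtain ⟨b, hb, h2⟩ := h x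
      refine ⟨a * b, W.mul_mem ha hb, fun r hr y hy => ?_⟩
      rcases Finset.mem_insert.1 hy with rfl | hy
      · exact h2 r (aux_mem_r a b r hr)
      · exact h1 r (aux_mem_l a b r hr) y hy
  obtain ⟨a, ha, h1⟩ := key S
  refine ⟨a, ha, fun r hr => ?_⟩
  apply LinearMap.ext_on hS
  intro x hx
  simpa using h1 r hr x hx

theorem auxGamma_inj (W : Submonoid (Ideal R)) {E : Type u} [AddCommGroup E] [Module R E]
    (hE : Module.Injective R E) : Module.Injective R (auxGamma W E) := by
  apply Module.Baer.injective
  intro I g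
  obtain ⟨a, ha, hg⟩ := auxGamma_fg W ((auxGamma W E).subtype.comp g) (fun x => (g x).2)
  obtain ⟨k, hk⟩ := Ideal.exists_pow_inf_eq_pow_smul a (M := R) I
  have hk1 := hk (k + 1) (by omega)
  have hz : ∀ x ∈ a • I, ∃ h : x ∈ I, ((g ⟨x, h⟩ : auxGamma W E) : E) = 0 := by
    intro x hx
    refine Submodule.smul_induction_on hx ?_ ?_
    · intro r hr y hy
      refine ⟨I.smul_mem r hy, ?_⟩
      have := LinearMap.congr_fun (hg r hr) ⟨y, hy⟩
      have h2 : (⟨r • y, I.smul_mem r hy⟩ : I) = r • ⟨y, hy⟩ := rfl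
      rw [h2, map_smul]
      exact this
    · rintro x y ⟨hx, hx'⟩ ⟨hy, hy'⟩
      refine ⟨I.add_mem hx hy, ?_⟩
      have h2 : (⟨x + y, I.add_mem hx hy⟩ : I) = ⟨x, hx⟩ + ⟨y, hy⟩ := rfl
      rw [h2, map_add, Submodule.coe_add, hx', hy', add_zero]
  obtain ⟨h, hh⟩ := aux_ext_range hE ((a ^ (k + 1)).mkQ.comp I.subtype)
    ((auxGamma W E).subtype.comp g) (by
      intro x hx
      have hx1 : (x : R) ∈ a ^ (k + 1) :=
        (Submodule.Quotient.mk_eq_zero _).1 hx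
      have hx2 : (x : R) ∈ a • I := by
        have : (x : R) ∈ a ^ (k + 1) • (⊤ : Ideal R) ⊓ I := ⟨by simpa using hx1, x.2⟩
        rw [hk1] at this
        have h3 : k + 1 - k = 1 := by omega
        rw [h3, pow_one] at this
        exact Submodule.smul_mono (le_refl a) inf_le_right this
      obtain ⟨_, h4⟩ := hz x hx2
      exact h4)
  let e : E := h ((a ^ (k + 1)).mkQ 1)
  have hmem : e ∈ auxGamma W E := by
    refine ⟨a ^ (k + 1), W.pow_mem ha _, fun r hr => ?_⟩
    show r • h ((a ^ (k + 1)).mkQ 1) = 0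
    rw [← map_smul, ← map_smul]
    have : (a ^ (k + 1)).mkQ (r • (1 : R)) = 0 := by
      rw [smul_eq_mul, mul_one]
      exact (Submodule.Quotient.mk_eq_zero _).2 hr
    rw [this, map_zero]
  refine ⟨LinearMap.toSpanSingleton R _ ⟨e, hmem⟩, fun x hx => ?_⟩
  apply Subtype.ext
  have := LinearMap.congr_fun hh ⟨x, hx⟩
  have h5 : x • e = h ((a ^ (k + 1)).mkQ x) := by
    show x • h ((a ^ (k + 1)).mkQ 1) = _
    rw [← map_smul, ← map_smul, smul_eq_mul, mul_one]
  simp only [LinearMap.toSpanSingleton_apply, Submodule.coe_smul, h5]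
  exact this

theorem aux_stab {E M : Type u} [AddCommGroup E] [Module R E] [AddCommGroup M] [Module R M]
    [Module.Finite R M] (hE : Module.Injective R E) (h : M →ₗ[R] E) (x : R) (N : ℕ) :
    ∃ (m : ℕ) (h' : M →ₗ[R] E), x ^ m • h = x ^ (m + N) • h' := by
  let c : ℕ →o Submodule R M := ⟨fun m => LinearMap.ker (x ^ m • (LinearMap.id : M →ₗ[R] M)), by
    intro a b hab y hy
    obtain ⟨t, rfl⟩ := Nat.exists_eq_add_of_le hab
    simp only [LinearMap.mem_ker, LinearMap.smul_apply, LinearMap.id_apply] at hy ⊢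
    rw [add_comm, pow_add, mul_smul, hy, smul_zero]⟩
  obtain ⟨m, hm⟩ := monotone_stabilizes_iff_noetherian.2 (inferInstance : IsNoetherian R M) c
  obtain ⟨h', hh'⟩ := aux_ext_range hE (x ^ (m + N) • (LinearMap.id : M →ₗ[R] M)) (x ^ m • h) (by
    intro y hy
    have h1 : y ∈ c (m + N) := hy
    rw [← hm (m + N) (by omega)] at h1
    have h2 : x ^ m • y = 0 := h1
    rw [LinearMap.smul_apply, ← map_smul, h2, map_zero])
  refine ⟨m, h', ?_⟩
  rw [← hh']
  ext y
  simp

omit [IsNoetherianRing R] in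
theorem aux_kill_sup {M : Type u} [AddCommGroup M] [Module R M] (f : M) (x : R) (b : Ideal R)
    (m n : ℕ) (hx : x ^ m • f = 0) (hb : ∀ r ∈ b ^ n, r • f = 0) :
    ∀ r ∈ (Ideal.span {x} ⊔ b) ^ (m + n), r • f = 0 := by
  intro r hr
  have h1 := Ideal.sup_pow_add_le_pow_sup_pow hr
  rw [Ideal.span_singleton_pow] at h1
  obtain ⟨s, hs, t, ht, rfl⟩ := Submodule.mem_sup.1 h1
  obtain ⟨c, rfl⟩ := Ideal.mem_span_singleton'.1 hs
  rw [add_smul, hb t ht, mul_smul, hx, smul_zero, add_zero]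

theorem aux_P (hX : ∀ i, Module.Injective R (X i)) (hd : ∀ i, (d i).comp (d (i + 1)) = 0)
    {D : Type u} [AddCommGroup D] [Module R D] [Module.Finite R D] (hD : AuxInC d D)
    (S : Finset R) (i : ℤ) (g : D →ₗ[R] X (i + 1)) (hg : (d i).comp g = 0)
    (hk : ∃ n, ∀ r ∈ (Ideal.span (S : Set R)) ^ n, r • g = 0) :
    ∃ f : D →ₗ[R] X (i + 1 + 1), (d (i + 1)).comp f = g ∧
      ∃ n, ∀ r ∈ (Ideal.span (S : Set R)) ^ n, r • f = 0 := by
  classical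
  induction S using Finset.induction_on generalizing i g with
  | empty =>
    obtain ⟨f, hf⟩ := hD i g hg
    refine ⟨f, hf, 1, fun r hr => ?_⟩
    have : r = 0 := by simpa using hr
    rw [this, zero_smul]
  | insert x S _ ih =>
    have hsp : Ideal.span ((insert x S : Finset R) : Set R) =
        Ideal.span {x} ⊔ Ideal.span (S : Set R) := by
      rw [Finset.coe_insert, Ideal.span_insert]
    rw [hsp] at hk ⊢
    set b := Ideal.span (S : Set R) with hb
    obtain ⟨N, hN⟩ := hk
    have hxN : x ^ N • g = 0 := hN _ (Ideal.pow_right_mono le_sup_left N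
      (Ideal.pow_mem_pow (Ideal.mem_span_singleton_self x) N))
    obtain ⟨f, hf, n₁, hn₁⟩ := ih i g hg ⟨N, fun r hr => hN r (Ideal.pow_right_mono le_sup_right N hr)⟩
    obtain ⟨h, hh, n₂, hn₂⟩ := ih (i + 1) (x ^ N • f) (by
      rw [LinearMap.comp_smul, hf, hxN])
      ⟨n₁, fun r hr => by rw [smul_comm, hn₁ r hr, smul_zero]⟩
    let W : Submonoid (Ideal R) := Submonoid.powers b
    have hm : ∀ y, h y ∈ auxGamma W (X (i + 1 + 1 + 1)) := fun y =>
      ⟨b ^ n₂, ⟨n₂, rfl⟩, fun r hr => LinearMap.congr_fun (hn₂ r hr) y⟩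
    obtain ⟨m, h', hm'⟩ := aux_stab (auxGamma_inj W (hX (i + 1 + 1 + 1))) (h.codRestrict _ hm) x N
    let k := (auxGamma W (X (i + 1 + 1 + 1))).subtype.comp h'
    have hk1 : x ^ m • h = x ^ (m + N) • k := by
      ext y
      exact congrArg Subtype.val (LinearMap.congr_fun hm' y)
    obtain ⟨_, ⟨n₃, rfl⟩, hn₃⟩ := auxGamma_fg W k (fun y => (h' y).2)
    refine ⟨f - (d (i + 1 + 1)).comp k, ?_, ?_⟩
    · rw [LinearMap.comp_sub, hf, ← LinearMap.comp_assoc, hd, LinearMap.zero_comp, sub_zero]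
    · refine ⟨(m + N) + (n₁ + n₃), aux_kill_sup _ x b _ _ ?_ ?_⟩
      · rw [smul_sub, ← LinearMap.comp_smul, ← hk1, LinearMap.comp_smul, hh, pow_add, mul_smul,
          sub_self]
      · intro r hr
        rw [smul_sub, ← LinearMap.comp_smul, hn₁ r (Ideal.pow_le_pow_right (by omega) hr),
          hn₃ r (Ideal.pow_le_pow_right (by omega) hr), LinearMap.comp_zero, sub_zero]

theorem AuxInC.gamma (hX : ∀ i, Module.Injective R (X i)) (hd : ∀ i, (d i).comp (d (i + 1)) = 0)
    {D : Type u} [AddCommGroup D] [Module R D] [Module.Finite R D] (hD : AuxInC d D)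
    (W : Submonoid (Ideal R)) :
    AuxInC (X := fun i => auxGamma W (X i)) (fun i => (d i).restrict (auxGamma_map W (d i))) D := by
  intro i g hg
  obtain ⟨a, ha, h1⟩ := auxGamma_fg W ((auxGamma W (X (i + 1))).subtype.comp g) (fun y => (g y).2)
  obtain ⟨S, rfl⟩ := (IsNoetherian.noetherian a : a.FG)
  obtain ⟨f, hf, n, hn⟩ := aux_P hX hd hD S i ((auxGamma W (X (i + 1))).subtype.comp g) (by
    ext y
    exact congrArg Subtype.val (LinearMap.congr_fun hg y)) ⟨1, by rw [pow_one]; exact h1⟩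
  refine ⟨f.codRestrict _ (fun y => ⟨_, W.pow_mem ha n, fun r hr =>
    LinearMap.congr_fun (hn r hr) y⟩), ?_⟩
  ext y
  exact LinearMap.congr_fun hf y

theorem aux_gamma_le {E : Type u} [AddCommGroup E] [Module R E] (hE : Module.Injective R E)
    (𝒮 : Set (Ideal R)) (T : Submodule R E) (hT : ∀ p ∈ 𝒮, torsionGamma p E ≤ T) :
    auxGamma (Submonoid.closure 𝒮) E ≤ T := by
  rintro x ⟨a, ha, hx⟩
  induction ha using Submonoid.closure_induction_left generalizing x with
  | one =>
    have := hx 1 (by simp)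
    rw [one_smul] at this
    rw [this]; exact T.zero_mem
  | mul_left p hp b hb ih =>
    obtain ⟨k, hk⟩ := Ideal.exists_pow_inf_eq_pow_smul p (M := R) b
    have hk1 := hk (k + 1) (by omega)
    have hz : ∀ y ∈ p ^ (k + 1), y ∈ b → y • x = 0 := by
      intro y hy hyb
      have : y ∈ p ^ (k + 1) • (⊤ : Ideal R) ⊓ b := ⟨by simpa using hy, hyb⟩
      rw [hk1] at this
      have h3 : k + 1 - k = 1 := by omega
      rw [h3, pow_one] at this
      exact hx y (Submodule.smul_mono (le_refl p) inf_le_right this)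
    obtain ⟨φ, hφ⟩ := aux_ext_range hE (b.mkQ.comp (p ^ (k + 1)).subtype)
      ((LinearMap.toSpanSingleton R E x).comp (p ^ (k + 1)).subtype) (by
        intro y hy
        exact hz y y.2 ((Submodule.Quotient.mk_eq_zero _).1 hy))
    let y := φ (b.mkQ 1)
    have hy : ∀ r, r • y = φ (b.mkQ r) := by
      intro r
      show r • φ (b.mkQ 1) = _
      rw [← map_smul, ← map_smul, smul_eq_mul, mul_one]
    have h1 : y ∈ T := ih (fun r hr => by
      rw [hy]
      have : b.mkQ r = 0 := (Submodule.Quotient.mk_eq_zero _).2 hr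
      rw [this, map_zero])
    have h2 : x - y ∈ T := by
      apply hT p hp
      refine Submodule.mem_iSup_of_mem (k + 1) ?_
      rw [Submodule.mem_torsionBySet_iff]
      rintro ⟨r, hr⟩
      have := LinearMap.congr_fun hφ ⟨r, hr⟩
      show r • (x - y) = 0
      rw [smul_sub, hy, sub_eq_zero]
      exact this.symm
    simpa using T.add_mem h2 h1

omit [IsNoetherianRing R] in
theorem aux_torsionGamma_map (p : Ideal R) {M N : Type u} [AddCommGroup M] [Module R M]
    [AddCommGroup N] [Module R N] (f : M →ₗ[R] N) :
    torsionGamma p M ≤ (torsionGamma p N).comap f := by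
  refine iSup_le fun n x hx => ?_
  refine Submodule.mem_iSup_of_mem n ?_
  rw [Submodule.mem_torsionBySet_iff] at hx ⊢
  intro r
  have h := hx r
  change (r : R) • x = 0 at h
  change (r : R) • f x = 0
  rw [← map_smul, h, map_zero]

omit [IsNoetherianRing R] in
theorem aux_torsionGamma_le (𝒮 : Set (Ideal R)) (p : Ideal R) (hp : p ∈ 𝒮) (M : Type u)
    [AddCommGroup M] [Module R M] :
    torsionGamma p M ≤ auxGamma (Submonoid.closure 𝒮) M := by
  refine iSup_le fun n x hx => ?_
  rw [Submodule.mem_torsionBySet_iff] at hx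
  exact ⟨p ^ n, Submonoid.pow_mem _ (Submonoid.subset_closure hp) n, fun r hr => hx ⟨r, hr⟩⟩

end Main
end Aux

/-- the sum `Σ_{ht p = k} Γ_p(G)` is Gorenstein injective. -/
theorem isGorensteinInjective_iSup_torsionGamma_height
    {R : Type u} [CommRing R] [IsNoetherianRing R]
    (D : Type u) [AddCommGroup D] [Module R D] (hD : IsDualizingModule R D)
    (G : Type u) [AddCommGroup G] [Module R G] (hG : IsGorensteinInjective R G)
    (k : ℕ) :
    IsGorensteinInjective R
      (⨆ (p : PrimeSpectrum R) (_ : Order.height p = (k : ℕ∞)),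
        torsionGamma p.asIdeal G : Submodule R G) := by
  obtain ⟨⟨X, d, hX, hex, hhom, e⟩⟩ := hG
  have hd : ∀ i, (d i).comp (d (i + 1)) = 0 := by
    intro i
    ext x
    have : d (i + 1) x ∈ LinearMap.ker (d i) := by rw [← hex]; exact ⟨x, rfl⟩
    exact this
  have hI : ∀ (I : Type u) [AddCommGroup I] [Module R I], Module.Injective R I → AuxInC d I :=
    fun I _ _ hI i g hg => (hhom I hI i g).1 hg
  have hR : AuxInC d R := by
    intro i g hg
    have h1 : g 1 ∈ LinearMap.range (d (i + 1)) := by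
      rw [hex]; exact LinearMap.congr_fun hg 1
    obtain ⟨y, hy⟩ := h1
    exact ⟨LinearMap.toSpanSingleton R _ y, by ext; simpa using hy⟩
  have hDC : AuxInC d D := by
    obtain ⟨n, hn⟩ := aux_good_of_dualizing D hD
    exact AuxInC.of_good hX hd hI hn
  have := hD.1
  let 𝒮 : Set (Ideal R) := {a | ∃ p : PrimeSpectrum R, Order.height p = (k : ℕ∞) ∧ p.asIdeal = a}
  let W := Submonoid.closure 𝒮
  let Y : ℤ → Type u := fun i => auxGamma W (X i)
  let dY : ∀ i : ℤ, Y (i + 1) →ₗ[R] Y i := fun i => (d i).restrict (auxGamma_map W (d i))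
  have hY : ∀ i, Module.Injective R (Y i) := fun i => auxGamma_inj W (hX i)
  have hdY : ∀ i, (dY i).comp (dY (i + 1)) = 0 := by
    intro i
    ext x
    exact LinearMap.congr_fun (hd i) x.1
  have hRY : AuxInC dY R := AuxInC.gamma hX hd hR W
  have hDY : AuxInC dY D := AuxInC.gamma hX hd hDC W
  have hIY := AuxInC.of_injective hY hdY hD hDY
  have hexY : ∀ i, LinearMap.range (dY (i + 1)) = LinearMap.ker (dY i) := by
    intro i
    apply le_antisymm
    · rintro _ ⟨x, rfl⟩
      exact LinearMap.congr_fun (hdY i) x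
    · intro x hx
      obtain ⟨f, hf⟩ := hRY i (LinearMap.toSpanSingleton R _ x) (by
        ext
        have : dY i x = 0 := hx
        simp [this])
      exact ⟨f 1, by simpa using LinearMap.congr_fun hf 1⟩
  -- identification of the sum with `auxGamma W G`
  have hT : (⨆ (p : PrimeSpectrum R) (_ : Order.height p = (k : ℕ∞)),
        torsionGamma p.asIdeal G : Submodule R G) = auxGamma W G := by
    apply le_antisymm
    · exact iSup_le fun p => iSup_le fun hp => aux_torsionGamma_le 𝒮 p.asIdeal ⟨p, hp, rfl⟩ G
    · intro g hg
      have hm : (e g : X (-1 + 1)) ∈ auxGamma W (X (-1 + 1)) :=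
        auxGamma_map W ((LinearMap.ker (d (-1))).subtype.comp e.toLinearMap) g hg
      have hk : (⟨_, hm⟩ : Y (-1 + 1)) ∈ LinearMap.ker (dY (-1)) := by
        apply Subtype.ext
        exact (e g).2
      rw [← hexY] at hk
      obtain ⟨y, hy⟩ := hk
      let φ : X (-1 + 1 + 1) →ₗ[R] G := e.symm.toLinearMap.comp
        ((d (-1 + 1)).codRestrict (LinearMap.ker (d (-1)))
          (fun x => LinearMap.congr_fun (hd (-1)) x))
      have hφ : φ y.1 = g := by
        show e.symm _ = g
        rw [LinearEquiv.symm_apply_eq]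
        apply Subtype.ext
        have h := congrArg Subtype.val hy
        exact h
      rw [← hφ]
      refine aux_gamma_le (hX _) 𝒮 (Submodule.comap φ
        (⨆ (p : PrimeSpectrum R) (_ : Order.height p = (k : ℕ∞)),
          torsionGamma p.asIdeal G : Submodule R G)) ?_ y.2
      rintro _ ⟨p, hp, rfl⟩
      refine (aux_torsionGamma_map p.asIdeal φ).trans (Submodule.comap_mono ?_)
      exact le_iSup₂_of_le p hp le_rfl
  rw [hT]
  let ψ : auxGamma W G →ₗ[R] LinearMap.ker (dY (-1)) :=
    LinearMap.codRestrict _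
      (((LinearMap.ker (d (-1))).subtype.comp e.toLinearMap).restrict
        (auxGamma_map W ((LinearMap.ker (d (-1))).subtype.comp e.toLinearMap)))
      (fun x => Subtype.ext (e x.1).2)
  have hψ : Function.Bijective ψ := by
    constructor
    · intro a b hab
      apply Subtype.ext
      apply e.injective
      apply Subtype.ext
      have h := congrArg Subtype.val hab
      have h2 := congrArg Subtype.val h
      exact h2
    · rintro ⟨⟨x, hx⟩, hx'⟩
      have hxk : x ∈ LinearMap.ker (d (-1)) := congrArg Subtype.val hx'
      refine ⟨⟨e.symm ⟨x, hxk⟩, ?_⟩, ?_⟩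
      · obtain ⟨a, ha, h⟩ := hx
        refine ⟨a, ha, fun r hr => ?_⟩
        rw [← map_smul]
        have : r • (⟨x, hxk⟩ : LinearMap.ker (d (-1))) = 0 := Subtype.ext (h r hr)
        rw [this, map_zero]
      · apply Subtype.ext
        apply Subtype.ext
        show ((e (e.symm ⟨x, hxk⟩) : LinearMap.ker (d (-1))) : X (-1 + 1)) = x
        rw [LinearEquiv.apply_symm_apply]
  exact ⟨{
    E := Y
    d := dY
    inj := hY
    exact := hexY
    homExact := fun I _ _ hI i g => ⟨hIY I hI i g, by
      rintro ⟨f, rfl⟩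
      rw [← LinearMap.comp_assoc, hdY, LinearMap.zero_comp]⟩
    equiv := LinearEquiv.ofBijective ψ hψ }⟩
end

section
/- Let R be a commutative noetherian ring with a dualizing module and let G be a Gorenstein injective R-module. Then G equals the sum Σ_p Γ_p(G) of its p-torsion submodules taken over all prime ideals p of R of height 0 (equivalently, over all minimal primes of R). -/
open CategoryTheory

universe u

namespace GorAux

open CategoryTheory Abelian

variable {R : Type u} [CommRing R]

/-- some element outside `q` kills `Ext^i(M, D)` -/
def Kill (q : Ideal R) (D : ModuleCat.{u} R) (i : ℕ) (M : Type u) [AddCommGroup M]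
    [Module R M] : Prop :=
  ∃ s : R, s ∉ q ∧ ∀ e : Abelian.Ext.{u} (ModuleCat.of R M) D i, s • e = 0

theorem ses {M₁ M₂ M₃ : Type u} [AddCommGroup M₁] [AddCommGroup M₂] [AddCommGroup M₃]
    [Module R M₁] [Module R M₂] [Module R M₃] (f : M₁ →ₗ[R] M₂) (g : M₂ →ₗ[R] M₃)
    (hf : Function.Injective f) (hg : Function.Surjective g) (h : Function.Exact f g) :
    (ShortComplex.mk (ModuleCat.ofHom f) (ModuleCat.ofHom g)
      (by rw [← ModuleCat.ofHom_comp, h.linearMap_comp_eq_zero]; rfl)).ShortExact where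
  exact := by
    rw [ShortComplex.ShortExact.moduleCat_exact_iff_function_exact]
    exact h
  mono_f := (ModuleCat.mono_iff_injective _).2 hf
  epi_g := (ModuleCat.epi_iff_surjective _).2 hg

theorem old_ext_to_new (M D : ModuleCat.{u} R) (n : ℕ)
    (h : Limits.IsZero (((Ext R (ModuleCat.{u} R) (n + 1)).obj (Opposite.op M)).obj D)) :
    ∀ e : Abelian.Ext.{u} M D (n + 1), e = 0 := by
  intro e
  let P := projectiveResolution M
  obtain ⟨f, hf, rfl⟩ := P.extMk_surjective e (n + 2) rfl
  rw [P.extMk_eq_zero_iff f (n + 2) rfl hf n rfl]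
  have h1 := h.of_iso (P.isoExt (R := R) (n + 1) D).symm
  rw [← HomologicalComplex.exactAt_iff_isZero_homology,
    HomologicalComplex.exactAt_iff' _ n (n + 1) (n + 2) (by simp) (by simp),
    ShortComplex.moduleCat_exact_iff] at h1
  exact h1 f hf

theorem kill_ses (q : Ideal R) [q.IsPrime] (D : ModuleCat.{u} R) (i : ℕ)
    {M₁ M₂ M₃ : Type u} [AddCommGroup M₁] [AddCommGroup M₂] [AddCommGroup M₃]
    [Module R M₁] [Module R M₂] [Module R M₃] (f : M₁ →ₗ[R] M₂) (g : M₂ →ₗ[R] M₃)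
    (hf : Function.Injective f) (hg : Function.Surjective g) (h : Function.Exact f g)
    (h₁ : Kill q D i M₁) (h₃ : Kill q D i M₃) : Kill q D i M₂ := by
  obtain ⟨s, hs, h₁⟩ := h₁
  obtain ⟨t, ht, h₃⟩ := h₃
  refine ⟨t * s, fun hh => ?_, fun e => ?_⟩
  · rcases Ideal.IsPrime.mem_or_mem ‹_› hh with hh | hh
    exacts [ht hh, hs hh]
  · obtain ⟨e3, he3⟩ := Ext.contravariant_sequence_exact₂ (ses f g hf hg h) D (s • e)
      (by rw [Ext.comp_smul]; exact h₁ _)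
    rw [mul_smul, ← he3, ← Ext.comp_smul, h₃ e3, Ext.comp_zero]

theorem nak (q : Ideal R) [q.IsPrime] {E : Type*} [AddCommGroup E] [Module R E] [Module.Finite R E]
    (s x : R) (hs : s ∉ q) (hx : x ∈ q) (h : ∀ e : E, ∃ e' : E, s • e = x • e') :
    ∃ u : R, u ∉ q ∧ ∀ e : E, u • e = 0 := by
  obtain ⟨p, hp, -, hc, h0⟩ :=
    LinearMap.exists_monic_and_natDegree_eq_and_coeff_mem_pow_and_aeval_eq_zero R
      (algebraMap R (Module.End R E) s) q (by
        rintro _ ⟨e, rfl⟩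
        obtain ⟨e', he'⟩ := h e
        rw [Module.algebraMap_end_apply, he']
        exact Submodule.smul_mem_smul hx trivial)
  refine ⟨p.eval s, fun hm => ?_, fun e => ?_⟩
  · have hz : (Ideal.Quotient.mk q) (p.eval s) = (Ideal.Quotient.mk q s) ^ p.natDegree := by
      rw [Polynomial.eval_eq_sum_range, Finset.sum_range_succ, map_add, map_sum,
        Finset.sum_eq_zero]
      · simp [hp.coeff_natDegree]
      · intro k hk
        rw [Ideal.Quotient.eq_zero_iff_mem]
        refine q.mul_mem_right _ (Ideal.pow_le_self ?_ (hc k))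
        have := Finset.mem_range.1 hk
        omega
    rw [Ideal.Quotient.eq_zero_iff_mem.2 hm, ← map_pow, eq_comm,
      Ideal.Quotient.eq_zero_iff_mem] at hz
    exact hs (Ideal.IsPrime.mem_of_pow_mem ‹_› _ hz)
  · rw [Polynomial.aeval_algebraMap_apply] at h0
    have := LinearMap.congr_fun h0 e
    simpa [Polynomial.aeval_def, Polynomial.eval₂_eq_eval_map] using this

variable [IsNoetherianRing R]

theorem kill_div (q : Ideal R) [q.IsPrime] (D : ModuleCat.{u} R) [Module.Finite R D] (i : ℕ)
    (M : Type u) [AddCommGroup M] [Module R M] [Module.Finite R M]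
    (x : R) (hx : x ∈ q) (hinj : Function.Injective (LinearMap.lsmul R M x))
    (h : Kill q D (i + 1) (M ⧸ LinearMap.range (LinearMap.lsmul R M x))) : Kill q D i M := by
  obtain ⟨s, hs, h⟩ := h
  have : Module.Finite R (ModuleCat.of R M) := ‹Module.Finite R M›
  refine nak q s x hs hx fun e => ?_
  have hS := ses (LinearMap.lsmul R M x) (LinearMap.range (LinearMap.lsmul R M x)).mkQ hinj
    (Submodule.mkQ_surjective _) (LinearMap.exact_map_mkQ_range _)
  obtain ⟨e', he'⟩ := Ext.contravariant_sequence_exact₁ hS D (s • e) (add_comm 1 i)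
    (by rw [Ext.comp_smul]; exact h _)
  refine ⟨e', he'.symm.trans ?_⟩
  have : ModuleCat.ofHom (LinearMap.lsmul R M x) = x • 𝟙 (ModuleCat.of R M) := by
    ext; rfl
  change (Ext.mk₀ (ModuleCat.ofHom (LinearMap.lsmul R M x))).comp e' _ = _
  rw [this, Ext.mk₀_smul, Ext.smul_comp, Ext.mk₀_id_comp]

theorem kill_prime_lt (q : Ideal R) [q.IsPrime] (D : ModuleCat.{u} R) [Module.Finite R D] (i : ℕ)
    (h : ∀ (M : Type u) [AddCommGroup M] [Module R M] [Module.Finite R M], Kill q D (i + 1) M)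
    (M : Type u) [AddCommGroup M] [Module R M] [Module.Finite R M]
    (p : Ideal R) [p.IsPrime] (f : M ≃ₗ[R] R ⧸ p) (hpq : ¬ q ≤ p) : Kill q D i M := by
  obtain ⟨x, hxq, hxp⟩ := SetLike.not_le_iff_exists.1 hpq
  refine kill_div q D i M x hxq ?_ (h _)
  rw [← LinearMap.ker_eq_bot, LinearMap.ker_eq_bot']
  intro m hm
  have hm' : x • m = 0 := hm
  have h2 : x • f m = 0 := by rw [← map_smul, hm', map_zero]
  rw [Algebra.smul_def, mul_eq_zero] at h2
  rcases h2 with h2 | h2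
  · exact absurd (Ideal.Quotient.eq_zero_iff_mem.1 h2) hxp
  · simpa using h2

theorem kill_prime_eq (q : Ideal R) [q.IsPrime] (D : ModuleCat.{u} R) (i : ℕ)
    (h : ∀ (M : Type u) [AddCommGroup M] [Module R M] [Module.Finite R M], Kill q D (i + 2) M)
    (M : Type u) [AddCommGroup M] [Module R M]
    (f : M →ₗ[R] R) (hf : Function.Injective f) : Kill q D (i + 1) M := by
  obtain ⟨s, hs, h⟩ := h (R ⧸ LinearMap.range f)
  refine ⟨s, hs, fun e => ?_⟩
  have hS := ses f (LinearMap.range f).mkQ hf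
    (Submodule.mkQ_surjective _) (LinearMap.exact_map_mkQ_range _)
  obtain ⟨e', he'⟩ := Ext.contravariant_sequence_exact₁ hS D (s • e) (add_comm 1 (i + 1))
    (by rw [Ext.comp_smul]; exact h _)
  have : Projective (ModuleCat.of R R) := inferInstance
  have h0 : e' = 0 := Ext.eq_zero_of_projective (P := ModuleCat.of R R) e'
  rw [← he', h0, Ext.comp_zero]

theorem kill_step (q : Ideal R) [q.IsPrime] (D : ModuleCat.{u} R) [Module.Finite R D] (i : ℕ)
    (hq : IsAssociatedPrime q R)
    (h : ∀ (M : Type u) [AddCommGroup M] [Module R M] [Module.Finite R M], Kill q D (i + 2) M)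
    (M : Type u) [AddCommGroup M] [Module R M] [Module.Finite R M] : Kill q D (i + 1) M := by
  induction ‹Module.Finite R M› using
    IsNoetherianRing.induction_on_isQuotientEquivQuotientPrime R with
  | subsingleton N =>
    refine ⟨1, fun hh => ‹q.IsPrime›.ne_top ((Ideal.eq_top_iff_one _).2 hh), fun e => ?_⟩
    have h0 := (Ext.eq_zero_of_projective (P := ModuleCat.of R N) e)
    rw [h0, smul_zero]
  | quotient N p f =>
    have := p.2
    by_cases hqp : q ≤ p.1
    · by_cases hpq : p.1 ≤ q
      · have he : p.1 = q := le_antisymm hpq hqp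
        obtain ⟨-, g, hg⟩ := (isAssociatedPrime_iff_exists_injective_linearMap p.1 R).1 (he ▸ hq)
        exact kill_prime_eq q D i h N (g ∘ₗ f.toLinearMap) (hg.comp f.injective)
      · obtain ⟨x, hxp, hxq⟩ := SetLike.not_le_iff_exists.1 hpq
        refine ⟨x, hxq, fun e => ?_⟩
        have hz : x • 𝟙 (ModuleCat.of R N) = 0 := by
          ext m
          apply f.injective
          change f (x • m) = f 0
          rw [map_smul, map_zero, Algebra.smul_def]
          have : algebraMap R (R ⧸ p.1) x = 0 := Ideal.Quotient.eq_zero_iff_mem.2 hxp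
          rw [this, zero_mul]
        have : e = (Ext.mk₀ (𝟙 _)).comp e (zero_add _) := (Ext.mk₀_id_comp e).symm
        rw [this, ← Ext.smul_comp, ← Ext.mk₀_smul, hz, Ext.mk₀_zero, Ext.zero_comp]
    · exact kill_prime_lt q D (i + 1) h N p.1 f hqp
  | exact N₁ N₂ N₃ f g hf hg hfg h₁ h₃ => exact kill_ses q D (i + 1) f g hf hg hfg h₁ h₃

theorem assoc_minimal (D : Type u) [AddCommGroup D] [Module R D] (hD : IsDualizingModule R D)
    (q : Ideal R) (hq : IsAssociatedPrime q R) : q ∈ minimalPrimes R := by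
  have hqp : q.IsPrime := hq.isPrime
  obtain ⟨hfin, ⟨n, hn⟩, hbij, -⟩ := hD
  have : Module.Finite R (ModuleCat.of R D) := hfin
  have key : ∀ k i : ℕ, n ≤ i + k → ∀ (M : Type u) [AddCommGroup M] [Module R M]
      [Module.Finite R M], Kill q (ModuleCat.of R D) (i + 1) M := by
    intro k
    induction k with
    | zero =>
      intro i hi M _ _ _
      refine ⟨1, fun hh => hqp.ne_top ((Ideal.eq_top_iff_one _).2 hh), fun e => ?_⟩
      rw [old_ext_to_new _ _ i (hn M _ _ (i + 1) (by omega)) e, smul_zero]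
    | succ k ih =>
      intro i hi M _ _ _
      exact kill_step q _ i hq (fun M _ _ _ => ih (i + 1) (by omega) M) M
  obtain ⟨p, hp, hpq⟩ := Ideal.exists_minimalPrimes_le (bot_le : (⊥ : Ideal R) ≤ q)
  by_cases hle : q ≤ p
  · rwa [le_antisymm hle hpq]
  exfalso
  have hann : Module.annihilator R D = ⊥ := by
    rw [eq_bot_iff]
    intro r hr
    rw [Module.mem_annihilator] at hr
    exact hbij.1 (by ext d; simp [hr d])
  have hpa : IsAssociatedPrime p D :=
    Module.associatedPrimes.minimalPrimes_annihilator_subset_associatedPrimes R D (by rwa [hann])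
  have := hpa.isPrime
  obtain ⟨-, g, hg⟩ := (isAssociatedPrime_iff_exists_injective_linearMap p D).1 hpa
  obtain ⟨s, hs, h⟩ := kill_prime_lt q (ModuleCat.of R D) 0
    (fun M _ _ _ => key n 0 (by omega) M) (R ⧸ p) p (LinearEquiv.refl _ _) hle
  have h1 := h (Ext.mk₀ (ModuleCat.ofHom g))
  rw [← Ext.mk₀_smul, Ext.mk₀_eq_zero_iff] at h1
  have h2 : s • g 1 = 0 := congrArg (fun φ => φ.hom (1 : R ⧸ p)) h1
  rw [← map_smul] at h2
  have h3 : s • (1 : R ⧸ p) = 0 := hg (by rw [h2, map_zero])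
  rw [Algebra.smul_def, mul_one] at h3
  exact hs (hpq (Ideal.Quotient.eq_zero_iff_mem.1 h3))

theorem inj_sum (hR : ∀ q : Ideal R, IsAssociatedPrime q R → q ∈ minimalPrimes R)
    (I : Type u) [AddCommGroup I] [Module R I] (hI : Module.Injective R I) (x : I) :
    x ∈ (⨆ (p : PrimeSpectrum R) (_ : Order.height p = (0 : ℕ∞)), torsionGamma p.asIdeal I) := by
  classical
  obtain ⟨t, ht⟩ := Submodule.IsLasker.exists_isMinimalPrimaryDecomposition (Submodule.isLasker R R) ⊥
  let f : R →ₗ[R] ((J : t) → R ⧸ J.1) := LinearMap.pi fun J => J.1.mkQ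
  have hf : Function.Injective f := by
    rw [← LinearMap.ker_eq_bot, LinearMap.ker_eq_bot']
    intro r hr
    have : r ∈ t.inf id := by
      rw [Submodule.mem_finsetInf]
      intro J hJ
      have := congrFun hr ⟨J, hJ⟩
      exact (Submodule.Quotient.mk_eq_zero J).1 this
    rw [ht.inf_eq] at this
    simpa using this
  obtain ⟨g, hg⟩ := hI.out f hf (LinearMap.toSpanSingleton R I x)
  have hx : x = g (f 1) := by rw [hg]; simp
  rw [hx, ← Finset.univ_sum_single (f 1), map_sum]
  refine Submodule.sum_mem _ fun J _ => ?_
  have hJ : (J.1.colon Set.univ).radical ∈ minimalPrimes R := hR _ (ht.mem_associatedPrimes J.2)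
  let P : PrimeSpectrum R := ⟨_, hJ.1.1⟩
  have hP : Order.height P = (0 : ℕ∞) := by
    rw [Order.height_eq_zero]
    intro Q hQ
    exact hJ.2 ⟨Q.2, bot_le⟩ hQ
  refine Submodule.mem_iSup_of_mem P (Submodule.mem_iSup_of_mem hP ?_)
  obtain ⟨n, hn⟩ := Ideal.exists_radical_pow_le_of_fg (J.1.colon Set.univ)
    (IsNoetherian.noetherian _)
  refine Submodule.mem_iSup_of_mem n ?_
  rw [Submodule.mem_torsionBySet_iff]
  rintro ⟨a, ha⟩
  have ha' : a ∈ J.1.colon Set.univ := hn ha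
  change a • g (Pi.single J (f 1 J)) = 0
  rw [← map_smul, ← Pi.single_smul]
  have : a • f 1 J = 0 := by
    change a • Submodule.Quotient.mk (1 : R) = 0
    rw [← Submodule.Quotient.mk_smul, Submodule.Quotient.mk_eq_zero]
    exact Submodule.mem_colon.1 ha' 1 trivial
  rw [this, Pi.single_zero, map_zero]

theorem map_gamma {M N : Type u} [AddCommGroup M] [Module R M] [AddCommGroup N] [Module R N]
    (φ : M →ₗ[R] N) (a : Ideal R) : (torsionGamma a M).map φ ≤ torsionGamma a N := by
  unfold torsionGamma
  rw [Submodule.map_iSup]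
  refine iSup_mono fun n => ?_
  rintro _ ⟨m, hm, rfl⟩
  rw [SetLike.mem_coe, Submodule.mem_torsionBySet_iff] at hm
  rw [Submodule.mem_torsionBySet_iff]
  intro b
  rw [← map_smul, hm b, map_zero]

end GorAux

/-- a Gorenstein injective module is the sum of its `p`-torsion submodules
over the primes of height `0`. -/
theorem iSup_torsionGamma_height_zero_eq_top
    {R : Type u} [CommRing R] [IsNoetherianRing R]
    (D : Type u) [AddCommGroup D] [Module R D] (hD : IsDualizingModule R D)
    (G : Type u) [AddCommGroup G] [Module R G] (hG : IsGorensteinInjective R G) :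
    (⨆ (p : PrimeSpectrum R) (_ : Order.height p = (0 : ℕ∞)),
      torsionGamma p.asIdeal G) = (⊤ : Submodule R G) := by
  classical
  obtain ⟨C⟩ := hG
  let := C.acg
  let := C.mod
  have hs : ∀ y : LinearMap.ker (C.d (-1)), ∃ x, C.d (-1 + 1) x = (y : C.E (-1 + 1)) := by
    intro y
    exact (C.exact (-1)).ge y.2
  let φ : C.E (-1 + 1 + 1) →ₗ[R] G := C.equiv.symm.toLinearMap ∘ₗ
    (C.d (-1 + 1)).codRestrict (LinearMap.ker (C.d (-1)))
      (fun x => by rw [← C.exact (-1)]; exact ⟨x, rfl⟩)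
  rw [eq_top_iff]
  intro y _
  obtain ⟨x, hx⟩ := hs (C.equiv y)
  have hy : φ x = y := by
    apply C.equiv.injective
    apply Subtype.ext
    change ((C.equiv (C.equiv.symm _) : LinearMap.ker (C.d (-1))) : C.E (-1 + 1)) = _
    rw [LinearEquiv.apply_symm_apply]
    exact hx
  have hm := GorAux.inj_sum (GorAux.assoc_minimal D hD) _ (C.inj (-1 + 1 + 1)) x
  have hm' := Submodule.mem_map_of_mem (f := φ) hm
  rw [hy, Submodule.map_iSup] at hm'
  revert hm'
  apply SetLike.le_def.1
  refine iSup_mono (fun p => ?_)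
  rw [Submodule.map_iSup]
  exact iSup_mono fun _ => GorAux.map_gamma φ _
end

section
/- Let R be a commutative noetherian ring with a dualizing module D, let p be a prime ideal of R of height h, and let I be an injective R-module. Then Tor_h^R(E(R/p), Hom_R(D, I)) is an injective R-module. -/
open CategoryTheory

universe u

namespace DZ

section
variable {R : Type u} [CommRing R]

lemma exists_factor {X Y J : Type u} [AddCommGroup X] [Module R X] [AddCommGroup Y] [Module R Y]
    [AddCommGroup J] [Module R J] (hJ : Module.Injective R J) (P : X →ₗ[R] Y) (Φ : X →ₗ[R] J)
    (h : LinearMap.ker P ≤ LinearMap.ker Φ) : ∃ Ψ : Y →ₗ[R] J, Ψ ∘ₗ P = Φ := by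
  let Pb := (LinearMap.ker P).liftQ P le_rfl
  have hPb : Function.Injective Pb :=
    LinearMap.ker_eq_bot.mp (Submodule.ker_liftQ_eq_bot _ _ _ le_rfl)
  obtain ⟨Ψ, hΨ⟩ := hJ.out Pb hPb ((LinearMap.ker P).liftQ Φ h)
  refine ⟨Ψ, ?_⟩
  ext x
  simpa [Pb] using hΨ (Submodule.Quotient.mk x)

lemma inj_crit {J : Type u} [AddCommGroup J] [Module R J] (hJ : Module.Injective R J) {n : ℕ}
    (a : Fin n → R) (e : Fin n → J)
    (h : ∀ c : Fin n → R, ∑ i, a i * c i = 0 → ∑ i, c i • e i = 0) :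
    ∃ e0 : J, ∀ i, e i = a i • e0 := by
  obtain ⟨Ψ, hΨ⟩ := exists_factor (R := R)
    (X := ULift.{u} (Fin n) → R) hJ
    (Fintype.linearCombination R (fun i => a i.down)) (Fintype.linearCombination R (fun i => e i.down))
    (by
      intro c hc
      simp only [LinearMap.mem_ker, Fintype.linearCombination_apply] at hc ⊢
      have := h (fun i => c ⟨i⟩) (by
        rw [← Equiv.ulift.sum_comp] ; rw [← hc]; apply Finset.sum_congr rfl; intro i _
        simp [mul_comm])
      rw [← Equiv.ulift.sum_comp] at this
      exact this)
  refine ⟨Ψ 1, fun i => ?_⟩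
  have := LinearMap.congr_fun hΨ (Pi.single ⟨i⟩ 1)
  simp [Fintype.linearCombination_apply_single] at this
  rw [← this, ← map_smul]; simp

lemma inj_of_crit [IsNoetherianRing R] {J : Type u} [AddCommGroup J] [Module R J]
    (H : ∀ (n : ℕ) (a : Fin n → R) (e : Fin n → J),
      (∀ c : Fin n → R, ∑ i, a i * c i = 0 → ∑ i, c i • e i = 0) →
      ∃ e0 : J, ∀ i, e i = a i • e0) : Module.Injective R J := by
  apply Module.Baer.injective
  intro I g
  obtain ⟨n, a, ha⟩ := Submodule.fg_iff_exists_fin_generating_family.mp (IsNoetherian.noetherian I)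
  have hmem : ∀ i, a i ∈ I := fun i => ha ▸ Submodule.subset_span ⟨i, rfl⟩
  obtain ⟨e0, he0⟩ := H n a (fun i => g ⟨a i, hmem i⟩) (by
    intro c hc
    have : ∑ i, c i • (⟨a i, hmem i⟩ : I) = 0 := by
      ext; simpa [mul_comm] using hc
    have h2 := congrArg g this
    rw [map_sum, map_zero] at h2
    simpa only [map_smul] using h2)
  refine ⟨LinearMap.toSpanSingleton R J e0, ?_⟩
  intro x hx
  have hx' := hx
  rw [← ha, Submodule.mem_span_range_iff_exists_fun] at hx'
  obtain ⟨c, rfl⟩ := hx'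
  have : (⟨∑ i, c i • a i, hx⟩ : I) = ∑ i, c i • (⟨a i, hmem i⟩ : I) := by
    ext; simp
  rw [this, map_sum, map_sum]
  refine Finset.sum_congr rfl fun i _ => ?_
  rw [LinearMap.map_smul, LinearMap.map_smul, he0]
  simp

lemma rel_gens [IsNoetherianRing R] {n : ℕ} (f : Fin n → R) :
    ∃ (m : ℕ) (r : Fin m → Fin n → R), (∀ j, ∑ i, f i * r j i = 0) ∧
      ∀ c : Fin n → R, ∑ i, f i * c i = 0 → ∃ b : Fin m → R, c = ∑ j, b j • r j := by
  obtain ⟨m, r, hr⟩ := Submodule.fg_iff_exists_fin_generating_family.mp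
    (IsNoetherian.noetherian (LinearMap.ker (Fintype.linearCombination R f)))
  refine ⟨m, r, fun j => ?_, fun c hc => ?_⟩
  · have : r j ∈ LinearMap.ker (Fintype.linearCombination R f) :=
      hr ▸ Submodule.subset_span ⟨j, rfl⟩
    simpa [Fintype.linearCombination_apply, mul_comm] using this
  · have : c ∈ LinearMap.ker (Fintype.linearCombination R f) := by
      simpa [Fintype.linearCombination_apply, mul_comm] using hc
    rw [← hr, Submodule.mem_span_range_iff_exists_fun] at this
    obtain ⟨b, hb⟩ := this
    exact ⟨b, hb.symm⟩

/-- the relation matrix map -/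
def relMap (J : Type u) [AddCommGroup J] [Module R J] {n m : ℕ} (r : Fin m → Fin n → R) :
    (Fin n → J) →ₗ[R] (Fin m → J) :=
  LinearMap.pi fun j => ∑ i, r j i • LinearMap.proj i

lemma relMap_apply (J : Type u) [AddCommGroup J] [Module R J] {n m : ℕ} (r : Fin m → Fin n → R)
    (e : Fin n → J) (j : Fin m) : relMap J r e j = ∑ i, r j i • e i := by
  simp [relMap]

/-- the diagonal map -/
def diagMap (J : Type u) [AddCommGroup J] [Module R J] {n : ℕ} (f : Fin n → R) :
    J →ₗ[R] (Fin n → J) :=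
  LinearMap.pi fun i => f i • LinearMap.id

lemma exact_of_inj {J : Type u} [AddCommGroup J] [Module R J] (hJ : Module.Injective R J)
    {n m : ℕ} (f : Fin n → R) (r : Fin m → Fin n → R) (h1 : ∀ j, ∑ i, f i * r j i = 0)
    (h2 : ∀ c : Fin n → R, ∑ i, f i * c i = 0 → ∃ b : Fin m → R, c = ∑ j, b j • r j) :
    Function.Exact (diagMap (R := R) J f) (relMap J r) := by
  intro e
  constructor
  · intro he
    obtain ⟨e0, he0⟩ := inj_crit hJ f e (by
      intro c hc
      obtain ⟨b, rfl⟩ := h2 c hc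
      simp only [Finset.sum_apply, Pi.smul_apply, smul_eq_mul, Finset.sum_smul, mul_smul]
      rw [Finset.sum_comm]
      apply Finset.sum_eq_zero
      intro j _
      rw [← Finset.smul_sum, ← relMap_apply, he]; simp)
    exact ⟨e0, by ext i; simp [diagMap, he0]⟩
  · rintro ⟨e0, rfl⟩
    ext j
    rw [relMap_apply]
    simp only [diagMap, LinearMap.pi_apply, LinearMap.smul_apply, LinearMap.id_apply, smul_smul,
      ← Finset.sum_smul]
    simp_rw [mul_comm (r j _)]
    rw [h1 j]; simp

lemma flat_hom_inj [IsNoetherianRing R] {J I : Type u} [AddCommGroup J] [Module R J]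
    [AddCommGroup I] [Module R I]
    (hJ : Module.Injective R J) (hI : Module.Injective R I) : Module.Flat R (J →ₗ[R] I) := by
  rw [Module.Flat.iff_forall_isTrivialRelation]
  intro l f φ hφ
  obtain ⟨m, r, h1, h2⟩ := rel_gens f
  have hex := exact_of_inj hJ f r h1 h2
  obtain ⟨Ψ, hΨ⟩ := exists_factor hI (relMap J r) (LinearMap.lsum R (fun _ => J) R φ) (by
    intro e he
    obtain ⟨e0, rfl⟩ := (hex e).mp he
    have := LinearMap.congr_fun hφ e0
    simpa [diagMap, LinearMap.lsum_apply] using this)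
  refine ⟨m, fun i j => r j i, fun j => Ψ ∘ₗ LinearMap.single R (fun _ => J) j, fun i => ?_, h1⟩
  ext e
  have := LinearMap.congr_fun hΨ (Pi.single i e)
  have e1 : (LinearMap.lsum R (fun _ => J) R φ) (Pi.single i e) = φ i e := by
    rw [LinearMap.lsum_piSingle]
  have e2 : relMap J r (Pi.single i e) = ∑ j, r j i • Pi.single j e := by
    ext j
    rw [relMap_apply, Finset.sum_apply]
    rw [Finset.sum_eq_single i (by intro b _ hb; simp [hb]) (by simp)]
    rw [Finset.sum_eq_single j (by intro b _ hb; simp [hb.symm]) (by simp)]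
    simp
  rw [LinearMap.comp_apply, e1, e2] at this
  rw [← this]
  simp

lemma inj_of_flat_dual [IsNoetherianRing R] {Q T : Type u} [AddCommGroup Q] [Module R Q]
    [AddCommGroup T] [Module R T]
    (hcog : ∀ (M : Type u) [AddCommGroup M] [Module R M] (m : M), m ≠ 0 → ∃ f : M →ₗ[R] Q, f m ≠ 0)
    (hT : Module.Flat R (T →ₗ[R] Q)) : Module.Injective R T := by
  apply inj_of_crit
  intro n a e he
  by_contra hcon
  have hne : (LinearMap.range (diagMap (R := R) T a)).mkQ e ≠ 0 := by
    intro h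
    rw [Submodule.mkQ_apply, Submodule.Quotient.mk_eq_zero] at h
    obtain ⟨e0, h0⟩ := h
    exact hcon ⟨e0, fun i => by rw [← h0]; simp [diagMap]⟩
  obtain ⟨χ, hχ⟩ := hcog _ _ hne
  let ψ := χ ∘ₗ (LinearMap.range (diagMap (R := R) T a)).mkQ
  let φ : Fin n → (T →ₗ[R] Q) := fun i => ψ ∘ₗ LinearMap.single R (fun _ => T) i
  have hψ : ∀ v, ψ v = ∑ i, φ i (v i) := by
    intro v
    simp only [φ, LinearMap.comp_apply, ← map_sum]
    congr 1
    ext i; simp [Finset.sum_apply, Pi.single_apply]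
  have hrel : ∑ i, a i • φ i = 0 := by
    ext t
    have h0 : ψ (diagMap (R := R) T a t) = 0 := by
      simp only [ψ, LinearMap.comp_apply]
      rw [Submodule.mkQ_apply, (Submodule.Quotient.mk_eq_zero _).mpr (LinearMap.mem_range_self _ t), map_zero]
    rw [hψ] at h0
    simpa [diagMap] using h0
  obtain ⟨k, c, y, hy, hc⟩ := Module.Flat.isTrivialRelation_of_sum_smul_eq_zero hrel
  apply hχ
  change ψ e = 0
  rw [hψ]
  simp only [hy, LinearMap.sum_apply, LinearMap.smul_apply]
  rw [Finset.sum_comm]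
  apply Finset.sum_eq_zero
  intro j _
  have := he (fun i => c i j) (hc j)
  simpa using congrArg (y j) this

open TensorProduct in
lemma inj_tensor [IsNoetherianRing R] {F E : Type u} [AddCommGroup F] [Module R F]
    [AddCommGroup E] [Module R E] (hF : Module.Flat R F) (hE : Module.Injective R E) :
    Module.Injective R (F ⊗[R] E) := by
  apply inj_of_crit
  intro n a e he
  obtain ⟨m, r, h1, h2⟩ := rel_gens a
  have hex := Module.Flat.lTensor_exact F (exact_of_inj hE a r h1 h2)
  let p1 := TensorProduct.piRight R R F (fun _ : Fin n => E)
  let p2 := TensorProduct.piRight R R F (fun _ : Fin m => E)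
  have c1 : ∀ z, p1 ((diagMap (R := R) E a).lTensor F z) = diagMap (R := R) (F ⊗[R] E) a z := by
    intro z
    induction z with
    | zero => simp
    | add x y hx hy => simp only [map_add, hx, hy]
    | tmul x y =>
      ext i
      simp [p1, diagMap]
  have c2 : ∀ z, p2 ((relMap (R := R) E r).lTensor F z) = relMap (R := R) (F ⊗[R] E) r (p1 z) := by
    intro z
    induction z with
    | zero => simp
    | add x y hx hy => simp only [map_add, hx, hy]
    | tmul x y =>
      ext i
      rw [relMap_apply]
      simp [p1, p2, relMap_apply, TensorProduct.tmul_sum]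
  have hz : (relMap (R := R) E r).lTensor F (p1.symm e) = 0 := by
    apply p2.injective
    rw [c2, LinearEquiv.apply_symm_apply, map_zero]
    ext j
    rw [relMap_apply]
    exact he _ (h1 j)
  obtain ⟨z, hz⟩ := (hex _).mp hz
  refine ⟨z, fun i => ?_⟩
  have := congrArg p1 hz
  rw [c1, LinearEquiv.apply_symm_apply] at this
  rw [← this]; simp [diagMap]

/-- Hom-tensor adjunction: Hom(F, Hom(E,Q)) flat. -/
lemma flat_hom_hom [IsNoetherianRing R] {F E Q : Type u} [AddCommGroup F] [Module R F]
    [AddCommGroup E] [Module R E] [AddCommGroup Q] [Module R Q]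
    (hF : Module.Flat R F) (hE : Module.Injective R E) (hQ : Module.Injective R Q) :
    Module.Flat R (F →ₗ[R] E →ₗ[R] Q) :=
  haveI := flat_hom_inj (inj_tensor hF hE) hQ
  Module.Flat.of_linearEquiv (TensorProduct.lift.equiv (.id R) F E Q)

/-- Hom(G,Q) injective for G flat. -/
lemma inj_hom {G Q : Type u} [AddCommGroup G] [Module R G] [AddCommGroup Q] [Module R Q]
    (hG : Module.Flat R G) (hQ : Module.Injective R Q) : Module.Injective R (G →ₗ[R] Q) := by
  constructor
  intro X Y _ _ _ _ f hf g
  obtain ⟨Ψ, hΨ⟩ := hQ.out (f.rTensor G) (Module.Flat.rTensor_preserves_injective_linearMap f hf)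
    (TensorProduct.lift g)
  refine ⟨TensorProduct.curry Ψ, fun x => ?_⟩
  ext y
  simpa using hΨ (TensorProduct.tmul R x y)

open TensorProduct in
/-- restriction of scalars of injectives along flat -/
lemma inj_restrict {B : Type u} [CommRing B] [Algebra R B] (hB : Module.Flat R B)
    {J : Type u} [AddCommGroup J] [Module R J] [Module B J] [IsScalarTower R B J]
    (hJ : Module.Injective B J) : Module.Injective R J := by
  constructor
  intro X Y _ _ _ _ f hf g
  have hinj : Function.Injective (f.baseChange B) := by
    have := Module.Flat.lTensor_preserves_injective_linearMap (M := B) f hf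
    exact this
  let g' : B ⊗[R] X →ₗ[B] J := AlgebraTensorModule.lift
    ((LinearMap.lsmul B (X →ₗ[R] J)).flip g)
  obtain ⟨Ψ, hΨ⟩ := hJ.out (f.baseChange B) hinj g'
  refine ⟨(Ψ.restrictScalars R) ∘ₗ (TensorProduct.mk R B Y 1), fun x => ?_⟩
  have := hΨ (1 ⊗ₜ x)
  simpa [g'] using this

lemma inj_of_equiv {J J' : Type u} [AddCommGroup J] [Module R J] [AddCommGroup J'] [Module R J']
    (hJ : Module.Injective R J) (e : J ≃ₗ[R] J') : Module.Injective R J' := by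
  constructor
  intro X Y _ _ _ _ f hf g
  obtain ⟨Ψ, hΨ⟩ := hJ.out f hf (e.symm.toLinearMap ∘ₗ g)
  exact ⟨e.toLinearMap ∘ₗ Ψ, fun x => by simp [hΨ]⟩

variable (R) in
/-- A cogenerator -/
lemma exists_cogen : ∃ (Q : Type u) (_ : AddCommGroup Q) (_ : Module R Q),
    Module.Injective R Q ∧
    ∀ (M : Type u) [AddCommGroup M] [Module R M] (m : M), m ≠ 0 → ∃ f : M →ₗ[R] Q, f m ≠ 0 := by
  refine ⟨CharacterModule R, inferInstance, inferInstance, ?_, ?_⟩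
  · exact (Module.Flat.iff_characterModule_injective (R := R) (M := R)).mp inferInstance
  · intro M _ _ m hm
    obtain ⟨c, hc⟩ := CharacterModule.exists_character_apply_ne_zero_of_ne_zero hm
    refine ⟨CharacterModule.curry (R := R) (A := M) (B := R)
      (CharacterModule.dual (TensorProduct.rid R M).toLinearMap c), fun h => hc ?_⟩
    have h2 : CharacterModule.curry (R := R) (A := M) (B := R)
      (CharacterModule.dual (TensorProduct.rid R M).toLinearMap c) m (1 : R) = 0 := by
      rw [h]; rfl
    have h3 : c ((TensorProduct.rid R M) (TensorProduct.tmul R m 1)) = 0 := h2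
    simpa using h3

end
end DZ


namespace DZ
open CategoryTheory.Abelian
section
variable (R : Type u) [CommRing R]

/-- Ext of modules. -/
abbrev EX (X Y : Type u) [AddCommGroup X] [Module R X] [AddCommGroup Y] [Module R Y] (n : ℕ) :
    Type u := Ext.{u} (ModuleCat.of R X) (ModuleCat.of R Y) n

/-- vanishing of Ext -/
def Van (X Y : Type u) [AddCommGroup X] [Module R X] [AddCommGroup Y] [Module R Y] (n : ℕ) :
    Prop := Subsingleton (EX R X Y n)

/-- flatness of Ext -/
def FlatE (X Y : Type u) [AddCommGroup X] [Module R X] [AddCommGroup Y] [Module R Y] (n : ℕ) :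
    Prop := Module.Flat R (EX R X Y n)

variable {R}
variable {X X1 X2 X3 Y Y1 Y2 Y3 : Type u} [AddCommGroup X] [Module R X] [AddCommGroup Y] [Module R Y]
  [AddCommGroup X1] [Module R X1] [AddCommGroup X2] [Module R X2] [AddCommGroup X3] [Module R X3]
  [AddCommGroup Y1] [Module R Y1] [AddCommGroup Y2] [Module R Y2] [AddCommGroup Y3] [Module R Y3]

lemma Van.flat {n : ℕ} (h : Van R X Y n) : FlatE R X Y n := by
  unfold Van at h; unfold FlatE; infer_instance

lemma ses {f : X1 →ₗ[R] X2} {g : X2 →ₗ[R] X3} (hf : Function.Injective f)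
    (hg : Function.Surjective g) (hfg : Function.Exact f g) :
    (ShortComplex.mk (ModuleCat.ofHom f) (ModuleCat.ofHom g)
      (by rw [← ModuleCat.ofHom_comp, hfg.linearMap_comp_eq_zero]; rfl)).ShortExact :=
  ModuleCat.shortComplex_shortExact _ hfg hf hg

lemma van_of_inj (hY : Module.Injective R Y) (n : ℕ) : Van R X Y (n + 1) := by
  have : Injective (ModuleCat.of R Y) := (Module.injective_iff_injective_object R Y).mp hY
  exact ⟨fun a b => by rw [Ext.eq_zero_of_injective a, Ext.eq_zero_of_injective b]⟩

lemma van_of_proj [Module.Projective R X] (n : ℕ) : Van R X Y (n + 1) := by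
  have : Projective (ModuleCat.of R X) := inferInstance
  exact ⟨fun a b => by rw [Ext.eq_zero_of_projective a, Ext.eq_zero_of_projective b]⟩

/-- Ext 0 is Hom -/
noncomputable def ex0 : EX R X Y 0 ≃ₗ[R] (X →ₗ[R] Y) :=
  (Ext.linearEquiv₀ (R := R)).trans ModuleCat.homLinearEquiv

lemma van_zero_iff : Van R X Y 0 ↔ ∀ f : X →ₗ[R] Y, f = 0 := by
  have e := ex0 (R := R) (X := X) (Y := Y)
  constructor
  · intro h f
    have h : Subsingleton (EX R X Y 0) := h
    exact e.symm.injective (Subsingleton.elim _ _)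
  · intro h
    exact ⟨fun a b => e.injective (by rw [h (e a), h (e b)])⟩

lemma flat_zero_iff : FlatE R X Y 0 ↔ Module.Flat R (X →ₗ[R] Y) :=
  Module.Flat.equiv_iff ex0

section contra
variable {f : X1 →ₗ[R] X2} {g : X2 →ₗ[R] X3} (hf : Function.Injective f)
    (hg : Function.Surjective g) (hfg : Function.Exact f g)
include hf hg hfg

lemma van_c1 {n : ℕ} (h2 : Van R X2 Y n) (h3 : Van R X3 Y (n + 1)) : Van R X1 Y n := by
  have h2 : Subsingleton (EX R X2 Y n) := h2
  have h3 : Subsingleton (EX R X3 Y (n + 1)) := h3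
  have key : ∀ x : EX R X1 Y n, x = 0 := fun x => by
    obtain ⟨y, hy⟩ := Ext.contravariant_sequence_exact₁ (ses hf hg hfg) _ x (n₁ := n + 1) (by omega)
      (Subsingleton.elim (α := EX R X3 Y (n + 1)) _ _)
    rw [← hy, Subsingleton.elim (α := EX R X2 Y n) y 0, Ext.comp_zero]
  exact ⟨fun a b => by rw [key a, key b]⟩

lemma van_c2 {n : ℕ} (h1 : Van R X1 Y n) (h3 : Van R X3 Y n) : Van R X2 Y n := by
  have h1 : Subsingleton (EX R X1 Y n) := h1
  have h3 : Subsingleton (EX R X3 Y n) := h3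
  have key : ∀ x : EX R X2 Y n, x = 0 := fun x => by
    obtain ⟨y, hy⟩ := Ext.contravariant_sequence_exact₂ (ses hf hg hfg) _ x
      (Subsingleton.elim (α := EX R X1 Y n) _ _)
    rw [← hy, Subsingleton.elim (α := EX R X3 Y n) y 0, Ext.comp_zero]
  exact ⟨fun a b => by rw [key a, key b]⟩

lemma van_c3 {n : ℕ} (h1 : Van R X1 Y n) (h2 : Van R X2 Y (n + 1)) : Van R X3 Y (n + 1) := by
  have h1 : Subsingleton (EX R X1 Y n) := h1
  have h2 : Subsingleton (EX R X2 Y (n + 1)) := h2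
  have key : ∀ x : EX R X3 Y (n + 1), x = 0 := fun x => by
    obtain ⟨y, hy⟩ := Ext.contravariant_sequence_exact₃ (ses hf hg hfg) _ x
      (Subsingleton.elim (α := EX R X2 Y (n + 1)) _ _) (n₀ := n) (by omega)
    rw [← hy, Subsingleton.elim (α := EX R X1 Y n) y 0, Ext.comp_zero]
  exact ⟨fun a b => by rw [key a, key b]⟩

lemma flat_c3 {n : ℕ} (h2 : Van R X2 Y n) (h2' : Van R X2 Y (n + 1)) (hF : FlatE R X1 Y n) :
    FlatE R X3 Y (n + 1) := by
  have h2 : Subsingleton (EX R X2 Y n) := h2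
  have h2' : Subsingleton (EX R X2 Y (n + 1)) := h2'
  have hF : Module.Flat R (EX R X1 Y n) := hF
  let S := ses hf hg hfg
  let L : EX R X1 Y n →ₗ[R] EX R X3 Y (n + 1) :=
    Ext.bilinearCompOfLinear R _ _ _ 1 n (n + 1) (by omega) S.extClass
  have hL : Function.Bijective L := by
    constructor
    · rw [injective_iff_map_eq_zero]
      intro x hx
      obtain ⟨y, hy⟩ := Ext.contravariant_sequence_exact₁ S _ x (n₁ := n + 1) (by omega) hx
      rw [← hy, Subsingleton.elim (α := EX R X2 Y n) y 0, Ext.comp_zero]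
    · intro x
      obtain ⟨y, hy⟩ := Ext.contravariant_sequence_exact₃ S _ x
        (Subsingleton.elim (α := EX R X2 Y (n + 1)) _ _) (n₀ := n) (by omega)
      exact ⟨y, hy⟩
  exact Module.Flat.of_linearEquiv (LinearEquiv.ofBijective L hL).symm

lemma flat_c2_of_van1 {n : ℕ} (h1 : ∀ k, Van R X1 Y k) (hF : FlatE R X3 Y n) :
    FlatE R X2 Y n := by
  have h1 : ∀ k, Subsingleton (EX R X1 Y k) := h1
  have hF : Module.Flat R (EX R X3 Y n) := hF
  let S := ses hf hg hfg
  let L : EX R X3 Y n →ₗ[R] EX R X2 Y n :=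
    Ext.bilinearCompOfLinear R _ _ _ 0 n n (by omega) (Ext.mk₀ (ModuleCat.ofHom g))
  have hL : Function.Bijective L := by
    constructor
    · rw [injective_iff_map_eq_zero]
      intro x hx
      obtain _ | n := n
      · have : Epi (ModuleCat.ofHom g) := (ModuleCat.epi_iff_surjective _).mpr hg
        have h := Ext.precomp_mk₀_injective_of_epi (ModuleCat.of R Y) (ModuleCat.ofHom g)
        apply h
        rw [map_zero]; exact hx
      · obtain ⟨y, hy⟩ := Ext.contravariant_sequence_exact₃ S _ x hx (n₀ := n) (by omega)
        have := h1 n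
        rw [← hy, Subsingleton.elim (α := EX R X1 Y n) y 0, Ext.comp_zero]
    · intro x
      have := h1 n
      obtain ⟨y, hy⟩ := Ext.contravariant_sequence_exact₂ S _ x
        (Subsingleton.elim (α := EX R X1 Y n) _ _) 
      exact ⟨y, hy⟩
  exact Module.Flat.of_linearEquiv (LinearEquiv.ofBijective L hL).symm

lemma flat_c1_of_van3 {n : ℕ} (h3 : ∀ k, Van R X3 Y k) (hF : FlatE R X2 Y n) :
    FlatE R X1 Y n := by
  have h3 : ∀ k, Subsingleton (EX R X3 Y k) := h3
  have hF : Module.Flat R (EX R X2 Y n) := hF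
  let S := ses hf hg hfg
  let L : EX R X2 Y n →ₗ[R] EX R X1 Y n :=
    Ext.bilinearCompOfLinear R _ _ _ 0 n n (by omega) (Ext.mk₀ (ModuleCat.ofHom f))
  have hL : Function.Bijective L := by
    constructor
    · rw [injective_iff_map_eq_zero]
      intro x hx
      obtain ⟨y, hy⟩ := Ext.contravariant_sequence_exact₂ S _ x hx
      have := h3 n
      rw [← hy, Subsingleton.elim (α := EX R X3 Y n) y 0, Ext.comp_zero]
    · intro x
      have := h3 (n + 1)
      obtain ⟨y, hy⟩ := Ext.contravariant_sequence_exact₁ S _ x (n₁ := n + 1) (by omega)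
        (Subsingleton.elim (α := EX R X3 Y (n + 1)) _ _) 
      exact ⟨y, hy⟩
  exact Module.Flat.of_linearEquiv (LinearEquiv.ofBijective L hL).symm

end contra

section cov
variable {f : Y1 →ₗ[R] Y2} {g : Y2 →ₗ[R] Y3} (hf : Function.Injective f)
    (hg : Function.Surjective g) (hfg : Function.Exact f g)
include hf hg hfg

lemma van_v1 {n : ℕ} (h2 : Van R X Y2 (n + 1)) (h3 : Van R X Y3 n) : Van R X Y1 (n + 1) := by
  have h2 : Subsingleton (EX R X Y2 (n + 1)) := h2
  have h3 : Subsingleton (EX R X Y3 n) := h3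
  have key : ∀ x : EX R X Y1 (n + 1), x = 0 := fun x => by
    obtain ⟨y, hy⟩ := Ext.covariant_sequence_exact₁ _ (ses hf hg hfg) x
      (Subsingleton.elim (α := EX R X Y2 (n + 1)) _ _) (n₀ := n) (by omega)
    rw [← hy, Subsingleton.elim (α := EX R X Y3 n) y 0, Ext.zero_comp]
  exact ⟨fun a b => by rw [key a, key b]⟩

lemma van_v2 {n : ℕ} (h1 : Van R X Y1 n) (h3 : Van R X Y3 n) : Van R X Y2 n := by
  have h1 : Subsingleton (EX R X Y1 n) := h1
  have h3 : Subsingleton (EX R X Y3 n) := h3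
  have key : ∀ x : EX R X Y2 n, x = 0 := fun x => by
    obtain ⟨y, hy⟩ := Ext.covariant_sequence_exact₂ _ (ses hf hg hfg) x
      (Subsingleton.elim (α := EX R X Y3 n) _ _)
    rw [← hy, Subsingleton.elim (α := EX R X Y1 n) y 0, Ext.zero_comp]
  exact ⟨fun a b => by rw [key a, key b]⟩

lemma van_v3 {n : ℕ} (h1 : Van R X Y1 (n + 1)) (h2 : Van R X Y2 n) : Van R X Y3 n := by
  have h1 : Subsingleton (EX R X Y1 (n + 1)) := h1
  have h2 : Subsingleton (EX R X Y2 n) := h2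
  have key : ∀ x : EX R X Y3 n, x = 0 := fun x => by
    obtain ⟨y, hy⟩ := Ext.covariant_sequence_exact₃ _ (ses hf hg hfg) x (n₁ := n + 1) (by omega)
      (Subsingleton.elim (α := EX R X Y1 (n + 1)) _ _)
    rw [← hy, Subsingleton.elim (α := EX R X Y2 n) y 0, Ext.zero_comp]
  exact ⟨fun a b => by rw [key a, key b]⟩

end cov

lemma Van.congr_left (e : X1 ≃ₗ[R] X2) {n : ℕ} (h : Van R X1 Y n) : Van R X2 Y n := by
  have h : Subsingleton (EX R X1 Y n) := h
  have key : ∀ x : EX R X2 Y n, x = 0 := fun x => by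
    have h1 : (Ext.mk₀ e.symm.toModuleIso.hom).comp
        ((Ext.mk₀ e.toModuleIso.hom).comp x (zero_add n)) (zero_add n) = x := by
      rw [Ext.mk₀_comp_mk₀_assoc]
      have : e.symm.toModuleIso.hom ≫ e.toModuleIso.hom = 𝟙 _ := by
        ext x; simp
      rw [this, Ext.mk₀_id_comp]
    rw [← h1, Subsingleton.elim (α := EX R X1 Y n) ((Ext.mk₀ e.toModuleIso.hom).comp x (zero_add n)) 0,
      Ext.comp_zero]
  exact ⟨fun a b => by rw [key a, key b]⟩

lemma Van.congr_right (e : Y1 ≃ₗ[R] Y2) {n : ℕ} (h : Van R X Y1 n) : Van R X Y2 n := by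
  have h : Subsingleton (EX R X Y1 n) := h
  have key : ∀ x : EX R X Y2 n, x = 0 := fun x => by
    have h1 : (x.comp (Ext.mk₀ e.symm.toModuleIso.hom) (add_zero n)).comp
        (Ext.mk₀ e.toModuleIso.hom) (add_zero n) = x := by
      rw [Ext.comp_assoc_of_third_deg_zero, Ext.mk₀_comp_mk₀]
      have : e.symm.toModuleIso.hom ≫ e.toModuleIso.hom = 𝟙 _ := by
        ext x; simp
      rw [this, Ext.comp_mk₀_id]
    rw [← h1, Subsingleton.elim (α := EX R X Y1 n) (x.comp (Ext.mk₀ e.symm.toModuleIso.hom) (add_zero n)) 0,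
      Ext.zero_comp]
  exact ⟨fun a b => by rw [key a, key b]⟩

lemma van_one_of_ext {f : Y1 →ₗ[R] Y2} {g : Y2 →ₗ[R] Y3} (hf : Function.Injective f)
    (hg : Function.Surjective g) (hfg : Function.Exact f g) (h2 : Van R X Y2 1)
    (h : ∀ φ : X →ₗ[R] Y3, ∃ ψ : X →ₗ[R] Y2, g ∘ₗ ψ = φ) : Van R X Y1 1 := by
  have h2 : Subsingleton (EX R X Y2 1) := h2
  have key : ∀ x : EX R X Y1 1, x = 0 := fun x => by
    obtain ⟨y, hy⟩ := Ext.covariant_sequence_exact₁ _ (ses hf hg hfg) x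
      (Subsingleton.elim (α := EX R X Y2 1) _ _) (n₀ := 0) (by omega)
    obtain ⟨φ, rfl⟩ := (Ext.mk₀_bijective (ModuleCat.of R X) (ModuleCat.of R Y3)).2 y
    obtain ⟨ψ, hψ⟩ := h φ.hom
    have : φ = ModuleCat.ofHom ψ ≫ ModuleCat.ofHom g := by
      rw [← ModuleCat.ofHom_comp, hψ]; rfl
    rw [← hy, this, ← Ext.mk₀_comp_mk₀]
    rw [Ext.comp_assoc_of_second_deg_zero]
    have h0 := (ses hf hg hfg).comp_extClass
    dsimp at h0
    rw [h0, Ext.comp_zero]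
  exact ⟨fun a b => by rw [key a, key b]⟩

lemma lift_of_van_one {f : Y1 →ₗ[R] Y2} {g : Y2 →ₗ[R] Y3} (hf : Function.Injective f)
    (hg : Function.Surjective g) (hfg : Function.Exact f g) (h1 : Van R X Y1 1)
    (φ : X →ₗ[R] Y3) : ∃ ψ : X →ₗ[R] Y2, g ∘ₗ ψ = φ := by
  have h1 : Subsingleton (EX R X Y1 1) := h1
  obtain ⟨y, hy⟩ := Ext.covariant_sequence_exact₃ _ (ses hf hg hfg) (Ext.mk₀ (ModuleCat.ofHom φ))
    (n₁ := 1) (by omega) (Subsingleton.elim (α := EX R X Y1 1) _ _)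
  obtain ⟨ψ, rfl⟩ := (Ext.mk₀_bijective (ModuleCat.of R X) (ModuleCat.of R Y2)).2 y
  dsimp at hy
  rw [Ext.mk₀_comp_mk₀] at hy
  have := (Ext.mk₀_bijective _ _).1 hy
  exact ⟨ψ.hom, by simpa using congrArg ModuleCat.Hom.hom this⟩

end
end DZ


namespace DZ
section
variable {R : Type u} [CommRing R]

lemma exists_embed (M : Type u) [AddCommGroup M] [Module R M] :
    ∃ (J : Type u) (_ : AddCommGroup J) (_ : Module R J) (f : M →ₗ[R] J),
      Module.Injective R J ∧ Function.Injective f := by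
  let J := Injective.under (ModuleCat.of R M)
  refine ⟨J, inferInstance, inferInstance, (Injective.ι (ModuleCat.of R M)).hom, ?_, ?_⟩
  · exact (Module.injective_iff_injective_object R J).mpr (inferInstanceAs (Injective J))
  · exact (ModuleCat.mono_iff_injective _).mp inferInstance

/-- precomposition exact sequence into injective module -/
lemma lcomp_ses {X1 X2 X3 Q : Type u} [AddCommGroup Q] [Module R Q]
    [AddCommGroup X1] [Module R X1] [AddCommGroup X2] [Module R X2] [AddCommGroup X3] [Module R X3]
    (hQ : Module.Injective R Q)
    {f : X1 →ₗ[R] X2} {g : X2 →ₗ[R] X3} (hf : Function.Injective f)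
    (hg : Function.Surjective g) (hfg : Function.Exact f g) :
    Function.Injective (LinearMap.lcomp R Q g) ∧ Function.Surjective (LinearMap.lcomp R Q f) ∧
      Function.Exact (LinearMap.lcomp R Q g) (LinearMap.lcomp R Q f) := by
  refine ⟨LinearMap.lcomp_injective_of_surjective g hg, fun φ => ?_, fun φ => ⟨fun h => ?_, ?_⟩⟩
  · obtain ⟨ψ, hψ⟩ := hQ.out f hf φ
    exact ⟨ψ, LinearMap.ext hψ⟩
  · obtain ⟨ψ, hψ⟩ := exists_factor hQ g φ (by
      intro x hx
      obtain ⟨y, rfl⟩ := (hfg x).mp hx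
      exact LinearMap.congr_fun h y)
    exact ⟨ψ, hψ⟩
  · rintro ⟨ψ, rfl⟩
    ext x
    simp [hfg.apply_apply_eq_zero]

lemma ker_ses {X1 X2 : Type u} [AddCommGroup X1] [Module R X1] [AddCommGroup X2] [Module R X2]
    (g : X1 →ₗ[R] X2) : Function.Exact (LinearMap.ker g).subtype g := by
  rw [LinearMap.exact_iff]; simp

lemma van_flat_hom {F E Q : Type u} [AddCommGroup F] [Module R F]
    [AddCommGroup E] [Module R E] [AddCommGroup Q] [Module R Q]
    (hF : Module.Flat R F) (hQ : Module.Injective R Q) (n : ℕ) : Van R F (E →ₗ[R] Q) (n + 1) := by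
  have main : ∀ (E : Type u) [AddCommGroup E] [Module R E],
      ∃ (G L : Type u) (_ : AddCommGroup G) (_ : AddCommGroup L) (_ : Module R G) (_ : Module R L)
      (f : L →ₗ[R] G) (g : G →ₗ[R] E), Module.Flat R G ∧ Function.Injective f ∧
        Function.Surjective g ∧ Function.Exact f g := by
    intro E _ _
    refine ⟨E →₀ R, LinearMap.ker (Finsupp.linearCombination R (id : E → E)), inferInstance,
      inferInstance, inferInstance, inferInstance, Submodule.subtype _, _, inferInstance,
      Subtype.val_injective, Finsupp.linearCombination_id_surjective R E, ker_ses _⟩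
  induction n generalizing E with
  | zero =>
    obtain ⟨G, L, _, _, _, _, f, g, hG, hf, hg, hfg⟩ := main E
    obtain ⟨h1, h2, h3⟩ := lcomp_ses hQ hf hg hfg
    refine van_one_of_ext h1 h2 h3 (van_of_inj (inj_hom hG hQ) 0) (fun φ => ?_)
    obtain ⟨ψ, hψ⟩ := hQ.out (f.lTensor F) (Module.Flat.lTensor_preserves_injective_linearMap f hf)
      (TensorProduct.lift φ)
    refine ⟨TensorProduct.curry ψ, ?_⟩
    ext x y
    simpa using hψ (TensorProduct.tmul R x y)
  | succ n ih =>
    obtain ⟨G, L, _, _, _, _, f, g, hG, hf, hg, hfg⟩ := main E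
    obtain ⟨h1, h2, h3⟩ := lcomp_ses hQ hf hg hfg
    exact van_v1 h1 h2 h3 (van_of_inj (inj_hom hG hQ) _) ih

lemma van_torsion (S : Submonoid R) [IsNoetherianRing R] {N W : Type u} [AddCommGroup N] [Module R N]
    [AddCommGroup W] [Module R W] (hN : ∀ x : N, ∃ s ∈ S, s • x = 0)
    (hW : ∀ s ∈ S, Function.Bijective (fun x : W => s • x)) (n : ℕ) : Van R N W n := by
  induction n generalizing W with
  | zero =>
    rw [van_zero_iff]
    intro f
    ext x
    obtain ⟨s, hs, h⟩ := hN x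
    apply (hW s hs).1
    simp [← map_smul, h]
  | succ n ih =>
    obtain ⟨J', _, _, f, hJ', hf⟩ := exists_embed (R := R) W
    let J := LocalizedModule S J'
    have hJ : Module.Injective R J := by
      have : Module.Injective R J' := hJ'
      have h1 : Module.Injective (Localization S) J :=
        Module.injective_of_isLocalizedModule S (LocalizedModule.mkLinearMap S J')
      exact inj_restrict (IsLocalization.flat (Localization S) S) h1
    let i : W →ₗ[R] J := LocalizedModule.mkLinearMap S J' ∘ₗ f
    have hi : Function.Injective i := by
      rw [injective_iff_map_eq_zero]
      intro w hw
      have hw : LocalizedModule.mkLinearMap S J' (f w) = 0 := hw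
      rw [IsLocalizedModule.eq_zero_iff S] at hw
      obtain ⟨s, hs⟩ := hw
      apply (hW s s.2).1
      apply hf
      simpa [Submonoid.smul_def] using hs
    have hJb : ∀ s ∈ S, Function.Bijective (fun x : J => s • x) := fun s hs => by
      have := IsLocalizedModule.map_units (S := S) (LocalizedModule.mkLinearMap S J') ⟨s, hs⟩
      rw [Module.End.isUnit_iff] at this
      exact this
    refine van_v1 hi (Submodule.mkQ_surjective (LinearMap.range i)) ?_ (van_of_inj hJ n) (ih ?_)
    · rw [LinearMap.exact_iff]; simp
    · intro s hs
      constructor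
      · intro a b hab
        rw [← sub_eq_zero] at hab ⊢
        simp only [← smul_sub] at hab
        obtain ⟨x, hx⟩ := Submodule.mkQ_surjective _ (a - b)
        rw [← hx] at hab ⊢
        rw [← map_smul, Submodule.mkQ_apply, Submodule.Quotient.mk_eq_zero] at hab
        rw [Submodule.mkQ_apply, Submodule.Quotient.mk_eq_zero]
        obtain ⟨w, hw⟩ := hab
        obtain ⟨w', rfl⟩ := (hW s hs).2 w
        refine ⟨w', (hJb s hs).1 ?_⟩
        simpa using hw
      · intro a
        obtain ⟨x, rfl⟩ := Submodule.mkQ_surjective _ a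
        obtain ⟨y, rfl⟩ := (hJb s hs).2 x
        exact ⟨Submodule.mkQ _ y, by simp⟩

lemma flat_of_localization (S : Submonoid R) [IsNoetherianRing R] {H H' W : Type u}
    [AddCommGroup H] [Module R H] [AddCommGroup H'] [Module R H']
    [AddCommGroup W] [Module R W] (f : H →ₗ[R] H') [IsLocalizedModule S f]
    (hW : ∀ s ∈ S, Function.Bijective (fun x : W => s • x)) {n : ℕ} (hF : FlatE R H' W n) :
    FlatE R H W n := by
  have h1 : FlatE R (LinearMap.range f) W n := by
    refine flat_c1_of_van3 (f := (LinearMap.range f).subtype) (g := (LinearMap.range f).mkQ)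
      Subtype.val_injective (Submodule.mkQ_surjective _) ?_ ?_ hF
    · rw [LinearMap.exact_iff]; simp
    · intro k
      apply van_torsion S ?_ hW
      intro x
      obtain ⟨y, rfl⟩ := Submodule.mkQ_surjective _ x
      obtain ⟨⟨a, s⟩, h⟩ := IsLocalizedModule.surj S f y
      refine ⟨s, s.2, ?_⟩
      rw [← map_smul, Submodule.mkQ_apply, Submodule.Quotient.mk_eq_zero]
      exact ⟨a, h.symm⟩
  refine flat_c2_of_van1 (f := (LinearMap.ker f).subtype) (g := f.rangeRestrict)
      Subtype.val_injective f.surjective_rangeRestrict ?_ ?_ h1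
  · rw [LinearMap.exact_iff]; simp
  · intro k
    apply van_torsion S ?_ hW
    intro x
    obtain ⟨s, hs⟩ := (IsLocalizedModule.eq_zero_iff S f).mp x.2
    exact ⟨s, s.2, Subtype.ext hs⟩

end
end DZ


namespace DZ
open CategoryTheory.Abelian
section
variable {R : Type u} [CommRing R]

/-- cocycles -/
def cocyc (K : ChainComplex (ModuleCat.{u} R) ℕ) (n : ℕ) (Q : Type u) [AddCommGroup Q] [Module R Q] :
    Submodule R (K.X n →ₗ[R] Q) := LinearMap.ker (LinearMap.lcomp R Q (K.d (n + 1) n).hom)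

lemma mem_cocyc {K : ChainComplex (ModuleCat.{u} R) ℕ} {n : ℕ} {Q : Type u} [AddCommGroup Q]
    [Module R Q] {φ : K.X n →ₗ[R] Q} : φ ∈ cocyc K n Q ↔ φ ∘ₗ (K.d (n + 1) n).hom = 0 := Iff.rfl

lemma cocyc_d {K : ChainComplex (ModuleCat.{u} R) ℕ} {n : ℕ} {Q : Type u} [AddCommGroup Q]
    [Module R Q] (φ : cocyc K n Q) : K.d (n + 1) n ≫ ModuleCat.ofHom φ.1 = 0 := by
  ext x
  exact LinearMap.congr_fun (mem_cocyc.mp φ.2) x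

/-- map to the dual of homology -/
noncomputable def homDual (K : ChainComplex (ModuleCat.{u} R) ℕ) (n : ℕ) (Q : Type u)
    [AddCommGroup Q] [Module R Q] : cocyc K n Q →ₗ[R] (K.homology n →ₗ[R] Q) where
  toFun φ := (K.homologyι n ≫ K.descOpcycles (ModuleCat.ofHom φ.1) (n + 1) (by simp) (cocyc_d φ)).hom
  map_add' φ ψ := by
    have : K.descOpcycles (ModuleCat.ofHom (φ + ψ).1) (n + 1) (by simp) (cocyc_d (φ + ψ)) =
      K.descOpcycles (ModuleCat.ofHom φ.1) (n + 1) (by simp) (cocyc_d φ) +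
      K.descOpcycles (ModuleCat.ofHom ψ.1) (n + 1) (by simp) (cocyc_d ψ) := by
      rw [← cancel_epi (K.pOpcycles n)]
      simp [Preadditive.comp_add]
    rw [this, Preadditive.comp_add]; rfl
  map_smul' r φ := by
    have : K.descOpcycles (ModuleCat.ofHom (r • φ).1) (n + 1) (by simp) (cocyc_d (r • φ)) =
      r • K.descOpcycles (ModuleCat.ofHom φ.1) (n + 1) (by simp) (cocyc_d φ) := by
      rw [← cancel_epi (K.pOpcycles n)]
      simp [Linear.comp_smul]
      rfl
    rw [this, Linear.comp_smul]; rfl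

lemma homDual_surj (K : ChainComplex (ModuleCat.{u} R) ℕ) (n : ℕ) {Q : Type u}
    [AddCommGroup Q] [Module R Q] (hQ : Module.Injective R Q) :
    Function.Surjective (homDual K n Q) := by
  intro χ
  obtain ⟨ψ, hψ⟩ := hQ.out (K.homologyι n).hom
    ((ModuleCat.mono_iff_injective _).mp inferInstance) χ
  refine ⟨⟨ψ ∘ₗ (K.pOpcycles n).hom, ?_⟩, ?_⟩
  · rw [mem_cocyc, LinearMap.comp_assoc, ← ModuleCat.hom_comp, K.d_pOpcycles]
    simp
  · have h1 : K.descOpcycles (ModuleCat.ofHom (ψ ∘ₗ (K.pOpcycles n).hom)) (n + 1) (by simp)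
        (by rw [ModuleCat.ofHom_comp, ModuleCat.ofHom_hom, K.d_pOpcycles_assoc, Limits.zero_comp])
        = ModuleCat.ofHom ψ := by
      rw [← cancel_epi (K.pOpcycles n)]
      rw [K.p_descOpcycles]; rfl
    change (K.homologyι n ≫ K.descOpcycles (ModuleCat.ofHom (ψ ∘ₗ (K.pOpcycles n).hom)) _ _ _).hom = χ
    rw [h1]
    ext x; exact hψ x

lemma homDual_ker (K : ChainComplex (ModuleCat.{u} R) ℕ) (m : ℕ) {Q : Type u}
    [AddCommGroup Q] [Module R Q] (hQ : Module.Injective R Q) (φ : cocyc K (m + 1) Q) :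
    homDual K (m + 1) Q φ = 0 ↔ ∃ ψ : K.X m →ₗ[R] Q, ψ ∘ₗ (K.d (m + 1) m).hom = φ.1 := by
  constructor
  · intro h
    let g : K.opcycles (m + 1) ⟶ ModuleCat.of R Q :=
      K.descOpcycles (ModuleCat.ofHom φ.1) (m + 1 + 1) (by simp) (cocyc_d φ)
    have hex := ShortComplex.exact_of_f_is_kernel
      (ShortComplex.mk _ _ (K.homologyι_comp_fromOpcycles (m + 1) m))
      (K.homologyIsKernel (m + 1) m (by simp))
    rw [ShortComplex.moduleCat_exact_iff] at hex
    obtain ⟨ψ, hψ⟩ := exists_factor hQ (K.fromOpcycles (m + 1) m).hom g.hom (by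
      intro x hx
      obtain ⟨y, hy⟩ := hex x hx
      rw [LinearMap.mem_ker, ← hy]
      exact LinearMap.congr_fun h y)
    refine ⟨ψ, ?_⟩
    rw [← K.p_fromOpcycles (m + 1) m, ModuleCat.hom_comp, ← LinearMap.comp_assoc, hψ,
      ← ModuleCat.hom_comp, K.p_descOpcycles]
    rfl
  · rintro ⟨ψ, hψ⟩
    have h1 : K.descOpcycles (ModuleCat.ofHom φ.1) (m + 1 + 1) (by simp) (cocyc_d φ)
        = K.fromOpcycles (m + 1) m ≫ ModuleCat.ofHom ψ := by
      rw [← cancel_epi (K.pOpcycles (m + 1))]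
      rw [K.p_descOpcycles, K.p_fromOpcycles_assoc, ← hψ]; rfl
    change (K.homologyι (m + 1) ≫ K.descOpcycles (ModuleCat.ofHom φ.1) _ _ _).hom = 0
    rw [h1, K.homologyι_comp_fromOpcycles_assoc]; simp

section
variable {X : ModuleCat.{u} R} (P : ProjectiveResolution X) (n : ℕ) (W : Type u)
    [AddCommGroup W] [Module R W]

/-- map to Ext -/
noncomputable def extMap : cocyc P.complex n W →ₗ[R] Ext.{u} X (ModuleCat.of R W) n where
  toFun φ := P.extMk (ModuleCat.ofHom φ.1) (n + 1) rfl (cocyc_d φ)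
  map_add' φ ψ := by rw [P.add_extMk]; rfl
  map_smul' r φ := by
    rw [RingHom.id_apply, Ext.smul_eq_comp_mk₀, P.extMk_comp_mk₀]
    congr 1

lemma extMap_surj : Function.Surjective (extMap P n W) := by
  intro x
  obtain ⟨f, hf, rfl⟩ := P.extMk_surjective x (n + 1) rfl
  refine ⟨⟨f.hom, ?_⟩, rfl⟩
  rw [mem_cocyc, ← ModuleCat.hom_comp, hf]; rfl

lemma extMap_ker (m : ℕ) (φ : cocyc P.complex (m + 1) W) : extMap P (m + 1) W φ = 0 ↔
    ∃ ψ : P.complex.X m →ₗ[R] W, ψ ∘ₗ (P.complex.d (m + 1) m).hom = φ.1 := by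
  change P.extMk (ModuleCat.ofHom φ.1) (m + 1 + 1) rfl (cocyc_d φ) = 0 ↔ _
  rw [P.extMk_eq_zero_iff _ _ _ _ m rfl]
  constructor
  · rintro ⟨g, hg⟩
    exact ⟨g.hom, by rw [← ModuleCat.hom_comp, hg]; rfl⟩
  · rintro ⟨ψ, hψ⟩
    exact ⟨ModuleCat.ofHom ψ, by rw [← hψ]; rfl⟩
end

lemma flat_of_surj {Z M N : Type u} [AddCommGroup Z] [Module R Z] [AddCommGroup M] [Module R M]
    [AddCommGroup N] [Module R N] (α : Z →ₗ[R] M) (β : Z →ₗ[R] N) (hα : Function.Surjective α)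
    (hβ : Function.Surjective β) (h : ∀ z, α z = 0 ↔ β z = 0) (hM : Module.Flat R M) :
    Module.Flat R N := by
  have hk : LinearMap.ker α = LinearMap.ker β := by ext z; exact h z
  exact Module.Flat.of_linearEquiv ((β.quotKerEquivOfSurjective hβ).symm.trans
    ((Submodule.quotEquivOfEq _ _ hk.symm).trans (α.quotKerEquivOfSurjective hα)))

lemma flat_of_surj' {Z Z' M N : Type u} [AddCommGroup Z] [Module R Z] [AddCommGroup M] [Module R M]
    [AddCommGroup N] [Module R N] [AddCommGroup Z'] [Module R Z']
    (α : Z →ₗ[R] M) (e : Z ≃ₗ[R] Z') (β : Z' →ₗ[R] N) (hα : Function.Surjective α)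
    (hβ : Function.Surjective β) (h : ∀ z, α z = 0 ↔ β (e z) = 0) (hM : Module.Flat R M) :
    Module.Flat R N :=
  flat_of_surj α (β ∘ₗ e.toLinearMap) hα (hβ.comp e.surjective) h hM

open MonoidalCategory in
lemma tor_inj [IsNoetherianRing R] {E H Q : Type u} [AddCommGroup E] [Module R E]
    [AddCommGroup H] [Module R H] [AddCommGroup Q] [Module R Q] (hQ : Module.Injective R Q)
    (hcog : ∀ (M : Type u) [AddCommGroup M] [Module R M] (m : M), m ≠ 0 → ∃ f : M →ₗ[R] Q, f m ≠ 0)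
    (n : ℕ) (hF : FlatE R H (E →ₗ[R] Q) n) :
    Module.Injective R (((Tor (ModuleCat.{u} R) n).obj (ModuleCat.of R E)).obj (ModuleCat.of R H)) := by
  let F := (tensoringLeft (ModuleCat.{u} R)).obj (ModuleCat.of R E)
  change Module.Injective R ((F.leftDerived n).obj (ModuleCat.of R H))
  obtain _ | m := n
  · rw [flat_zero_iff] at hF
    have : Limits.PreservesFiniteColimits F :=
      inferInstanceAs (Limits.PreservesFiniteColimits (tensorLeft (ModuleCat.of R E)))
    have e : (F.leftDerived 0).obj (ModuleCat.of R H) ≃ₗ[R] TensorProduct R E H :=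
      (F.leftDerivedZeroIsoSelf.app (ModuleCat.of R H)).toLinearEquiv
    refine inj_of_equiv (inj_of_flat_dual hcog ?_) e.symm
    exact Module.Flat.of_linearEquiv ((TensorProduct.lift.equiv (.id R) E H Q).symm.trans
      (LinearMap.lflip (R₀ := R)))
  · let P := ProjectiveResolution.of (ModuleCat.of R H)
    let K := (F.mapHomologicalComplex (ComplexShape.down ℕ)).obj P.complex
    have e : (F.leftDerived (m + 1)).obj (ModuleCat.of R H) ≃ₗ[R] K.homology (m + 1) :=
      (P.isoLeftDerivedObj F (m + 1)).toLinearEquiv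
    refine inj_of_equiv (inj_of_flat_dual hcog ?_) e.symm
    let t : ∀ k, (P.complex.X k →ₗ[R] E →ₗ[R] Q) ≃ₗ[R] (K.X k →ₗ[R] Q) := fun k =>
      (LinearMap.lflip (R₀ := R)).trans (TensorProduct.lift.equiv (.id R) E (P.complex.X k) Q)
    have ht : ∀ k (φ : P.complex.X k →ₗ[R] E →ₗ[R] Q),
        t (k + 1) (φ ∘ₗ (P.complex.d (k + 1) k).hom) = t k φ ∘ₗ (K.d (k + 1) k).hom := by
      intro k φ
      apply TensorProduct.ext'
      intro x y
      rfl
    let tz : cocyc P.complex (m + 1) (E →ₗ[R] Q) ≃ₗ[R] cocyc K (m + 1) Q :=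
      (t (m + 1)).submoduleMap _ |>.trans (LinearEquiv.ofEq _ _ (by
        ext φ
        rw [Submodule.mem_map_equiv, mem_cocyc, mem_cocyc]
        obtain ⟨ψ, rfl⟩ := (t (m + 1)).surjective φ
        rw [LinearEquiv.symm_apply_apply, ← ht, LinearEquiv.map_eq_zero_iff]))
    have htz : ∀ φ, (tz φ).1 = t (m + 1) φ.1 := fun φ => rfl
    have hF' : Module.Flat R (Ext.{u} (ModuleCat.of R H) (ModuleCat.of R (E →ₗ[R] Q)) (m + 1)) := hF
    clear_value tz
    have key := flat_of_surj' (R := R) (Z := cocyc P.complex (m + 1) (E →ₗ[R] Q)) (Z' := cocyc K (m + 1) Q)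
      (M := Ext.{u} (ModuleCat.of R H) (ModuleCat.of R (E →ₗ[R] Q)) (m + 1))
      (N := K.homology (m + 1) →ₗ[R] Q)
      (extMap P (m + 1) (E →ₗ[R] Q)) tz (homDual K (m + 1) Q)
      (extMap_surj P (m + 1) (E →ₗ[R] Q)) (homDual_surj K (m + 1) hQ)
    refine key (fun z => ?_) hF'
    have h1 := extMap_ker P (E →ₗ[R] Q) m z
    have h2 := homDual_ker K m hQ (tz z)
    refine h1.trans (Iff.trans ?_ h2.symm)
    rw [htz]
    constructor
    · rintro ⟨ψ, hψ⟩
      exact ⟨t m ψ, by rw [← ht, hψ]⟩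
    · rintro ⟨ψ, hψ⟩
      refine ⟨(t m).symm ψ, (t (m + 1)).injective ?_⟩
      rw [ht, LinearEquiv.apply_symm_apply, hψ]

end
end DZ


namespace DZ
open CategoryTheory.Abelian
section
variable {R : Type u} [CommRing R]
variable {X X1 X2 X3 Y Y1 Y2 Y3 : Type u} [AddCommGroup X] [Module R X] [AddCommGroup Y] [Module R Y]
  [AddCommGroup X1] [Module R X1] [AddCommGroup X2] [Module R X2] [AddCommGroup X3] [Module R X3]
  [AddCommGroup Y1] [Module R Y1] [AddCommGroup Y2] [Module R Y2] [AddCommGroup Y3] [Module R Y3]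

lemma ext_of_van_one {f : X1 →ₗ[R] X2} {g : X2 →ₗ[R] X3} (hf : Function.Injective f)
    (hg : Function.Surjective g) (hfg : Function.Exact f g) (h3 : Van R X3 Y 1)
    (φ : X1 →ₗ[R] Y) : ∃ ψ : X2 →ₗ[R] Y, ψ ∘ₗ f = φ := by
  have h3 : Subsingleton (EX R X3 Y (0 + 1)) := h3
  obtain ⟨y, hy⟩ := Ext.contravariant_sequence_exact₁ (ses hf hg hfg) _
    (Ext.mk₀ (ModuleCat.ofHom φ)) (n₁ := 0 + 1) (by omega)
      (Subsingleton.elim (α := EX R X3 Y (0 + 1)) _ _)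
  obtain ⟨ψ, rfl⟩ := Ext.homEquiv₀.symm.surjective y
  refine ⟨ψ.hom, ?_⟩
  have := Ext.homEquiv₀.symm.injective ((Ext.mk₀_comp_mk₀ _ _).symm.trans hy)
  exact congrArg ModuleCat.Hom.hom this

lemma van_of_cyclic (n : ℕ) : ∀ {Y : Type u} [AddCommGroup Y] [Module R Y],
    (∀ a : Ideal R, Van R (R ⧸ a) Y (n + 1)) →
    ∀ (X : Type u) [AddCommGroup X] [Module R X], Van R X Y (n + 1) := by
  induction n with
  | zero =>
    intro Y _ _ h X _ _
    apply van_of_inj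
    rw [← Module.Baer.iff_injective]
    intro a g
    obtain ⟨ψ, hψ⟩ := ext_of_van_one (f := a.subtype) (g := a.mkQ) a.subtype_injective
      a.mkQ_surjective (LinearMap.exact_subtype_mkQ a) (h a) g
    exact ⟨ψ, fun x hx => congrArg (fun f => f ⟨x, hx⟩) hψ⟩
  | succ n ih =>
    intro Y _ _ h X _ _
    obtain ⟨J, _, _, f, hJ, hf⟩ := exists_embed (R := R) Y
    have hs : Function.Surjective (LinearMap.range f).mkQ := Submodule.mkQ_surjective _
    have he : Function.Exact f (LinearMap.range f).mkQ := by
      rw [LinearMap.exact_iff]; simp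
    refine van_v1 hf hs he (van_of_inj hJ _) (ih (fun a => ?_) X)
    exact van_v3 hf hs he (h a) (van_of_inj hJ _)
end
end DZ


namespace DZ
open CategoryTheory.Abelian RingTheory.Sequence IsLocalRing
section
variable {A : Type u} [CommRing A] [IsNoetherianRing A] [IsLocalRing A]

lemma mem_max_of_isRegular {rs : List A} (reg : IsRegular A rs) : ∀ x ∈ rs, x ∈ maximalIdeal A := by
  intro x hx
  apply IsLocalRing.le_maximalIdeal reg.2.symm
  simpa using (Ideal.mem_span x).mpr fun p a ↦ a hx

lemma exists_max_regular : ∃ rs : List A, IsRegular A rs ∧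
    ((rs.length : ℕ) : WithBot ℕ∞) ≤ ringKrullDim A ∧
    ∀ x ∈ maximalIdeal A, ¬ IsSMulRegular (A ⧸ Ideal.ofList rs • (⊤ : Submodule A A)) x := by
  classical
  have hle : ∀ rs : List A, IsRegular A rs → ((rs.length : ℕ) : WithBot ℕ∞) ≤ ringKrullDim A := by
    intro rs reg
    rw [← ringKrullDim_add_length_eq_ringKrullDim_of_isRegular rs reg]
    have : Nontrivial (A ⧸ Ideal.ofList rs) := by
      rw [Ideal.Quotient.nontrivial_iff]
      intro h
      have := reg.2
      rw [h] at this
      simp at this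
    exact le_add_of_nonneg_left ringKrullDim_nonneg_of_nontrivial
  obtain ⟨d, hd⟩ : ∃ d : ℕ, ringKrullDim A = d := by
    have h1 : ringKrullDim A ≠ ⊤ := ringKrullDim_ne_top
    have h2 : ringKrullDim A ≠ ⊥ := ringKrullDim_ne_bot
    obtain ⟨e, he⟩ := WithBot.ne_bot_iff_exists.mp h2
    have : e ≠ ⊤ := by rintro rfl; exact h1 he.symm
    obtain ⟨d, rfl⟩ := ENat.ne_top_iff_exists.mp this
    exact ⟨d, he.symm⟩
  let P : ℕ → Prop := fun n => ∃ rs : List A, IsRegular A rs ∧ rs.length = n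
  have h0 : P 0 := ⟨[], IsRegular.nil A A, rfl⟩
  obtain ⟨rs, reg, hl⟩ : P (Nat.findGreatest P d) := Nat.findGreatest_spec (Nat.zero_le d) h0
  refine ⟨rs, reg, hle rs reg, fun x hx hreg => ?_⟩
  have hr : IsRegular A (rs ++ [x]) := by
    apply IsRegular.of_isWeaklyRegular_of_mem_maximalIdeal
    · intro r hr
      rw [List.mem_append] at hr
      rcases hr with hr | hr
      · exact mem_max_of_isRegular reg r hr
      · simp at hr; rwa [hr]
    · rw [isWeaklyRegular_append_iff, isWeaklyRegular_singleton_iff]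
      exact ⟨reg.1, hreg⟩
  have h1 := hle _ hr
  rw [hd] at h1
  have h1 : (rs ++ [x]).length ≤ d := by exact_mod_cast h1
  have h2 := Nat.le_findGreatest (P := P) h1 ⟨_, hr, rfl⟩
  rw [← hl] at h2
  simp at h2

lemma exists_k_embed {rs : List A}
    (h : ∀ x ∈ maximalIdeal A, ¬ IsSMulRegular (A ⧸ Ideal.ofList rs • (⊤ : Submodule A A)) x) :
    ∃ f : ResidueField A →ₗ[A] (A ⧸ Ideal.ofList rs), Function.Injective f := by
  have e : Ideal.ofList rs • (⊤ : Submodule A A) = Ideal.ofList rs := by simp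
  rw [e] at h
  have : ¬ Subsingleton (ResidueField A →ₗ[A] (A ⧸ Ideal.ofList rs)) := by
    rw [IsSMulRegular.subsingleton_linearMap_iff]
    rintro ⟨r, hr, hreg⟩
    refine h r ?_ hreg
    have := (Module.mem_annihilator.mp hr) 1
    rw [Algebra.smul_def, mul_one] at this
    exact (residue_eq_zero_iff r).mp this
  rw [not_subsingleton_iff_nontrivial] at this
  obtain ⟨f, hf⟩ := exists_ne (0 : ResidueField A →ₗ[A] (A ⧸ Ideal.ofList rs))
  refine ⟨f, ?_⟩
  rw [injective_iff_map_eq_zero]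
  intro x hx
  by_contra hne
  apply hf
  ext z
  obtain ⟨y, hy⟩ := residue_surjective (R := A) (z * x⁻¹)
  have h1 : z = y • x := by
    rw [Algebra.smul_def]; change z = residue A y * x; rw [hy, inv_mul_cancel_right₀ hne]
  simp [h1, hx]

lemma van_quot_of_regular {rs : List A} (reg : IsRegular A rs) {Y : Type u} [AddCommGroup Y]
    [Module A Y] {i : ℕ} (hi : rs.length < i) : Van A (A ⧸ Ideal.ofList rs) Y i := by
  have h := ModuleCat.projectiveDimension_quotient_eq_length.{u} rs reg
  have h2 := (projectiveDimension_le_iff _ _).mp h.le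
  have h3 : Van A (Shrink.{u} (A ⧸ Ideal.ofList rs)) Y i :=
    HasProjectiveDimensionLT.subsingleton _ (rs.length + 1) (hX := h2) i hi _
  exact h3.congr_left (Shrink.linearEquiv A _)

lemma van_domain_of_surj {P : Ideal A} (hP : P.IsPrime) {x : A} (hx : x ∈ maximalIdeal A) (hxP : x ∉ P)
    {Y : Type u} [AddCommGroup Y] [Module A Y] [Module.Finite A Y] {n : ℕ}
    (h : ∀ (M : Type u) [AddCommGroup M] [Module A M], Van A M Y (n + 1)) : Van A (A ⧸ P) Y n := by
  let f : (A ⧸ P) →ₗ[A] (A ⧸ P) := x • LinearMap.id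
  have hf : Function.Injective f := by
    rw [injective_iff_map_eq_zero]
    intro a ha
    obtain ⟨a, rfl⟩ := Ideal.Quotient.mk_surjective a
    have ha : x • (Ideal.Quotient.mk P a) = 0 := ha
    rw [Algebra.smul_def, Ideal.Quotient.algebraMap_eq, ← map_mul, Ideal.Quotient.eq_zero_iff_mem] at ha
    rw [Ideal.Quotient.eq_zero_iff_mem]
    exact (hP.mem_or_mem ha).resolve_left hxP
  have he : Function.Exact f (LinearMap.range f).mkQ := by rw [LinearMap.exact_iff]; simp
  have h3 : Subsingleton (EX A ((A ⧸ P) ⧸ LinearMap.range f) Y (n + 1)) := h _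
  have hfin : Module.Finite A (EX A (A ⧸ P) Y n) := ModuleCat.finite_ext A _ _ n
  have hsurj : ∀ z : EX A (A ⧸ P) Y n, ∃ y : EX A (A ⧸ P) Y n, x • y = z := by
    intro z
    obtain ⟨y, hy⟩ := Ext.contravariant_sequence_exact₁ (ses hf (Submodule.mkQ_surjective _) he) _ z
      (n₁ := n + 1) (by omega)
      (Subsingleton.elim (α := EX A ((A ⧸ P) ⧸ LinearMap.range f) Y (n + 1)) _ _)
    refine ⟨y, ?_⟩
    rw [← hy]
    have : ModuleCat.ofHom f = x • 𝟙 (ModuleCat.of A (A ⧸ P)) := rfl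
    dsimp
    rw [this, Ext.mk₀_smul, Ext.smul_comp, Ext.mk₀_id_comp]
  have hb : (⊤ : Submodule A (EX A (A ⧸ P) Y n)) = ⊥ := by
    apply Submodule.eq_bot_of_le_smul_of_le_jacobson_bot (maximalIdeal A) _ hfin.1
    · intro z _
      obtain ⟨y, rfl⟩ := hsurj z
      exact Submodule.smul_mem_smul hx trivial
    · exact (IsLocalRing.jacobson_eq_maximalIdeal ⊥ bot_ne_top).ge
  exact (Submodule.subsingleton_iff A).mp (subsingleton_of_bot_eq_top hb.symm)

lemma injdim_le {Y : Type u} [AddCommGroup Y] [Module A Y] [Module.Finite A Y] {rs : List A}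
    (reg : IsRegular A rs)
    (hk : ∃ f : ResidueField A →ₗ[A] (A ⧸ Ideal.ofList rs), Function.Injective f) (n : ℕ)
    (h : ∀ i, n < i → ∀ (M : Type u) [AddCommGroup M] [Module A M], Van A M Y i) :
    ∀ i, rs.length < i → ∀ (M : Type u) [AddCommGroup M] [Module A M], Van A M Y i := by
  suffices H : ∀ d, d ≤ n - rs.length → ∀ i, n - d < i → ∀ (M : Type u) [AddCommGroup M] [Module A M], Van A M Y i by
    intro i hi
    by_cases hn : n ≤ rs.length
    · exact h i (by omega)
    · exact H (n - rs.length) le_rfl i (by omega)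
  intro d
  induction d with
  | zero => intro _ i hi; exact h i hi
  | succ d ih =>
    intro hd i hi
    by_cases hi2 : n - d < i
    · exact ih (by omega) i hi2
    have hir : rs.length < i := by omega
    have h' := ih (by omega) (i + 1) (by omega)
    clear hi hi2 ih hd
    obtain ⟨r, rfl⟩ : ∃ r, i = r + 1 := ⟨i - 1, by omega⟩
    obtain ⟨f, hf⟩ := hk
    have hkv : Van A (ResidueField A) Y (r + 1) := by
      have he : Function.Exact f (LinearMap.range f).mkQ := by rw [LinearMap.exact_iff]; simp
      exact van_c1 hf (Submodule.mkQ_surjective _) he (van_quot_of_regular reg hir) (h' _)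
    have hprime : ∀ P : Ideal A, P.IsPrime → Van A (A ⧸ P) Y (r + 1) := by
      intro P hP
      by_cases hPm : P = maximalIdeal A
      · subst hPm; exact hkv
      · obtain ⟨x, hx, hxP⟩ := SetLike.exists_of_lt
          (lt_of_le_of_ne (IsLocalRing.le_maximalIdeal hP.ne_top) hPm)
        exact van_domain_of_surj hP hx hxP h'
    apply van_of_cyclic
    intro a
    refine IsNoetherianRing.induction_on_isQuotientEquivQuotientPrime A (M := A ⧸ a)
      (motive := fun N _ _ _ => Van A N Y (r + 1)) inferInstance ?_ ?_ ?_
    · intro N _ _ _ _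
      exact van_of_proj r
    · intro N _ _ _ p e
      exact (hprime p.asIdeal p.2).congr_left e.symm
    · intro N1 _ _ _ N2 _ _ _ N3 _ _ _ f g hf hg hfg h1 h3
      exact van_c2 hf hg hfg h1 h3
end
end DZ


namespace DZ
open CategoryTheory.Abelian RingTheory.Sequence IsLocalRing
open scoped Pointwise
section
variable {A : Type u} [CommRing A] [IsNoetherianRing A]

lemma smul_ses {M : Type u} [AddCommGroup M] [Module A M] {x : A} (hx : IsSMulRegular M x) :
    Function.Injective (x • LinearMap.id : M →ₗ[A] M) ∧
    Function.Surjective (x • (⊤ : Submodule A M)).mkQ ∧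
    Function.Exact (x • LinearMap.id : M →ₗ[A] M) (x • (⊤ : Submodule A M)).mkQ := by
  refine ⟨hx, Submodule.mkQ_surjective _, ?_⟩
  rw [LinearMap.exact_iff]
  ext y
  simp [Submodule.mem_smul_pointwise_iff_exists]

lemma weaklyRegular_of_hom {D : Type u} [AddCommGroup D] [Module A D] [Module.Finite A D]
    (hfaith : ∀ r : A, (∀ d : D, r • d = 0) → r = 0) (rs : List A) :
    ∀ {M : Type u} [AddCommGroup M] [Module A M] [Module.Finite A M],
    (∀ i, Van A D M (i + 1)) → IsWeaklyRegular (D →ₗ[A] M) rs → IsWeaklyRegular M rs := by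
  induction rs with
  | nil => intro M _ _ _ _ _; exact IsWeaklyRegular.nil A M
  | cons x rs ih =>
    intro M _ _ _ hV hreg
    rw [isWeaklyRegular_cons_iff] at hreg ⊢
    obtain ⟨h1, h2⟩ := hreg
    have hx : IsSMulRegular M x := by
      let K : Submodule A M := LinearMap.ker (x • LinearMap.id : M →ₗ[A] M)
      have hK : ∀ m ∈ K, x • m = 0 := fun m hm => hm
      have : Subsingleton (D →ₗ[A] K) := by
        refine ⟨fun f g => ?_⟩
        have hz : ∀ f : D →ₗ[A] K, f = 0 := fun f => by
          have h3 : x • (K.subtype ∘ₗ f) = x • 0 := by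
            ext d
            simpa using hK _ (f d).2
          have := h1 h3
          ext d
          exact congrArg (fun φ => φ d) this
        rw [hz f, hz g]
      rw [IsSMulRegular.subsingleton_linearMap_iff] at this
      obtain ⟨r, hr, hrr⟩ := this
      have : r = 0 := hfaith r (Module.mem_annihilator.mp hr)
      subst this
      have hsub : Subsingleton K := by
        refine ⟨fun a b => hrr ?_⟩
        simp
      intro a b hab
      have hab : x • a = x • b := hab
      have hm : a - b ∈ K := by
        change x • (a - b) = 0
        rw [smul_sub, hab, sub_self]
      have := congrArg Subtype.val (Subsingleton.elim (⟨a - b, hm⟩ : K) 0)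
      exact sub_eq_zero.mp this
    refine ⟨hx, ?_⟩
    obtain ⟨e1, e2, e3⟩ := smul_ses hx
    apply ih (M := QuotSMulTop x M)
    · intro i
      exact van_v3 e1 e2 e3 (hV (i + 1)) (hV i)
    · let L : (D →ₗ[A] M) →ₗ[A] (D →ₗ[A] QuotSMulTop x M) :=
        LinearMap.llcomp A D M (QuotSMulTop x M) (x • (⊤ : Submodule A M)).mkQ
      have hL : Function.Surjective L := fun φ => by
        obtain ⟨ψ, hψ⟩ := lift_of_van_one e1 e2 e3 (hV 0) φ
        exact ⟨ψ, hψ⟩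
      have hker : x • (⊤ : Submodule A (D →ₗ[A] M)) = LinearMap.ker L := by
        ext φ
        rw [Submodule.mem_smul_pointwise_iff_exists, LinearMap.mem_ker]
        constructor
        · rintro ⟨ψ, -, rfl⟩
          ext d
          exact (e3 _).mpr ⟨ψ d, rfl⟩
        · intro h
          have h : ∀ d, ∃ m : M, x • m = φ d := fun d => by
            have := congrArg (fun f => f d) h
            exact (e3 _).mp this
          choose ψ hψ using h
          refine ⟨⟨⟨ψ, fun a b => hx ?_⟩, fun r a => hx ?_⟩, trivial, ?_⟩
          · simp [smul_add, hψ]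
          · simp [smul_comm x r, hψ]
          · ext d
            simp [hψ]
      let e : QuotSMulTop x (D →ₗ[A] M) ≃ₗ[A] (D →ₗ[A] QuotSMulTop x M) :=
        (Submodule.quotEquivOfEq _ _ hker).trans (L.quotKerEquivOfSurjective hL)
      exact (LinearEquiv.isWeaklyRegular_congr e rs).mp h2

variable [IsLocalRing A]

lemma local_dualizing {D : Type u} [AddCommGroup D] [Module A D] [Module.Finite A D]
    (hb : Function.Bijective (fun r : A => r • (LinearMap.id : D →ₗ[A] D)))
    (hV : ∀ i, Van A D D (i + 1)) (n : ℕ)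
    (hn : ∀ i, n < i → ∀ (M : Type u) [AddCommGroup M] [Module A M], Van A M D i) :
    ∃ t : ℕ, ((t : ℕ) : WithBot ℕ∞) ≤ ringKrullDim A ∧
      (∀ i, t < i → ∀ (M : Type u) [AddCommGroup M] [Module A M], Van A M D i) ∧
      ∀ i, i < t → Van A (ResidueField A) D i := by
  obtain ⟨rs, reg, hd, hmax⟩ := exists_max_regular (A := A)
  refine ⟨rs.length, hd, injdim_le reg (exists_k_embed hmax) n hn, ?_⟩
  have hfaith : ∀ r : A, (∀ d : D, r • d = 0) → r = 0 := fun r hr => by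
    apply hb.1
    ext d
    simp [hr]
  have hnt : Nontrivial D := by
    by_contra h
    rw [not_nontrivial_iff_subsingleton] at h
    exact one_ne_zero (hfaith 1 (fun d => Subsingleton.elim _ _))
  let e : A ≃ₗ[A] (D →ₗ[A] D) :=
    LinearEquiv.ofBijective (LinearMap.toSpanSingleton A _ LinearMap.id) hb
  have hw : IsWeaklyRegular D rs :=
    weaklyRegular_of_hom hfaith rs hV ((LinearEquiv.isWeaklyRegular_congr e rs).mp reg.1)
  have hm := mem_max_of_isRegular reg
  have hr : IsRegular D rs := IsRegular.of_isWeaklyRegular_of_mem_maximalIdeal D hm hw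
  refine ModuleCat.subsingleton_ext_of_exists_isRegular (maximalIdeal A)
    (ModuleCat.of A (ResidueField A)) ?_ (ModuleCat.of A D) ?_ rs hm hr
  · intro q hq
    have := Module.annihilator_le_of_mem_support hq
    refine le_trans ?_ this
    intro x hx
    rw [Module.mem_annihilator]
    intro z
    rw [Algebra.smul_def]
    change residue A x * z = 0
    rw [(residue_eq_zero_iff x).mpr hx, zero_mul]
  · rw [lt_top_iff_ne_top]
    intro h
    have := Submodule.eq_bot_of_le_smul_of_le_jacobson_bot (maximalIdeal A) (⊤ : Submodule A D)
      Module.Finite.fg_top h.ge (IsLocalRing.jacobson_eq_maximalIdeal ⊥ bot_ne_top).ge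
    exact top_ne_bot this
end
end DZ


namespace DZ
open CategoryTheory.Abelian IsLocalRing
section

lemma inj_of_van_one {R : Type u} [CommRing R] {Y : Type u} [AddCommGroup Y] [Module R Y]
    (h : ∀ a : Ideal R, Van R (R ⧸ a) Y 1) : Module.Injective R Y := by
  rw [← Module.Baer.iff_injective]
  intro a g
  obtain ⟨ψ, hψ⟩ := ext_of_van_one (f := a.subtype) (g := a.mkQ) a.subtype_injective
    a.mkQ_surjective (LinearMap.exact_subtype_mkQ a) (h a) g
  exact ⟨ψ, fun x hx => congrArg (fun f => f ⟨x, hx⟩) hψ⟩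

variable {A : Type u} [CommRing A] [IsNoetherianRing A] [IsLocalRing A]

lemma exists_killed {ι : Type} (y : ι → A) {C : Type u} [AddCommGroup C] [Module A C]
    (c : C) (hc : c ≠ 0) (hn : ∀ i, ∃ n : ℕ, y i ^ n • c = 0) (s : Finset ι) :
    ∃ c' : C, c' ≠ 0 ∧ (∀ i, ∃ n : ℕ, y i ^ n • c' = 0) ∧ ∀ i ∈ s, y i • c' = 0 := by
  classical
  induction s using Finset.induction_on with
  | empty => exact ⟨c, hc, hn, by simp⟩
  | insert j s hj ih =>
    obtain ⟨c', h1, h2, h3⟩ := ih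
    have hf := Nat.find_spec (h2 j)
    have hpos : Nat.find (h2 j) ≠ 0 := by
      intro h0
      rw [h0] at hf
      simp at hf; exact h1 hf
    obtain ⟨m, hm⟩ := Nat.exists_eq_succ_of_ne_zero hpos
    have hlt := Nat.find_min (h2 j) (m := m) (by omega)
    rw [hm] at hf
    refine ⟨y j ^ m • c', hlt, fun i => ?_, fun i hi => ?_⟩
    · obtain ⟨n, hn⟩ := h2 i
      exact ⟨n, by rw [smul_comm, hn, smul_zero]⟩
    · rw [Finset.mem_insert] at hi
      rcases hi with rfl | hi
      · rw [smul_smul, ← pow_succ']; exact hf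
      · rw [smul_comm, h3 i hi, smul_zero]

lemma eq_zero_of_van {ι : Type} [Fintype ι] (y : ι → A)
    (hy : Ideal.span (Set.range y) = maximalIdeal A) {C : Type u} [AddCommGroup C] [Module A C]
    (hk : Van A (ResidueField A) C 0)
    (c : C) (hn : ∀ i, ∃ n : ℕ, y i ^ n • c = 0) : c = 0 := by
  by_contra hc
  obtain ⟨c', h1, -, h3⟩ := exists_killed y c hc hn Finset.univ
  have hle : maximalIdeal A ≤ LinearMap.ker (LinearMap.toSpanSingleton A C c') := by
    rw [← hy, Ideal.span_le]
    rintro _ ⟨i, rfl⟩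
    exact h3 i (Finset.mem_univ i)
  let f : (A ⧸ maximalIdeal A) →ₗ[A] C := Submodule.liftQ _ _ hle
  have h0 := (van_zero_iff.mp hk) f
  apply h1
  have h4 : f (Submodule.Quotient.mk 1) = c' := by
    exact (Submodule.liftQ_apply _ _ _).trans (by simp)
  rw [← h4]
  exact congrArg (fun φ : ResidueField A →ₗ[A] C => φ (Submodule.Quotient.mk (p := maximalIdeal A) 1)) h0

lemma exists_J {ι : Type} [Fintype ι] (y : ι → A)
    (hy : Ideal.span (Set.range y) = maximalIdeal A) {C : Type u} [AddCommGroup C] [Module A C]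
    (hk : Van A (ResidueField A) C 0) :
    ∃ (J : ι → Type u) (_ : ∀ i, AddCommGroup (J i)) (_ : ∀ i, Module A (J i))
      (f : C →ₗ[A] (∀ i, J i)), Function.Injective f ∧ (∀ i, Module.Injective A (J i)) ∧
      ∀ i, Function.Bijective (fun x : J i => y i • x) := by
  obtain ⟨J', _, _, f, hJ', hf⟩ := exists_embed (R := A) C
  refine ⟨fun i => LocalizedModule (Submonoid.powers (y i)) J', inferInstance, inferInstance,
    LinearMap.pi (fun i => LocalizedModule.mkLinearMap (Submonoid.powers (y i)) J' ∘ₗ f), ?_, ?_, ?_⟩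
  · rw [injective_iff_map_eq_zero]
    intro c hc
    apply eq_zero_of_van y hy hk
    intro i
    have h1 := congrFun hc i
    have h1 : LocalizedModule.mkLinearMap (Submonoid.powers (y i)) J' (f c) = 0 := h1
    rw [IsLocalizedModule.eq_zero_iff (Submonoid.powers (y i))] at h1
    obtain ⟨⟨_, n, rfl⟩, hs⟩ := h1
    refine ⟨n, hf ?_⟩
    rw [map_smul, map_zero]
    exact hs
  · intro i
    have : Module.Injective A J' := hJ'
    have h1 : Module.Injective (Localization (Submonoid.powers (y i)))
        (LocalizedModule (Submonoid.powers (y i)) J') :=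
      Module.injective_of_isLocalizedModule (Submonoid.powers (y i))
        (LocalizedModule.mkLinearMap (Submonoid.powers (y i)) J')
    exact inj_restrict (IsLocalization.flat (Localization (Submonoid.powers (y i)))
      (Submonoid.powers (y i))) h1
  · intro i
    have := IsLocalizedModule.map_units (S := Submonoid.powers (y i))
      (LocalizedModule.mkLinearMap (Submonoid.powers (y i)) J') ⟨y i, Submonoid.mem_powers _⟩
    rw [Module.End.isUnit_iff] at this
    exact this
end

section
variable {R A : Type u} [CommRing R] [IsNoetherianRing R]
  [CommRing A] [IsNoetherianRing A] [IsLocalRing A] [Algebra R A]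

lemma hom_van {ι : Type} [Fintype ι] (y : ι → R) {J : ι → Type u}
    [∀ i, AddCommGroup (J i)] [∀ i, Module A (J i)]
    (hJ : ∀ i, Function.Bijective (fun x : J i => algebraMap R A (y i) • x))
    {E Q I' : Type u} [AddCommGroup E] [Module R E] [AddCommGroup Q] [Module R Q]
    [AddCommGroup I'] [Module A I'] [Module R I'] [IsScalarTower R A I']
    (hE : ∀ i (e : E), ∃ n : ℕ, y i ^ n • e = 0) :
    Van R ((∀ i, J i) →ₗ[A] I') (E →ₗ[R] Q) 0 := by
  classical
  rw [van_zero_iff]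
  intro f
  ext φ e
  have hφ : φ = ∑ i, (φ ∘ₗ LinearMap.single A J i) ∘ₗ LinearMap.proj i := by
    refine LinearMap.ext fun x => ?_
    rw [LinearMap.sum_apply]
    simp only [LinearMap.comp_apply]
    rw [← map_sum]
    congr 1
    exact (LinearMap.sum_single_apply J x).symm
  rw [hφ, map_sum, LinearMap.sum_apply]
  refine Finset.sum_eq_zero fun i _ => ?_
  obtain ⟨n, hn⟩ := hE i e
  let m : J i ≃ₗ[A] J i := LinearEquiv.ofBijective (algebraMap R A (y i) • LinearMap.id) (hJ i)
  have hm : ∀ (k : ℕ) (x : J i), (algebraMap R A (y i)) ^ k • ((m.symm ^ k : J i ≃ₗ[A] J i) x) = x := by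
    intro k
    induction k with
    | zero => intro x; simp
    | succ k ih =>
      intro x
      rw [pow_succ', mul_smul, pow_succ]
      rw [LinearEquiv.mul_apply, ih]
      exact m.apply_symm_apply x
  have h1 : (φ ∘ₗ LinearMap.single A J i) ∘ₗ LinearMap.proj i =
      (y i ^ n) • ((φ ∘ₗ LinearMap.single A J i ∘ₗ (m.symm ^ n : J i ≃ₗ[A] J i).toLinearMap) ∘ₗ
        (LinearMap.proj i : (∀ i, J i) →ₗ[A] J i)) := by
    refine LinearMap.ext fun x => ?_
    rw [LinearMap.smul_apply, ← algebraMap_smul A (y i ^ n), map_pow]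
    simp only [LinearMap.comp_apply]
    rw [← map_smul, ← map_smul]
    congr 2
    exact (hm n _).symm
  rw [h1, map_smul, LinearMap.smul_apply, ← map_smul, hn, map_zero]

theorem main_flat (hA : Module.Flat R A) {ι : Type} [Fintype ι] (y : ι → R)
    (hy : Ideal.span (Set.range (fun i => algebraMap R A (y i))) = maximalIdeal A)
    {E Q I' : Type u} [AddCommGroup E] [Module R E] [AddCommGroup Q] [Module R Q]
    [AddCommGroup I'] [Module A I'] [Module R I'] [IsScalarTower R A I']
    (hI' : Module.Injective A I') (hEi : Module.Injective R E) (hQ : Module.Injective R Q)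
    (hE : ∀ i (e : E), ∃ n : ℕ, y i ^ n • e = 0) (t : ℕ) :
    ∀ {C : Type u} [AddCommGroup C] [Module A C] (h : ℕ), t ≤ h →
    (∀ i, t < i → ∀ (M : Type u) [AddCommGroup M] [Module A M], Van A M C i) →
    (∀ i, i < t → Van A (ResidueField A) C i) → FlatE R (C →ₗ[A] I') (E →ₗ[R] Q) h := by
  have hfl : ∀ {C : Type u} [AddCommGroup C] [Module A C], Module.Injective A C →
      Module.Flat R (C →ₗ[A] I') := fun {C} _ _ hC => by
    have : Module.Flat A (C →ₗ[A] I') := flat_hom_inj hC hI'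
    exact Module.Flat.trans R A _
  induction t with
  | zero =>
    intro C _ _ h _ h1 _
    have hC : Module.Injective A C := inj_of_van_one fun a => h1 1 (by omega) _
    cases h with
    | zero => 
      rw [flat_zero_iff]
      exact flat_hom_hom (hfl hC) hEi hQ
    | succ h => exact (van_flat_hom (hfl hC) hQ h).flat
  | succ t ih =>
    intro C _ _ h hh h1 h2
    obtain ⟨h, rfl⟩ : ∃ h', h = h' + 1 := ⟨h - 1, by omega⟩
    obtain ⟨J, _, _, f, hf, hJi, hJb⟩ := exists_J _ hy (h2 0 (by omega))
    have hJ : Module.Injective A (∀ i, J i) := Module.Injective.pi A J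
    have hs : Function.Surjective (LinearMap.range f).mkQ := Submodule.mkQ_surjective _
    have he : Function.Exact f (LinearMap.range f).mkQ := by rw [LinearMap.exact_iff]; simp
    have hkJ : ∀ i, Van A (ResidueField A) (∀ i, J i) i := by
      intro i
      cases i with
      | succ i => exact van_of_inj hJ i
      | zero =>
        rw [van_zero_iff]
        intro g
        refine LinearMap.ext fun z => funext fun i => (hJb i).1 ?_
        have hz : algebraMap R A (y i) • z = 0 := by
          rw [Algebra.smul_def]
          change residue A _ * z = 0
          rw [(residue_eq_zero_iff _).mpr, zero_mul]
          rw [← hy]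
          exact Ideal.subset_span ⟨i, rfl⟩
        have := congrFun (congrArg g hz) i
        rw [map_smul, map_zero] at this
        simpa using this
    obtain ⟨l1, l2, l3⟩ := lcomp_ses hI' hf hs he
    refine flat_c3 (f := (LinearMap.lcomp A I' (LinearMap.range f).mkQ).restrictScalars R)
      (g := (LinearMap.lcomp A I' f).restrictScalars R) l1 l2 l3
      (n := h) ?_ (van_flat_hom (hfl hJ) hQ h) (ih h (by omega) ?_ ?_)
    · cases h with
      | zero => exact hom_van y hJb hE
      | succ h => exact van_flat_hom (hfl hJ) hQ h
    · intro i hi M _ _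
      obtain ⟨i, rfl⟩ : ∃ h', i = h' + 1 := ⟨i - 1, by omega⟩
      exact van_v3 hf hs he (h1 _ (by omega) M) (van_of_inj hJ i)
    · intro i hi
      exact van_v3 hf hs he (h2 _ (by omega)) (hkJ i)
end
end DZ


namespace DZ
open CategoryTheory.Abelian IsLocalRing
section
variable {R : Type u} [CommRing R]

lemma van_of_oldExt {X Y : Type u} [AddCommGroup X] [Module R X] [AddCommGroup Y] [Module R Y]
    (m : ℕ) (h : Limits.IsZero (((_root_.Ext R (ModuleCat.{u} R) (m + 1)).obj
      (Opposite.op (ModuleCat.of R X))).obj (ModuleCat.of R Y))) : Van R X Y (m + 1) := by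
  let P := ProjectiveResolution.of (ModuleCat.of R X)
  have h1 := Limits.IsZero.of_iso h (P.isoExt (R := R) (m + 1) (ModuleCat.of R Y)).symm
  rw [← HomologicalComplex.exactAt_iff_isZero_homology,
    HomologicalComplex.exactAt_iff' _ m (m + 1) (m + 1 + 1) (by simp) (by simp),
    ShortComplex.moduleCat_exact_iff] at h1
  have key : ∀ x : EX R X Y (m + 1), x = 0 := fun x => by
    obtain ⟨φ, rfl⟩ := extMap_surj P (m + 1) Y x
    rw [extMap_ker]
    obtain ⟨ψ, hψ⟩ := h1 (ModuleCat.ofHom φ.1) (cocyc_d φ)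
    exact ⟨ModuleCat.Hom.hom ψ, congrArg ModuleCat.Hom.hom hψ⟩
  exact ⟨fun a b => by rw [key a, key b]⟩

section hull
variable [IsNoetherianRing R] {p : Ideal R} [hp : p.IsPrime] {E : Type u} [AddCommGroup E]
  [Module R E] (hE : Module.Injective R E) (f : (R ⧸ p) →ₗ[R] E) (hf : Function.Injective f)
  (hess : ∀ N : Submodule R E, N ≠ ⊥ → N ⊓ LinearMap.range f ≠ ⊥)

include hf hess in
lemma hull_inj {s : R} (hs : s ∉ p) : Function.Injective (s • LinearMap.id : E →ₗ[R] E) := by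
  rw [← LinearMap.ker_eq_bot]
  by_contra hK
  apply hess _ hK
  rw [eq_bot_iff]
  rintro _ ⟨h1, a, rfl⟩
  have h1 : s • f a = 0 := h1
  rw [← map_smul] at h1
  have h2 := hf (h1.trans (map_zero f).symm)
  obtain ⟨a, rfl⟩ := Ideal.Quotient.mk_surjective a
  rw [Algebra.smul_def, Ideal.Quotient.algebraMap_eq, ← map_mul, Ideal.Quotient.eq_zero_iff_mem] at h2
  have h3 := (hp.mem_or_mem h2).resolve_left hs
  rw [Ideal.Quotient.eq_zero_iff_mem.mpr h3, map_zero]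
  exact Submodule.zero_mem _

include hE hf hess in
lemma hull_bij {s : R} (hs : s ∉ p) : Function.Bijective (s • LinearMap.id : E →ₗ[R] E) := by
  have hi := hull_inj f hf hess hs
  refine ⟨hi, fun e => ?_⟩
  obtain ⟨g, hg⟩ := hE.out (s • LinearMap.id : E →ₗ[R] E) hi LinearMap.id
  refine ⟨g e, ?_⟩
  have := hg e
  simp only [LinearMap.smul_apply, LinearMap.id_apply, map_smul] at this ⊢
  exact this

include hE hf hess in
lemma hull_dual_bij {s : R} (hs : s ∉ p) {Q : Type u} [AddCommGroup Q] [Module R Q] :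
    Function.Bijective (fun φ : E →ₗ[R] Q => s • φ) := by
  let m : E ≃ₗ[R] E := LinearEquiv.ofBijective _ (hull_bij hE f hf hess hs)
  have hm : ∀ e, s • m.symm e = e := fun e => m.apply_symm_apply e
  constructor
  · intro φ ψ h
    ext e
    have := LinearMap.congr_fun h (m.symm e)
    simp only [LinearMap.smul_apply, ← map_smul, hm] at this
    exact this
  · intro φ
    refine ⟨φ ∘ₗ m.symm.toLinearMap, ?_⟩
    ext e
    simp only [LinearMap.smul_apply, LinearMap.comp_apply, LinearEquiv.coe_coe, ← map_smul, hm]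

include hf hess in
omit hp in
lemma hull_nil {x : R} (hx : x ∈ p) (e : E) : ∃ n : ℕ, x ^ n • e = 0 := by
  let c : ℕ →o Ideal R := ⟨fun n => LinearMap.ker (LinearMap.toSpanSingleton R E (x ^ n • e)), by
    apply monotone_nat_of_le_succ
    intro n r hr
    rw [LinearMap.mem_ker, LinearMap.toSpanSingleton_apply] at hr ⊢
    rw [pow_succ', mul_smul, smul_comm, hr, smul_zero]⟩
  obtain ⟨n, hn⟩ := monotone_stabilizes_iff_noetherian.mpr (inferInstanceAs (IsNoetherian R R)) c
  refine ⟨n, ?_⟩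
  by_contra hne
  apply hess (Submodule.span R {x ^ n • e})
  · simpa using hne
  rw [eq_bot_iff]
  rintro _ ⟨h1, a, rfl⟩
  obtain ⟨r, hr⟩ := Submodule.mem_span_singleton.mp h1
  have hxa : x • a = 0 := by
    obtain ⟨a, rfl⟩ := Ideal.Quotient.mk_surjective a
    rw [Algebra.smul_def, Ideal.Quotient.algebraMap_eq, ← map_mul, Ideal.Quotient.eq_zero_iff_mem]
    exact p.mul_mem_right _ hx
  have h2 : r ∈ c (n + 1) := by
    change r • (x ^ (n + 1) • e) = 0
    rw [pow_succ', mul_smul, smul_comm, hr, ← map_smul, hxa, map_zero]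
  rw [← hn (n + 1) (by omega)] at h2
  have h2 : r • (x ^ n • e) = 0 := h2
  rw [← hr, h2]
  exact Submodule.zero_mem _
end hull

section loc
variable [IsNoetherianRing R] (S : Submonoid R)

lemma inj_localized {J : Type u} [AddCommGroup J] [Module R J] (hJ : Module.Injective R J) :
    Module.Injective (Localization S) (LocalizedModule S J) := by
  have : Module.Injective R J := hJ
  exact Module.injective_of_isLocalizedModule S (LocalizedModule.mkLinearMap S J)

lemma hom_localized {N Z : Type u} [AddCommGroup N] [Module R N] [Module.Finite R N]
    [AddCommGroup Z] [Module R Z] 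
    (φ : LocalizedModule S N →ₗ[Localization S] LocalizedModule S Z) :
    ∃ (s : S) (φ0 : N →ₗ[R] Z), φ = Localization.mk 1 s • LocalizedModule.map S φ0 := by
  have : Module.FinitePresentation R N := Module.finitePresentation_of_finite R N
  obtain ⟨⟨φ0, s⟩, h⟩ := IsLocalizedModule.surj S (IsLocalizedModule.mapExtendScalars S
    (LocalizedModule.mkLinearMap S N) (LocalizedModule.mkLinearMap S Z) (Localization S)) φ
  refine ⟨s, φ0, ?_⟩
  have h' : s • φ = LocalizedModule.map S φ0 := h
  rw [← h']
  have h1 : s • φ = (algebraMap R (Localization S) s) • φ := by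
    rw [algebraMap_smul]; rfl
  rw [h1, smul_smul, ← Localization.mk_one_eq_algebraMap, Localization.mk_mul]
  rw [one_mul, mul_one, Localization.mk_self, one_smul]

lemma van_localized (i : ℕ) {N : Type u} [AddCommGroup N] [Module R N] [Module.Finite R N] :
    ∀ {M : Type u} [AddCommGroup M] [Module R M], Van R N M (i + 1) →
    Van (Localization S) (LocalizedModule S N) (LocalizedModule S M) (i + 1) := by
  induction i with
  | zero =>
    intro M _ _ h
    obtain ⟨J, _, _, f, hJ, hf⟩ := exists_embed (R := R) M
    have hs : Function.Surjective (LinearMap.range f).mkQ := Submodule.mkQ_surjective _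
    have he : Function.Exact f (LinearMap.range f).mkQ := by rw [LinearMap.exact_iff]; simp
    refine van_one_of_ext (LocalizedModule.map_injective S f hf)
      (LocalizedModule.map_surjective S _ hs) (LocalizedModule.map_exact S _ _ he)
      (van_of_inj (inj_localized S hJ) 0) ?_
    intro φ
    obtain ⟨s, φ0, rfl⟩ := hom_localized S φ
    obtain ⟨ψ, rfl⟩ := lift_of_van_one hf hs he h φ0
    refine ⟨Localization.mk 1 s • LocalizedModule.map S ψ, ?_⟩
    rw [LinearMap.comp_smul]
    congr 1
    refine LinearMap.ext fun x => ?_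
    induction x using LocalizedModule.induction_on with
    | _ n t => simp [LocalizedModule.map_mk]
  | succ i ih =>
    intro M _ _ h
    obtain ⟨J, _, _, f, hJ, hf⟩ := exists_embed (R := R) M
    have hs : Function.Surjective (LinearMap.range f).mkQ := Submodule.mkQ_surjective _
    have he : Function.Exact f (LinearMap.range f).mkQ := by rw [LinearMap.exact_iff]; simp
    exact van_v1 (LocalizedModule.map_injective S f hf)
      (LocalizedModule.map_surjective S _ hs) (LocalizedModule.map_exact S _ _ he)
      (van_of_inj (inj_localized S hJ) _) (ih (van_v3 hf hs he h (van_of_inj hJ _)))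

lemma cyclic_localized (a : Ideal (Localization S)) :
    ∃ (N : Type u) (_ : AddCommGroup N) (_ : Module R N), Module.Finite R N ∧
      Nonempty (LocalizedModule S N ≃ₗ[Localization S] (Localization S ⧸ a)) := by
  let X := Localization S ⧸ a
  let N : Submodule R X := Submodule.span R {1}
  refine ⟨N, inferInstance, inferInstance, inferInstance, ?_⟩
  have hb : ∀ s : S, IsUnit (algebraMap R (Module.End R X) s) := fun s => by
    have h1 := (IsLocalization.map_units (Localization S) s).map
      (algebraMap (Localization S) (Module.End (Localization S) X))
    rw [Module.End.isUnit_iff] at h1 ⊢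
    convert h1 using 1
    ext x
    simp [Module.algebraMap_end_apply]
  have hloc : IsLocalizedModule S N.subtype := by
    refine ⟨hb, ?_, ?_⟩
    · intro x
      obtain ⟨x, rfl⟩ := Ideal.Quotient.mk_surjective x
      obtain ⟨r, s, rfl⟩ := IsLocalization.exists_mk'_eq S x
      refine ⟨⟨⟨r • 1, Submodule.smul_mem _ _ (Submodule.mem_span_singleton_self 1)⟩, s⟩, ?_⟩
      change (s : R) • Ideal.Quotient.mk a (IsLocalization.mk' (Localization S) r s) = r • (1 : X)
      rw [← algebraMap_smul (Localization S) (s : R), ← algebraMap_smul (Localization S) r]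
      change Ideal.Quotient.mk a (algebraMap R (Localization S) s *
        IsLocalization.mk' (Localization S) r s) =
        Ideal.Quotient.mk a (algebraMap R (Localization S) r * 1)
      rw [mul_one, mul_comm, IsLocalization.mk'_spec]
    · intro x y h
      exact ⟨1, by rw [Subtype.ext h]⟩
  exact ⟨LinearEquiv.extendScalarsOfIsLocalization S (Localization S)
    (IsLocalizedModule.iso S N.subtype)⟩
end loc
end
end DZ


namespace DZ
open CategoryTheory.Abelian IsLocalRing
section
variable {R : Type u} [CommRing R] [IsNoetherianRing R]

lemma homothety_localized (S : Submonoid R) {D : Type u} [AddCommGroup D] [Module R D]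
    [Module.Finite R D]
    (hb : Function.Bijective (fun r : R => r • (LinearMap.id : D →ₗ[R] D))) :
    Function.Bijective (fun r : Localization S => r •
      (LinearMap.id : LocalizedModule S D →ₗ[Localization S] LocalizedModule S D)) := by
  have : Module.FinitePresentation R D := Module.finitePresentation_of_finite R D
  have hid : ∀ r : R, LocalizedModule.map S (r • (LinearMap.id : D →ₗ[R] D)) =
      algebraMap R (Localization S) r • LinearMap.id := by
    intro r
    rw [map_smul, algebraMap_smul]
    congr 1
    refine LinearMap.ext fun x => ?_
    induction x using LocalizedModule.induction_on with
    | _ n t => simp [LocalizedModule.map_mk]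
  constructor
  · let T : Localization S →ₗ[Localization S] _ := LinearMap.toSpanSingleton (Localization S) _
      (LinearMap.id : LocalizedModule S D →ₗ[Localization S] LocalizedModule S D)
    change Function.Injective T
    rw [injective_iff_map_eq_zero]
    intro x hx
    obtain ⟨r, s, rfl⟩ := IsLocalization.exists_mk'_eq S x
    have h1 : algebraMap R (Localization S) r •
        (LinearMap.id : LocalizedModule S D →ₗ[Localization S] LocalizedModule S D) = 0 := by
      rw [← IsLocalization.mk'_spec (Localization S) r s, mul_comm, mul_smul]
      have hx : IsLocalization.mk' (Localization S) r s • (LinearMap.id :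
        LocalizedModule S D →ₗ[Localization S] LocalizedModule S D) = 0 := hx
      rw [hx, smul_zero]
    rw [← hid] at h1
    have h2 : IsLocalizedModule.mapExtendScalars S (LocalizedModule.mkLinearMap S D)
      (LocalizedModule.mkLinearMap S D) (Localization S) (r • LinearMap.id) = 0 := h1
    rw [IsLocalizedModule.eq_zero_iff S] at h2
    obtain ⟨c, hc⟩ := h2
    have h3 : (c : R) * r = 0 := by
      apply hb.1
      change ((c : R) * r) • (LinearMap.id : D →ₗ[R] D) = (0 : R) • LinearMap.id
      rw [mul_smul, zero_smul]
      exact hc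
    rw [IsLocalization.mk'_eq_zero_iff]
    exact ⟨c, h3⟩
  · intro φ
    obtain ⟨s, φ0, rfl⟩ := hom_localized S φ
    obtain ⟨r, rfl⟩ := hb.2 φ0
    refine ⟨Localization.mk 1 s * algebraMap R (Localization S) r, ?_⟩
    change _ = Localization.mk 1 s • LocalizedModule.map S (r • (LinearMap.id : D →ₗ[R] D))
    rw [hid, smul_smul]

theorem main_tor (D : Type u) [AddCommGroup D] [Module R D] [Module.Finite R D] (n : ℕ)
    (hn : ∀ (M : Type u) [AddCommGroup M] [Module R M], ∀ i : ℕ, n < i → Van R M D i)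
    (hb : Function.Bijective (fun r : R => r • (LinearMap.id : D →ₗ[R] D)))
    (hV : ∀ i, Van R D D (i + 1))
    (p : Ideal R) [hp : p.IsPrime] (h : ℕ) (hph : p.height = (h : ℕ∞))
    (E : Type u) [AddCommGroup E] [Module R E] (hE : Module.Injective R E)
    (f : (R ⧸ p) →ₗ[R] E) (hf : Function.Injective f)
    (hess : ∀ N : Submodule R E, N ≠ ⊥ → N ⊓ LinearMap.range f ≠ ⊥)
    (I : Type u) [AddCommGroup I] [Module R I] (hI : Module.Injective R I) :
    Module.Injective R (((Tor (ModuleCat.{u} R) h).obj (ModuleCat.of R E)).obj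
      (ModuleCat.of R (D →ₗ[R] I))) := by
  obtain ⟨Q, _, _, hQ, hcog⟩ := exists_cogen R
  have : Module.FinitePresentation R D := Module.finitePresentation_of_finite R D
  let S := p.primeCompl
  let A := Localization.AtPrime p
  refine tor_inj hQ hcog h ?_
  refine flat_of_localization S (IsLocalizedModule.mapExtendScalars S
    (LocalizedModule.mkLinearMap S D) (LocalizedModule.mkLinearMap S I) (Localization S))
    (fun s hs => hull_dual_bij hE f hf hess hs) ?_
  have hn' : ∀ i, n < i → ∀ (M : Type u) [AddCommGroup M] [Module A M],
      Van A M (LocalizedModule S D) i := by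
    intro i hi
    obtain ⟨i, rfl⟩ : ∃ j, i = j + 1 := ⟨i - 1, by omega⟩
    apply van_of_cyclic
    intro a
    obtain ⟨N, _, _, _, ⟨e⟩⟩ := cyclic_localized S a
    exact (van_localized S i (hn N _ hi)).congr_left e
  have hfin : Module.Finite A (LocalizedModule S D) :=
    Module.Finite.of_isLocalizedModule S (LocalizedModule.mkLinearMap S D)
  have hnoe : IsNoetherianRing A := IsLocalization.isNoetherianRing S A inferInstance
  obtain ⟨t, ht, h1, h2⟩ := local_dualizing (A := A) (D := LocalizedModule S D)
    (homothety_localized S hb) (fun i => van_localized S i (hV i)) n hn'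
  have hth : t ≤ h := by
    rw [IsLocalization.AtPrime.ringKrullDim_eq_height p A, hph] at ht
    exact_mod_cast ht
  obtain ⟨m, y, hy⟩ := Submodule.fg_iff_exists_fin_generating_family.mp
    (IsNoetherian.noetherian p : p.FG)
  refine main_flat (A := A) (IsLocalization.flat A S) y ?_ (inj_localized S hI) hE hQ
    (fun i e => hull_nil f hf hess (hy ▸ Submodule.subset_span ⟨i, rfl⟩) e) t h hth h1 h2
  rw [← Localization.AtPrime.map_eq_maximalIdeal]
  have h5 : Ideal.map (algebraMap R A) p = Ideal.map (algebraMap R A) (Ideal.span (Set.range y)) :=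
    congrArg _ hy.symm
  refine Eq.trans ?_ h5.symm
  rw [Ideal.map_span, ← Set.range_comp]
  rfl
end
end DZ

/-- `Tor_h^R(E(R/p), Hom_R(D, I))` is an injective module, where
`h = ht p` and `I` is injective. -/
theorem injective_tor_height_hom_dualizing
    {R : Type u} [CommRing R] [IsNoetherianRing R]
    (D : Type u) [AddCommGroup D] [Module R D] (hD : IsDualizingModule R D)
    (p : Ideal R) [hp : p.IsPrime] (h : ℕ) (hph : idealHeight p hp = (h : ℕ∞))
    (Ep : Type u) [AddCommGroup Ep] [Module R Ep]
    (hEp : IsInjectiveHull R (R ⧸ p) Ep)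
    (I : Type u) [AddCommGroup I] [Module R I] (hI : Module.Injective R I) :
    Module.Injective R
      (((Tor (ModuleCat.{u} R) h).obj (ModuleCat.of R Ep)).obj
        (ModuleCat.of R (D →ₗ[R] I))) := by
  obtain ⟨h1, ⟨n, hn⟩, h3, h4⟩ := hD
  obtain ⟨hE, f, hf, hess⟩ := hEp
  have : Module.Finite R D := h1
  refine DZ.main_tor D n (fun M _ _ i hi => ?_) h3
    (fun i => DZ.van_of_oldExt i (h4 (i + 1) (by omega))) p h ?_ Ep hE f hf hess I hI
  · obtain ⟨i, rfl⟩ : ∃ j, i = j + 1 := ⟨i - 1, by omega⟩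
    exact DZ.van_of_oldExt i (hn M _ _ (i + 1) hi)
  · exact (PrimeSpectrum.height_eq_orderHeight ⟨p, hp⟩).trans hph
end
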